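/- There exist ε > 0 and C > 0 such that the following holds. Let (u,v) be a smooth solution of the Thirring system on [1,∞) × ℝ such that u, v and all their derivatives are Schwartz in x locally uniformly in t, with data f = u(1,·), g = v(1,·) satisfying ‖⟨x⟩^{7/2} f‖_{H^5} + ‖⟨x⟩^{7/2} g‖_{H^5} ≤ ε. Then there exist bounded continuous functions f_+, f_− : (−1,1) → ℂ such that for every (t,x) with t ≥ ⟨x⟩, writing ρ = √(t²−x²), one has |u(t,x) − (t−x)^{−1/2}( e^{iρ} e^{i|f_+(x/t)|² ln ρ} f_+(x/t) + e^{−iρ} e^{i|f_−(x/t)|² ln ρ} f_−(x/t) )| ≤ C ρ^{−1/2} (t−x)^{−1/2} and |v(t,x) − (t+x)^{−1/2}( e^{iρ} e^{i|f_+(x/t)|² ln ρ} f_+(x/t) − e^{−iρ} e^{i|f_−(x/t)|² ln ρ} f_−(x/t) )| ≤ C ρ^{−1/2} (t+x)^{−1/2}. In particular the solution scatters to a linear solution modulo a logarithmic phase correction. -/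

import Mathlib

noncomputable section
open MeasureTheory

/-- Partial derivative in the first (time) variable. -/
def pt (u : ℝ → ℝ → ℂ) : ℝ → ℝ → ℂ := fun t x => deriv (fun s => u s x) t
/-- Partial derivative in the second (space) variable. -/
def px (u : ℝ → ℝ → ℂ) : ℝ → ℝ → ℂ := fun t x => deriv (fun y => u t y) x

/-- Japanese bracket ⟨x⟩ = (1+x²)^{1/2}. -/
def jb (x : ℝ) : ℝ := Real.sqrt (1 + x ^ 2)

/-- Sobolev norm ‖g‖_{H^k} = (Σ_{j=0}^k ∫ |∂_x^j g|² dx)^{1/2}. -/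
def sobNorm (k : ℕ) (f : ℝ → ℂ) : ℝ :=
  Real.sqrt (∑ j ∈ Finset.range (k + 1), ∫ x : ℝ, ‖deriv^[j] f x‖ ^ 2)

/-- Weighted Sobolev norm ‖⟨x⟩^s f‖_{H^k}. -/
def wSobNorm (s : ℝ) (k : ℕ) (f : ℝ → ℂ) : ℝ :=
  sobNorm k (fun x => ((jb x ^ s : ℝ) : ℂ) * f x)

/-- u, v and all their derivatives are Schwartz in x, locally uniformly in t. -/
def SchwartzLocUnif (u : ℝ → ℝ → ℂ) : Prop :=
  ∀ (a b n : ℕ) (A : ℝ), ∃ C : ℝ, ∀ t ∈ Set.Icc (1 : ℝ) A, ∀ x : ℝ,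
    |x| ^ n * ‖pt^[a] (px^[b] u) t x‖ ≤ C

/-- The Thirring (cubic Dirac) system: (∂_t+∂_x)u = iv + i|v|²u, (∂_t-∂_x)v = iu + i|u|²v
on [1,∞) × ℝ. -/
def Thirring (u v : ℝ → ℝ → ℂ) : Prop :=
  ∀ t x : ℝ, 1 ≤ t →
    pt u t x + px u t x = Complex.I * v t x + Complex.I * (‖v t x‖ ^ 2 : ℝ) * u t x ∧
    pt v t x - px v t x = Complex.I * u t x + Complex.I * (‖u t x‖ ^ 2 : ℝ) * v t x

/-! ### Part A: calculus in the plane -/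

section PartA
variable {E : Type*} [NormedAddCommGroup E] [NormedSpace ℝ E]

/-- first partial derivative -/
def d1 (F : ℝ × ℝ → E) (z : ℝ × ℝ) : E := fderiv ℝ F z (1, 0)
/-- second partial derivative -/
def d2 (F : ℝ × ℝ → E) (z : ℝ × ℝ) : E := fderiv ℝ F z (0, 1)

/-- smooth on an open set -/
def Sm (O : Set (ℝ × ℝ)) (F : ℝ × ℝ → E) : Prop := IsOpen O ∧ ContDiffOn ℝ (⊤ : ℕ∞) F O

theorem Sm.d1 {O : Set (ℝ × ℝ)} {F : ℝ × ℝ → E} (h : Sm O F) : Sm O (d1 F) := by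
  refine ⟨h.1, ?_⟩
  have := h.2.fderiv_of_isOpen h.1 (m := (⊤ : ℕ∞)) (by simp)
  exact this.clm_apply contDiffOn_const

theorem Sm.d2 {O : Set (ℝ × ℝ)} {F : ℝ × ℝ → E} (h : Sm O F) : Sm O (d2 F) := by
  refine ⟨h.1, ?_⟩
  have := h.2.fderiv_of_isOpen h.1 (m := (⊤ : ℕ∞)) (by simp)
  exact this.clm_apply contDiffOn_const

theorem Sm.cda {O : Set (ℝ × ℝ)} {F : ℝ × ℝ → E} (h : Sm O F) {z : ℝ × ℝ} (hz : z ∈ O) :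
    ContDiffAt ℝ (⊤ : ℕ∞) F z := h.2.contDiffAt (h.1.mem_nhds hz)

theorem Sm.da {O : Set (ℝ × ℝ)} {F : ℝ × ℝ → E} (h : Sm O F) {z : ℝ × ℝ} (hz : z ∈ O) :
    DifferentiableAt ℝ F z := (h.cda hz).differentiableAt (by simp)

theorem Sm.ca {O : Set (ℝ × ℝ)} {F : ℝ × ℝ → E} (h : Sm O F) {z : ℝ × ℝ} (hz : z ∈ O) :
    ContinuousAt F z := (h.da hz).continuousAt

theorem Sm.co {O : Set (ℝ × ℝ)} {F : ℝ × ℝ → E} (h : Sm O F) : ContinuousOn F O :=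
  h.2.continuousOn

theorem Sm.chain {O : Set (ℝ × ℝ)} {F : ℝ × ℝ → E} (h : Sm O F) {α β : ℝ → ℝ} {α' β' r : ℝ}
    (hα : HasDerivAt α α' r) (hβ : HasDerivAt β β' r) (hz : (α r, β r) ∈ O) :
    HasDerivAt (fun r => F (α r, β r)) (α' • _root_.d1 F (α r, β r) + β' • _root_.d2 F (α r, β r)) r := by
  have h1 := (h.da hz).hasFDerivAt
  have h2 := h1.comp_hasDerivAt r (hα.prodMk hβ)
  refine h2.congr_deriv ?_
  have : (α', β') = α' • ((1:ℝ), (0:ℝ)) + β' • ((0:ℝ), (1:ℝ)) := by ext <;> simp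
  rw [this, map_add, map_smul, map_smul]; simp [_root_.d1, _root_.d2]

theorem Sm.hd1 {O : Set (ℝ × ℝ)} {F : ℝ × ℝ → E} (h : Sm O F) {p q : ℝ} (hz : (p, q) ∈ O) :
    HasDerivAt (fun r => F (r, q)) (_root_.d1 F (p, q)) p := by
  simpa using h.chain (α := fun r => r) (β := fun _ => q) (hasDerivAt_id' p) (hasDerivAt_const p q) hz

theorem Sm.hd2 {O : Set (ℝ × ℝ)} {F : ℝ × ℝ → E} (h : Sm O F) {p q : ℝ} (hz : (p, q) ∈ O) :
    HasDerivAt (fun r => F (p, r)) (_root_.d2 F (p, q)) q := by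
  simpa using h.chain (α := fun _ => p) (β := fun r => r) (hasDerivAt_const q p) (hasDerivAt_id' q) hz

theorem Sm.d1_eq {O : Set (ℝ × ℝ)} {F : ℝ × ℝ → E} (h : Sm O F) {p q : ℝ} (hz : (p, q) ∈ O) {D : E}
    (hd : HasDerivAt (fun r => F (r, q)) D p) : _root_.d1 F (p, q) = D := (h.hd1 hz).unique hd

theorem Sm.d2_eq {O : Set (ℝ × ℝ)} {F : ℝ × ℝ → E} (h : Sm O F) {p q : ℝ} (hz : (p, q) ∈ O) {D : E}
    (hd : HasDerivAt (fun r => F (p, r)) D q) : _root_.d2 F (p, q) = D := (h.hd2 hz).unique hd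

theorem d1_congr {O : Set (ℝ × ℝ)} (hO : IsOpen O) {F G : ℝ × ℝ → E} (h : ∀ z ∈ O, F z = G z) :
    ∀ z ∈ O, d1 F z = d1 G z := by
  intro z hz
  have : F =ᶠ[nhds z] G := Filter.eventuallyEq_of_mem (hO.mem_nhds hz) h
  simp only [d1, this.fderiv_eq]

theorem d2_congr {O : Set (ℝ × ℝ)} (hO : IsOpen O) {F G : ℝ × ℝ → E} (h : ∀ z ∈ O, F z = G z) :
    ∀ z ∈ O, d2 F z = d2 G z := by
  intro z hz
  have : F =ᶠ[nhds z] G := Filter.eventuallyEq_of_mem (hO.mem_nhds hz) h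
  simp only [d2, this.fderiv_eq]

theorem Sm.comm {O : Set (ℝ × ℝ)} {F : ℝ × ℝ → E} (h : Sm O F) {z : ℝ × ℝ} (hz : z ∈ O) :
    _root_.d1 (_root_.d2 F) z = _root_.d2 (_root_.d1 F) z := by
  have hs := (h.cda hz).isSymmSndFDerivAt (by simp; norm_cast)
  have hf : DifferentiableAt ℝ (fderiv ℝ F) z :=
    ((h.cda hz).fderiv_right (m := 1) (by norm_cast)).differentiableAt (by simp)
  have e1 : _root_.d1 (_root_.d2 F) z = fderiv ℝ (fderiv ℝ F) z (1,0) (0,1) := by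
    unfold _root_.d1 _root_.d2
    rw [fderiv_clm_apply hf (by fun_prop)]
    simp
  have e2 : _root_.d2 (_root_.d1 F) z = fderiv ℝ (fderiv ℝ F) z (0,1) (1,0) := by
    unfold _root_.d1 _root_.d2
    rw [fderiv_clm_apply hf (by fun_prop)]
    simp
  rw [e1, e2]; exact hs _ _

theorem Sm.congr {O : Set (ℝ × ℝ)} {F G : ℝ × ℝ → E} (h : Sm O F) (hh : ∀ z ∈ O, G z = F z) :
    Sm O G := ⟨h.1, h.2.congr hh⟩

/-- derivative of an integral with fixed limits -/
theorem leib_fixed [CompleteSpace E] {O : Set (ℝ × ℝ)} {F : ℝ × ℝ → E} (h : Sm O F) {a b p : ℝ}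
    (hseg : ∀ q ∈ Set.uIcc a b, (p, q) ∈ O) :
    HasDerivAt (fun p => ∫ q in a..b, F (p, q)) (∫ q in a..b, d1 F (p, q)) p := by
  have hsub : ({p} : Set ℝ) ×ˢ Set.uIcc a b ⊆ O := by
    rintro ⟨x, y⟩ ⟨hx, hy⟩
    simp only [Set.mem_singleton_iff] at hx
    subst hx; exact hseg y hy
  obtain ⟨S, T, hS, hT, hpS, hT', hST⟩ :=
    generalized_tube_lemma isCompact_singleton isCompact_uIcc h.1 hsub
  obtain ⟨δ, hδ, hball⟩ := Metric.isOpen_iff.1 hS p (hpS rfl)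
  have hcb : ∀ r ∈ Metric.closedBall p (δ/2), ∀ q ∈ Set.uIcc a b, (r, q) ∈ O := fun r hr q hq =>
    hST ⟨hball (Metric.closedBall_subset_ball (by linarith) hr), hT' hq⟩
  have hK : IsCompact (Metric.closedBall p (δ/2) ×ˢ Set.uIcc a b) :=
    (isCompact_closedBall _ _).prod isCompact_uIcc
  have hKO : Metric.closedBall p (δ/2) ×ˢ Set.uIcc a b ⊆ O := fun z hz => hcb z.1 hz.1 z.2 hz.2
  obtain ⟨C, hC⟩ := hK.exists_bound_of_continuousOn (h.d1.co.mono hKO)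
  have hcont : ∀ G : ℝ × ℝ → E, Sm O G → ∀ r ∈ Metric.closedBall p (δ/2),
      ContinuousOn (fun q => G (r, q)) (Set.uIcc a b) := fun G hG r hr =>
    hG.co.comp (by fun_prop) (fun q hq => hcb r hr q hq)
  have hIntg : ∀ G : ℝ × ℝ → E, Sm O G → ∀ r ∈ Metric.closedBall p (δ/2),
      IntervalIntegrable (fun q => G (r, q)) volume a b := fun G hG r hr =>
    (hcont G hG r hr).intervalIntegrable
  have hpm : p ∈ Metric.closedBall p (δ/2) := Metric.mem_closedBall_self (by linarith)
  refine (intervalIntegral.hasDerivAt_integral_of_dominated_loc_of_deriv_le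
    (F := fun r q => F (r, q)) (F' := fun r q => d1 F (r, q))
    (s := Metric.closedBall p (δ/2)) (bound := fun _ => C)
    (Metric.closedBall_mem_nhds p (by linarith)) ?_ (hIntg F h p hpm) ?_ ?_ ?_ ?_).2
  · filter_upwards [Metric.closedBall_mem_nhds p (half_pos hδ)] with r hr
    exact (hIntg F h r hr).def'.aestronglyMeasurable
  · exact (hIntg _ h.d1 p hpm).def'.aestronglyMeasurable
  · refine Filter.Eventually.of_forall fun q hq r hr => hC (r, q) ⟨hr, Set.uIoc_subset_uIcc hq⟩
  · simp
  · exact Filter.Eventually.of_forall fun q hq r hr => h.hd1 (hcb r hr q (Set.uIoc_subset_uIcc hq))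

theorem Sm.ii {O : Set (ℝ × ℝ)} {F : ℝ × ℝ → E} (h : Sm O F) {a b p : ℝ}
    (hseg : ∀ q ∈ Set.uIcc a b, (p, q) ∈ O) :
    IntervalIntegrable (fun q => F (p, q)) volume a b :=
  ContinuousOn.intervalIntegrable (h.co.comp (by fun_prop) hseg)

theorem leib_edge [CompleteSpace E] {O : Set (ℝ × ℝ)} {F : ℝ × ℝ → E} (h : Sm O F)
    {β : ℝ → ℝ} {β' p : ℝ} (hβ : HasDerivAt β β' p) (hz : (p, β p) ∈ O) :
    HasDerivAt (fun r => ∫ q in β p..β r, F (r, q)) (β' • F (p, β p)) p ∧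
    ∀ᶠ r in nhds p, ∀ q ∈ Set.uIcc (β p) (β r), (r, q) ∈ O := by
  have key : ∀ ε > 0, ∀ᶠ r in nhds p, ∀ q ∈ Set.uIcc (β p) (β r), (r, q) ∈ O ∧
      ‖F (r, q) - F (p, β p)‖ ≤ ε := by
    intro ε hε
    have h1 : ∀ᶠ z in nhds (p, β p), z ∈ O ∧ ‖F z - F (p, β p)‖ ≤ ε := by
      refine Filter.Eventually.and (h.1.mem_nhds hz) ?_
      have := (h.ca hz).eventually (Metric.closedBall_mem_nhds (F (p, β p)) hε)
      filter_upwards [this] with z hz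
      simpa [dist_eq_norm] using hz
    obtain ⟨δ, hδ, hb⟩ := Metric.eventually_nhds_iff.1 h1
    have h2 : ∀ᶠ r in nhds p, dist r p < δ ∧ dist (β r) (β p) < δ :=
      Filter.Eventually.and (Metric.ball_mem_nhds p hδ) (hβ.continuousAt.eventually (Metric.ball_mem_nhds _ hδ))
    filter_upwards [h2] with r hr q hq
    refine hb ?_
    rw [Prod.dist_eq, max_lt_iff]
    refine ⟨hr.1, lt_of_le_of_lt ?_ hr.2⟩
    simp only [Real.dist_eq]
    exact Set.abs_sub_left_of_mem_uIcc hq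
  refine ⟨?_, (key 1 one_pos).mono fun r hr q hq => (hr q hq).1⟩
  rw [hasDerivAt_iff_isLittleO]
  have e1 : (fun r => (∫ q in β p..β r, F (r, q)) - (β r - β p) • F (p, β p))
      =o[nhds p] fun r => r - p := by
    refine Asymptotics.IsLittleO.trans_isBigO (g := fun r => β r - β p) ?_ ?_
    · rw [Asymptotics.isLittleO_iff]
      intro c hc
      filter_upwards [key c hc] with r hr
      have hi : IntervalIntegrable (fun q => F (r, q)) volume (β p) (β r) :=
        h.ii fun q hq => (hr q hq).1
      have : (∫ q in β p..β r, F (r, q)) - (β r - β p) • F (p, β p) =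
          ∫ q in β p..β r, (F (r, q) - F (p, β p)) := by
        rw [intervalIntegral.integral_sub hi (by simp), intervalIntegral.integral_const]
      rw [this]
      refine (intervalIntegral.norm_integral_le_of_norm_le_const
        fun q hq => (hr q (Set.uIoc_subset_uIcc hq)).2).trans (by simp)
    · exact hβ.isBigO_sub
  have e2 : (fun r => (β r - β p - (r - p) • β') • F (p, β p)) =o[nhds p] fun r => r - p := by
    have := hasDerivAt_iff_isLittleO.1 hβ
    have h3 := this.smul_isBigO (Asymptotics.isBigO_refl (fun _ : ℝ => F (p, β p)) (nhds p))
    refine h3.trans_isBigO ?_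
    refine Asymptotics.IsBigO.of_bound ‖F (p, β p)‖ (Filter.Eventually.of_forall fun r => ?_)
    rw [norm_smul, mul_comm]
  refine (e1.add e2).congr (fun r => ?_) (fun r => rfl)
  simp [sub_smul, mul_smul]

theorem leib [CompleteSpace E] {O : Set (ℝ × ℝ)} {F : ℝ × ℝ → E} (h : Sm O F)
    {α β : ℝ → ℝ} {α' β' p : ℝ} (hα : HasDerivAt α α' p) (hβ : HasDerivAt β β' p)
    (hseg : ∀ q ∈ Set.uIcc (α p) (β p), (p, q) ∈ O) :
    HasDerivAt (fun r => ∫ q in α r..β r, F (r, q))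
      (β' • F (p, β p) - α' • F (p, α p) + ∫ q in α p..β p, d1 F (p, q)) p := by
  have hA := leib_edge h hα (hseg _ Set.left_mem_uIcc)
  have hB := leib_edge h hβ (hseg _ Set.right_mem_uIcc)
  have hM := leib_fixed h hseg
  have hsum := (hB.1.sub hA.1).add hM
  refine hsum.congr_of_eventuallyEq ?_
  have hsub : ({p} : Set ℝ) ×ˢ Set.uIcc (α p) (β p) ⊆ O := by
    rintro ⟨x, y⟩ ⟨hx, hy⟩
    simp only [Set.mem_singleton_iff] at hx
    subst hx; exact hseg y hy
  obtain ⟨S, T, hS, hT, hpS, hT', hST⟩ :=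
    generalized_tube_lemma isCompact_singleton isCompact_uIcc h.1 hsub
  filter_upwards [hA.2, hB.2, hS.mem_nhds (hpS rfl)] with r h1 h2 h3
  have i1 := h.ii h1
  have i2 := h.ii h2
  have i3 : IntervalIntegrable (fun q => F (r, q)) volume (α p) (β p) :=
    h.ii fun q hq => hST ⟨h3, hT' hq⟩
  have := intervalIntegral.integral_add_adjacent_intervals i3 i2
  have h5 := intervalIntegral.integral_add_adjacent_intervals i1.symm (i3.trans i2)
  simp only [Pi.add_apply, Pi.sub_apply]
  rw [← h5, ← this, intervalIntegral.integral_symm (α p) (α r)]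
  abel

end PartA

/-! ### Part B: one-variable inequalities -/

theorem sob_diff {f f' : ℝ → ℂ} {a b c : ℝ} (hab : a ≤ b) (hc : 0 < c)
    (hd : ∀ q ∈ Set.Icc a b, HasDerivAt f (f' q) q) (hf' : ContinuousOn f' (Set.Icc a b))
    {z q : ℝ} (hz : z ∈ Set.Icc a b) (hq : q ∈ Set.Icc a b) :
    ‖f q‖ ^ 2 ≤ ‖f z‖ ^ 2 + (c * (∫ s in a..b, ‖f s‖ ^ 2) + c⁻¹ * ∫ s in a..b, ‖f' s‖ ^ 2) := by
  have hf : ContinuousOn f (Set.Icc a b) := fun q hq => (hd q hq).continuousAt.continuousWithinAt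
  have hu : Set.uIcc a b = Set.Icc a b := Set.uIcc_of_le hab
  have hsub : Set.uIcc z q ⊆ Set.Icc a b := by rw [← hu]; exact Set.uIcc_subset_uIcc (hu ▸ hz) (hu ▸ hq)
  set g' : ℝ → ℝ := fun s => 2 * inner ℝ (f s) (f' s) with hg'
  have hg'c : ContinuousOn g' (Set.Icc a b) := (hf.inner hf').const_smul (2:ℝ)
  have h1 : ∫ s in z..q, g' s = ‖f q‖ ^ 2 - ‖f z‖ ^ 2 :=
    intervalIntegral.integral_eq_sub_of_hasDerivAt (f := fun s => ‖f s‖ ^ 2)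
      (fun s hs => (hd s (hsub hs)).norm_sq) ((hg'c.mono hsub).intervalIntegrable)
  have hk : ContinuousOn (fun s => c * ‖f s‖ ^ 2 + c⁻¹ * ‖f' s‖ ^ 2) (Set.Icc a b) := by fun_prop
  have hki := (hu ▸ hk : ContinuousOn _ (Set.uIcc a b)).intervalIntegrable (μ := volume)
  have h2 : |∫ s in z..q, g' s| ≤ |∫ s in z..q, (c * ‖f s‖ ^ 2 + c⁻¹ * ‖f' s‖ ^ 2)| := by
    rw [← Real.norm_eq_abs, ← Real.norm_eq_abs]
    refine intervalIntegral.norm_integral_le_abs_of_norm_le ?_ ?_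
    · filter_upwards with s
      have h3 : |inner ℝ (f s) (f' s)| ≤ ‖f s‖ * ‖f' s‖ := abs_real_inner_le_norm _ _
      have h4 : 0 ≤ (c * ‖f s‖ - ‖f' s‖) ^ 2 * c⁻¹ := by positivity
      have h5 : (c * ‖f s‖ - ‖f' s‖) ^ 2 * c⁻¹ =
        c * ‖f s‖ ^ 2 + c⁻¹ * ‖f' s‖ ^ 2 - 2 * (‖f s‖ * ‖f' s‖) := by field_simp; ring
      simp only [hg', Real.norm_eq_abs, abs_mul, abs_two]
      linarith
    · exact (hk.mono hsub).intervalIntegrable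
  have h6 : |∫ s in z..q, (c * ‖f s‖ ^ 2 + c⁻¹ * ‖f' s‖ ^ 2)| ≤
      ∫ s in a..b, (c * ‖f s‖ ^ 2 + c⁻¹ * ‖f' s‖ ^ 2) := by
    rw [intervalIntegral.abs_integral_eq_abs_integral_uIoc, intervalIntegral.integral_of_le hab,
      abs_of_nonneg (integral_nonneg fun s => by positivity)]
    refine setIntegral_mono_set ?_ (Filter.Eventually.of_forall fun s => by simp only [Pi.zero_apply]; positivity) ?_
    · exact (intervalIntegrable_iff_integrableOn_Ioc_of_le hab).1 hki
    · exact (Set.Ioc_subset_Ioc (le_min hz.1 hq.1) (max_le hz.2 hq.2)).eventuallyLE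
  have h7 : (∫ s in a..b, (c * ‖f s‖ ^ 2 + c⁻¹ * ‖f' s‖ ^ 2)) =
      c * (∫ s in a..b, ‖f s‖ ^ 2) + c⁻¹ * ∫ s in a..b, ‖f' s‖ ^ 2 := by
    rw [intervalIntegral.integral_add, intervalIntegral.integral_const_mul,
      intervalIntegral.integral_const_mul] <;>
    · apply ContinuousOn.intervalIntegrable; rw [hu]; fun_prop
  have := le_abs_self (∫ s in z..q, g' s)
  linarith

theorem sob_int {f f' : ℝ → ℂ} {a b c : ℝ} (hab : a + 2 ≤ b) (hc : 0 < c)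
    (hd : ∀ q ∈ Set.Icc a b, HasDerivAt f (f' q) q) (hf' : ContinuousOn f' (Set.Icc a b))
    {q : ℝ} (hq : q ∈ Set.Icc a b) :
    ‖f q‖ ^ 2 ≤ (1 / 2 + c) * (∫ s in a..b, ‖f s‖ ^ 2) + c⁻¹ * ∫ s in a..b, ‖f' s‖ ^ 2 := by
  have hf : ContinuousOn f (Set.Icc a b) := fun q hq => (hd q hq).continuousAt.continuousWithinAt
  have hu : Set.uIcc a b = Set.Icc a b := Set.uIcc_of_le (by linarith)
  set K := c * (∫ s in a..b, ‖f s‖ ^ 2) + c⁻¹ * ∫ s in a..b, ‖f' s‖ ^ 2 with hK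
  have h1 : ∫ z in a..b, (‖f q‖ ^ 2 - K) ≤ ∫ z in a..b, ‖f z‖ ^ 2 := by
    refine intervalIntegral.integral_mono_on (by linarith) (by simp) ?_ ?_
    · apply ContinuousOn.intervalIntegrable; rw [hu]; fun_prop
    · intro z hz
      have := sob_diff (by linarith) hc hd hf' hz hq
      linarith
  rw [intervalIntegral.integral_const, smul_eq_mul] at h1
  have h0 : 0 ≤ ∫ z in a..b, ‖f z‖ ^ 2 :=
    intervalIntegral.integral_nonneg (by linarith) fun _ _ => by positivity
  have : ‖f q‖ ^ 2 - K ≤ 1 / 2 * ∫ z in a..b, ‖f z‖ ^ 2 := by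
    by_contra hcon
    push Not at hcon
    nlinarith
  linarith

theorem avg_bound {f : ℝ → ℂ} (hf : ContinuousOn f (Set.Icc 0 1)) {X : ℝ} (hX : 0 < X)
    (h : ∫ s in (0:ℝ)..1, ‖f s‖ ^ 2 ≤ X ^ 2) : ‖∫ s in (0:ℝ)..1, f s‖ ≤ X := by
  have hu : Set.uIcc (0:ℝ) 1 = Set.Icc 0 1 := Set.uIcc_of_le (by norm_num)
  have h1 : ‖∫ s in (0:ℝ)..1, f s‖ ≤ ∫ s in (0:ℝ)..1, (X / 2 + (2 * X)⁻¹ * ‖f s‖ ^ 2) := by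
    refine intervalIntegral.norm_integral_le_of_norm_le (by norm_num) ?_ ?_
    · filter_upwards with s _
      have h4 : 0 ≤ (X - ‖f s‖) ^ 2 * (2 * X)⁻¹ := by positivity
      have h5 : (X - ‖f s‖) ^ 2 * (2 * X)⁻¹ = X / 2 + (2 * X)⁻¹ * ‖f s‖ ^ 2 - ‖f s‖ := by
        field_simp; ring
      linarith
    · apply ContinuousOn.intervalIntegrable; rw [hu]; fun_prop
  rw [intervalIntegral.integral_add (by simp) (by
    apply ContinuousOn.intervalIntegrable; rw [hu]; fun_prop),
    intervalIntegral.integral_const_mul] at h1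
  simp only [intervalIntegral.integral_const, sub_zero, one_smul] at h1
  have : (2 * X)⁻¹ * ∫ s in (0:ℝ)..1, ‖f s‖ ^ 2 ≤ (2 * X)⁻¹ * X ^ 2 := by gcongr
  have h6 : (2 * X)⁻¹ * X ^ 2 = X / 2 := by field_simp
  linarith

theorem tail_bound {W W' : ℝ → ℂ} {c a b : ℝ} (ha : 0 < a) (hab : a ≤ b) (hc : 0 ≤ c)
    (hd : ∀ r ∈ Set.Icc a b, HasDerivAt W (W' r) r)
    (hb : ∀ r ∈ Set.Icc a b, ‖W' r‖ ≤ c * r ^ (-(8:ℝ) / 5)) :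
    ‖W b - W a‖ ≤ 5 / 3 * c * a ^ (-(3:ℝ) / 5) := by
  have hB : ∀ r, 0 < r → HasDerivAt (fun r : ℝ => 5 / 3 * c * (a ^ (-(3:ℝ) / 5) - r ^ (-(3:ℝ) / 5)))
      (c * r ^ (-(8:ℝ) / 5)) r := by
    intro r hr
    have := ((Real.hasDerivAt_rpow_const (p := -(3:ℝ)/5) (Or.inl hr.ne')).const_sub
      (a ^ (-(3:ℝ) / 5))).const_mul (5/3*c)
    refine this.congr_deriv ?_
    rw [show (-(3:ℝ)/5 - 1) = -(8:ℝ)/5 by norm_num]; ring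
  have h1 := image_norm_le_of_norm_deriv_right_le_deriv_boundary' (f := fun r => W r - W a) (f' := W') (a := a) (b := b)
    (B := fun r : ℝ => 5 / 3 * c * (a ^ (-(3:ℝ) / 5) - r ^ (-(3:ℝ) / 5)))
    (B' := fun r => c * r ^ (-(8:ℝ) / 5))
    (fun r hr => ((hd r hr).sub_const _).continuousAt.continuousWithinAt)
    (fun r hr => ((hd r (Set.Ico_subset_Icc_self hr)).sub_const _).hasDerivWithinAt)
    (by simp)
    (fun r hr => (hB r (ha.trans_le hr.1)).continuousAt.continuousWithinAt)
    (fun r hr => (hB r (ha.trans_le hr.1)).hasDerivWithinAt)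
    (fun r hr => hb r (Set.Ico_subset_Icc_self hr))
    (Set.right_mem_Icc.2 hab)
  refine h1.trans ?_
  have : 0 ≤ b ^ (-(3:ℝ) / 5) := Real.rpow_nonneg (ha.le.trans hab) _
  nlinarith [mul_nonneg hc this]

/-! ### Part C: the system in hyperbolic coordinates, energies -/

/-- cubic expression -/
def T3 (P Q R : ℝ × ℝ → ℂ) (z : ℝ × ℝ) : ℂ := P z * (starRingEnd ℂ) (Q z) * R z

section smrules
variable {O : Set (ℝ × ℝ)} {F G H : ℝ × ℝ → ℂ}

theorem Sm.mul (hF : Sm O F) (hG : Sm O G) : Sm O (fun z => F z * G z) := ⟨hF.1, hF.2.mul hG.2⟩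
theorem Sm.add (hF : Sm O F) (hG : Sm O G) : Sm O (fun z => F z + G z) := ⟨hF.1, hF.2.add hG.2⟩
theorem Sm.sub (hF : Sm O F) (hG : Sm O G) : Sm O (fun z => F z - G z) := ⟨hF.1, hF.2.sub hG.2⟩
theorem Sm.conj (hF : Sm O F) : Sm O (fun z => (starRingEnd ℂ) (F z)) :=
  ⟨hF.1, Complex.conjCLE.contDiff.comp_contDiffOn hF.2⟩
theorem Sm.ofCD {E : Type*} [NormedAddCommGroup E] [NormedSpace ℝ E] (hO : IsOpen O) {F : ℝ × ℝ → E} (h : ContDiff ℝ (⊤ : ℕ∞) F) : Sm O F := ⟨hO, h.contDiffOn⟩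
theorem Sm.T3 (hF : Sm O F) (hG : Sm O G) (hH : Sm O H) : Sm O (T3 F G H) :=
  (hF.mul hG.conj).mul hH
theorem Sm.nsq (hF : Sm O F) : Sm O (fun z => ‖F z‖ ^ 2) := ⟨hF.1, hF.2.norm_sq ℝ⟩
theorem Sm.radd {F G : ℝ × ℝ → ℝ} (hF : Sm O F) (hG : Sm O G) : Sm O (fun z => F z + G z) := ⟨hF.1, hF.2.add hG.2⟩
theorem Sm.rsub {F G : ℝ × ℝ → ℝ} (hF : Sm O F) (hG : Sm O G) : Sm O (fun z => F z - G z) := ⟨hF.1, hF.2.sub hG.2⟩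
theorem Sm.rmul {F G : ℝ × ℝ → ℝ} (hF : Sm O F) (hG : Sm O G) : Sm O (fun z => F z * G z) := ⟨hF.1, hF.2.mul hG.2⟩
theorem Sm.cmul (c : ℂ) (hF : Sm O F) : Sm O (fun z => c * F z) := ⟨hF.1, contDiffOn_const.mul hF.2⟩

theorem d2_T3 (hF : Sm O F) (hG : Sm O G) (hH : Sm O H) : ∀ z ∈ O,
    d2 (T3 F G H) z = T3 (d2 F) G H z + T3 F (d2 G) H z + T3 F G (d2 H) z := by
  rintro ⟨p, q⟩ hz
  refine (hF.T3 hG hH).d2_eq hz ?_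
  have := ((hF.hd2 hz).mul (hG.hd2 hz).star).mul (hH.hd2 hz)
  refine this.congr_deriv ?_
  simp only [T3, starRingEnd_apply, Pi.mul_apply]; ring

theorem d1_T3 (hF : Sm O F) (hG : Sm O G) (hH : Sm O H) : ∀ z ∈ O,
    d1 (T3 F G H) z = T3 (d1 F) G H z + T3 F (d1 G) H z + T3 F G (d1 H) z := by
  rintro ⟨p, q⟩ hz
  refine (hF.T3 hG hH).d1_eq hz ?_
  have := ((hF.hd1 hz).mul (hG.hd1 hz).star).mul (hH.hd1 hz)
  refine this.congr_deriv ?_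
  simp only [T3, starRingEnd_apply, Pi.mul_apply]; ring

theorem d2_add (hF : Sm O F) (hG : Sm O G) : ∀ z ∈ O,
    d2 (fun z => F z + G z) z = d2 F z + d2 G z := by
  rintro ⟨p, q⟩ hz
  exact (hF.add hG).d2_eq hz ((hF.hd2 hz).add (hG.hd2 hz))

theorem d1_add (hF : Sm O F) (hG : Sm O G) : ∀ z ∈ O,
    d1 (fun z => F z + G z) z = d1 F z + d1 G z := by
  rintro ⟨p, q⟩ hz
  exact (hF.add hG).d1_eq hz ((hF.hd1 hz).add (hG.hd1 hz))

theorem d1_nsq (hF : Sm O F) : ∀ z ∈ O, d1 (fun z => ‖F z‖ ^ 2) z = 2 * inner ℝ (F z) (d1 F z) := by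
  rintro ⟨p, q⟩ hz
  exact hF.nsq.d1_eq hz (hF.hd1 hz).norm_sq

theorem d2_nsq (hF : Sm O F) : ∀ z ∈ O, d2 (fun z => ‖F z‖ ^ 2) z = 2 * inner ℝ (F z) (d2 F z) := by
  rintro ⟨p, q⟩ hz
  exact hF.nsq.d2_eq hz (hF.hd2 hz).norm_sq
end smrules

/-- domain of hyperbolic coordinates -/
def O2 : Set (ℝ × ℝ) := {z | 1 < z.1}
theorem O2_open : IsOpen O2 := isOpen_lt continuous_const continuous_fst
theorem mem_O2 {p q : ℝ} : (p, q) ∈ O2 ↔ 1 < p := Iff.rfl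

/-- complex inverse of the radial coordinate -/
def rc (z : ℝ × ℝ) : ℂ := ((z.1⁻¹ : ℝ) : ℂ)

theorem sm_rc : Sm O2 rc := by
  refine ⟨O2_open, ?_⟩
  have : ContDiffOn ℝ (⊤ : ℕ∞) (fun z : ℝ × ℝ => z.1⁻¹) O2 :=
    contDiff_fst.contDiffOn.inv (fun z (hz : 1 < z.1) => by positivity)
  exact Complex.ofRealCLM.contDiff.comp_contDiffOn this

/-- linear equation with source -/
def Lin (s : ℝ) (X Y F : ℝ × ℝ → ℂ) : Prop := ∀ z ∈ O2,
  d1 X z = -(s : ℂ) * rc z * d2 X z + Complex.I * Y z + Complex.I * rc z * F z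

theorem Lin.diff {s : ℝ} {X Y F : ℝ × ℝ → ℂ} (hX : Sm O2 X) (hY : Sm O2 Y) (hF : Sm O2 F)
    (h : Lin s X Y F) : Lin s (d2 X) (d2 Y) (d2 F) := by
  intro z hz
  rw [hX.comm hz, d2_congr O2_open h z hz]
  obtain ⟨p, q⟩ := z
  refine ((((sm_rc.mul hX.d2).cmul (-(s:ℂ))).add (hY.cmul Complex.I)).add
    ((sm_rc.mul hF).cmul Complex.I) |>.congr ?_).d2_eq hz ?_
  · intro z _; ring
  · have h1 := (((hX.d2.hd2 hz).const_mul (-(s:ℂ) * rc (p, q))).add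
      ((hY.hd2 hz).const_mul Complex.I)).add ((hF.hd2 hz).const_mul (Complex.I * rc (p, q)))
    exact h1

theorem Lin.congr {s : ℝ} {X Y F G : ℝ × ℝ → ℂ} (h : Lin s X Y F) (hG : ∀ z ∈ O2, F z = G z) :
    Lin s X Y G := fun z hz => by rw [h z hz, hG z hz]

/-- energy inequality on shrinking cones -/
theorem energy {X Y F G : ℝ × ℝ → ℂ} (hX : Sm O2 X) (hY : Sm O2 Y) (hF : Sm O2 F) (hG : Sm O2 G)
    (h1 : Lin 1 X Y F) (h2 : Lin (-1) Y X G) (Λ : ℝ) {ρ : ℝ} (hρ : 1 < ρ) (hl : 0 ≤ Λ - Real.log ρ) :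
    ∃ D, HasDerivAt (fun r => ∫ y in (-(Λ - Real.log r))..(Λ - Real.log r),
        (‖X (r, y)‖ ^ 2 + ‖Y (r, y)‖ ^ 2)) D ρ ∧
      D ≤ ρ⁻¹ * ∫ y in (-(Λ - Real.log ρ))..(Λ - Real.log ρ),
        2 * (‖F (ρ, y)‖ * ‖X (ρ, y)‖ + ‖G (ρ, y)‖ * ‖Y (ρ, y)‖) := by
  have hρ0 : 0 < ρ := by linarith
  set e : ℝ × ℝ → ℝ := fun z => ‖X z‖ ^ 2 + ‖Y z‖ ^ 2 with he
  set j : ℝ × ℝ → ℝ := fun z => ‖X z‖ ^ 2 - ‖Y z‖ ^ 2 with hj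
  have hes : Sm O2 e := hX.nsq.radd hY.nsq
  have hjs : Sm O2 j := hX.nsq.rsub hY.nsq
  have hlog : HasDerivAt (fun r => Λ - Real.log r) (-ρ⁻¹) ρ :=
    (Real.hasDerivAt_log hρ0.ne').const_sub Λ
  have hL := leib hes (α := fun r => -(Λ - Real.log r)) (α' := - -ρ⁻¹) hlog.neg hlog (p := ρ) (fun q _ => mem_O2.2 hρ)
  refine ⟨_, hL, ?_⟩
  set ℓ := Λ - Real.log ρ
  have hm : ∀ y, (ρ, y) ∈ O2 := fun y => mem_O2.2 hρ
  have hpt : ∀ y, d1 e (ρ, y) ≤ -ρ⁻¹ * d2 j (ρ, y) +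
      ρ⁻¹ * (2 * (‖F (ρ, y)‖ * ‖X (ρ, y)‖ + ‖G (ρ, y)‖ * ‖Y (ρ, y)‖)) := by
    intro y
    have e1 : d1 e (ρ, y) = 2 * inner ℝ (X (ρ, y)) (d1 X (ρ, y)) + 2 * inner ℝ (Y (ρ, y)) (d1 Y (ρ, y)) :=
      hes.d1_eq (hm y) ((hX.hd1 (hm y)).norm_sq.add (hY.hd1 (hm y)).norm_sq)
    have e2 : d2 j (ρ, y) = 2 * inner ℝ (X (ρ, y)) (d2 X (ρ, y)) - 2 * inner ℝ (Y (ρ, y)) (d2 Y (ρ, y)) :=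
      hjs.d2_eq (hm y) ((hX.hd2 (hm y)).norm_sq.sub (hY.hd2 (hm y)).norm_sq)
    rw [e1, e2, h1 _ (hm y), h2 _ (hm y)]
    have b1 : inner ℝ (X (ρ, y)) (Complex.I * F (ρ, y)) ≤ ‖F (ρ, y)‖ * ‖X (ρ, y)‖ := by
      refine (real_inner_le_norm _ _).trans ?_
      rw [norm_mul, Complex.norm_I, one_mul, mul_comm]
    have b2 : inner ℝ (Y (ρ, y)) (Complex.I * G (ρ, y)) ≤ ‖G (ρ, y)‖ * ‖Y (ρ, y)‖ := by
      refine (real_inner_le_norm _ _).trans ?_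
      rw [norm_mul, Complex.norm_I, one_mul, mul_comm]
    have hr : 0 < ρ⁻¹ := inv_pos.2 hρ0
    have b3 := mul_le_mul_of_nonneg_left b1 hr.le
    have b4 := mul_le_mul_of_nonneg_left b2 hr.le
    simp only [Complex.inner, rc] at b3 b4 ⊢
    simp only [Complex.mul_re, Complex.mul_im, Complex.add_re, Complex.add_im, Complex.conj_re,
      Complex.conj_im, Complex.I_re, Complex.I_im, Complex.ofReal_re, Complex.ofReal_im,
      Complex.neg_re, Complex.neg_im] at b3 b4 ⊢
    linarith
  have hi1 : IntervalIntegrable (fun y => d1 e (ρ, y)) volume (-ℓ) ℓ := hes.d1.ii fun q _ => hm q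
  have hi2 : IntervalIntegrable (fun y => d2 j (ρ, y)) volume (-ℓ) ℓ := hjs.d2.ii fun q _ => hm q
  have hc : ∀ W : ℝ × ℝ → ℂ, Sm O2 W → Continuous (fun y => W (ρ, y)) := fun W hW =>
    continuous_iff_continuousAt.2 fun y => ContinuousAt.comp (f := fun y => (ρ, y)) (hW.ca (hm y)) (by fun_prop)
  have hi3 : IntervalIntegrable (fun y => 2 * (‖F (ρ, y)‖ * ‖X (ρ, y)‖ + ‖G (ρ, y)‖ * ‖Y (ρ, y)‖))
      volume (-ℓ) ℓ := by
    apply Continuous.intervalIntegrable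
    exact continuous_const.mul (((hc F hF).norm.mul (hc X hX).norm).add ((hc G hG).norm.mul (hc Y hY).norm))
  have hIntg := intervalIntegral.integral_mono_on (by linarith : -ℓ ≤ ℓ) hi1
    ((hi2.const_mul (-ρ⁻¹)).add (hi3.const_mul ρ⁻¹)) (fun y _ => hpt y)
  rw [intervalIntegral.integral_add (hi2.const_mul _) (hi3.const_mul _),
    intervalIntegral.integral_const_mul, intervalIntegral.integral_const_mul,
    intervalIntegral.integral_eq_sub_of_hasDerivAt (f := fun y => j (ρ, y)) (fun y _ => hjs.hd2 (hm y)) hi2] at hIntg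
  have hb : -ρ⁻¹ • e (ρ, ℓ) - - -ρ⁻¹ • e (ρ, -ℓ) + -ρ⁻¹ * (j (ρ, ℓ) - j (ρ, -ℓ)) ≤ 0 := by
    have : -ρ⁻¹ • e (ρ, ℓ) - - -ρ⁻¹ • e (ρ, -ℓ) + -ρ⁻¹ * (j (ρ, ℓ) - j (ρ, -ℓ)) =
      -(ρ⁻¹ * (2 * ‖X (ρ, ℓ)‖ ^ 2 + 2 * ‖Y (ρ, -ℓ)‖ ^ 2)) := by
      simp only [he, hj, smul_eq_mul]; ring
    rw [this]
    have : 0 ≤ ρ⁻¹ * (2 * ‖X (ρ, ℓ)‖ ^ 2 + 2 * ‖Y (ρ, -ℓ)‖ ^ 2) := by positivity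
    linarith
  linarith

/-! ### Part D: growth of the energies under the bootstrap assumption -/

theorem fence {f B B' : ℝ → ℝ} {a b : ℝ}
    (hB : ∀ r ∈ Set.Icc a b, HasDerivAt B (B' r) r) (h0 : f a ≤ B a)
    (hf : ∀ r ∈ Set.Icc a b, ∃ D, HasDerivAt f D r ∧ (f r = B r → D < B' r)) :
    ∀ r ∈ Set.Icc a b, f r ≤ B r := by
  intro r hr
  refine image_le_of_deriv_right_lt_deriv_boundary' (f := f) (f' := deriv f) (B := B) (B' := B')
    (fun r hr => ?_) (fun r hr => ?_) h0
    (fun r hr => (hB r hr).continuousAt.continuousWithinAt)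
    (fun r hr => (hB r (Set.Ico_subset_Icc_self hr)).hasDerivWithinAt) (fun r hr h => ?_) hr
  · obtain ⟨D, hD, _⟩ := hf r hr
    exact hD.continuousAt.continuousWithinAt
  · obtain ⟨D, hD, _⟩ := hf r (Set.Ico_subset_Icc_self hr)
    exact (hD.differentiableAt.hasDerivAt).hasDerivWithinAt
  · obtain ⟨D, hD, h2⟩ := hf r (Set.Ico_subset_Icc_self hr)
    rw [hD.deriv]; exact h2 h

theorem fence_pow {f : ℝ → ℝ} {a b c s : ℝ} (ha : 1 ≤ a)
    (h0 : f a ≤ c * a ^ s)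
    (hf : ∀ r ∈ Set.Icc a b, ∃ D, HasDerivAt f D r ∧ (f r = c * r ^ s → D < s * r⁻¹ * (c * r ^ s))) :
    ∀ r ∈ Set.Icc a b, f r ≤ c * r ^ s := by
  refine fence (B := fun r => c * r ^ s) (B' := fun r => s * r⁻¹ * (c * r ^ s)) (fun r hr => ?_) h0 hf
  have hr0 : 0 < r := by linarith [hr.1]
  refine ((Real.hasDerivAt_rpow_const (Or.inl hr0.ne')).const_mul c).congr_deriv ?_
  rw [Real.rpow_sub_one hr0.ne']; field_simp

/-- the system -/
structure Sys (U V : ℝ × ℝ → ℂ) : Prop where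
  smU : Sm O2 U
  smV : Sm O2 V
  eqU : Lin 1 U V (T3 V V U)
  eqV : Lin (-1) V U (T3 U U V)

theorem norm_T3 (P Q R : ℝ × ℝ → ℂ) (z : ℝ × ℝ) : ‖T3 P Q R z‖ = ‖P z‖ * ‖Q z‖ * ‖R z‖ := by
  simp [T3]

theorem d2c_eq {P R : ℝ × ℝ → ℂ} {O} (hP : Sm O P) (hR : Sm O R) : ∀ z ∈ O,
    d2 (T3 P P R) z = T3 (d2 P) P R z + T3 P (d2 P) R z + T3 P P (d2 R) z := d2_T3 hP hP hR

theorem d2c_bound {P R : ℝ × ℝ → ℂ} (hP : Sm O2 P) (hR : Sm O2 R) {z} (hz : z ∈ O2) {κ : ℝ}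
    (h1 : ‖P z‖ ≤ κ) (h2 : ‖R z‖ ≤ κ) :
    ‖d2 (T3 P P R) z‖ ≤ κ ^ 2 * (2 * ‖d2 P z‖ + ‖d2 R z‖) := by
  rw [d2c_eq hP hR z hz]
  have hκ : 0 ≤ κ := (norm_nonneg _).trans h1
  refine (norm_add₃_le).trans ?_
  simp only [norm_T3]
  have e1 : ‖d2 P z‖ * ‖P z‖ * ‖R z‖ ≤ ‖d2 P z‖ * κ * κ := by gcongr
  have e2 : ‖P z‖ * ‖d2 P z‖ * ‖R z‖ ≤ κ * ‖d2 P z‖ * κ := by gcongr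
  have e3 : ‖P z‖ * ‖P z‖ * ‖d2 R z‖ ≤ κ * κ * ‖d2 R z‖ := by gcongr
  linarith

theorem d22c_bound {P R : ℝ × ℝ → ℂ} (hP : Sm O2 P) (hR : Sm O2 R) {z} (hz : z ∈ O2) {κ : ℝ}
    (h1 : ‖P z‖ ≤ κ) (h2 : ‖R z‖ ≤ κ) :
    ‖d2 (d2 (T3 P P R)) z‖ ≤ κ ^ 2 * (2 * ‖d2 (d2 P) z‖ + ‖d2 (d2 R) z‖) +
      κ * (2 * ‖d2 P z‖ ^ 2 + 4 * ‖d2 P z‖ * ‖d2 R z‖) := by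
  have hκ : 0 ≤ κ := (norm_nonneg _).trans h1
  have hP1 := hP.d2
  have hR1 := hR.d2
  rw [d2_congr O2_open (d2c_eq hP hR) z hz,
    d2_add ((hP1.T3 hP hR).add (hP.T3 hP1 hR)) (hP.T3 hP hR1) z hz,
    d2_add (hP1.T3 hP hR) (hP.T3 hP1 hR) z hz, d2_T3 hP1 hP hR z hz, d2_T3 hP hP1 hR z hz,
    d2_T3 hP hP hR1 z hz]
  refine (norm_add₃_le).trans ?_
  have b1 := norm_add₃_le (a := T3 (d2 (d2 P)) P R z) (b := T3 (d2 P) (d2 P) R z) (c := T3 (d2 P) P (d2 R) z)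
  have b2 := norm_add₃_le (a := T3 (d2 P) (d2 P) R z) (b := T3 P (d2 (d2 P)) R z) (c := T3 P (d2 P) (d2 R) z)
  have b3 := norm_add₃_le (a := T3 (d2 P) P (d2 R) z) (b := T3 P (d2 P) (d2 R) z) (c := T3 P P (d2 (d2 R)) z)
  simp only [norm_T3] at b1 b2 b3
  have e1 : ‖d2 (d2 P) z‖ * ‖P z‖ * ‖R z‖ ≤ ‖d2 (d2 P) z‖ * κ * κ := by gcongr
  have e2 : ‖P z‖ * ‖d2 (d2 P) z‖ * ‖R z‖ ≤ κ * ‖d2 (d2 P) z‖ * κ := by gcongr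
  have e3 : ‖P z‖ * ‖P z‖ * ‖d2 (d2 R) z‖ ≤ κ * κ * ‖d2 (d2 R) z‖ := by gcongr
  have e4 : ‖d2 P z‖ * ‖d2 P z‖ * ‖R z‖ ≤ ‖d2 P z‖ * ‖d2 P z‖ * κ := by gcongr
  have e5 : ‖d2 P z‖ * ‖P z‖ * ‖d2 R z‖ ≤ ‖d2 P z‖ * κ * ‖d2 R z‖ := by gcongr
  have e6 : ‖P z‖ * ‖d2 P z‖ * ‖d2 R z‖ ≤ κ * ‖d2 P z‖ * ‖d2 R z‖ := by gcongr
  linarith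

/-- local energy on a cone slice -/
def EN (X Y : ℝ × ℝ → ℂ) (Λ r : ℝ) : ℝ :=
  ∫ y in (-(Λ - Real.log r))..(Λ - Real.log r), (‖X (r, y)‖ ^ 2 + ‖Y (r, y)‖ ^ 2)

theorem Sm.slice {W : ℝ × ℝ → ℂ} (hW : Sm O2 W) {ρ : ℝ} (hρ : 1 < ρ) :
    Continuous (fun y => W (ρ, y)) :=
  continuous_iff_continuousAt.2 fun y =>
    ContinuousAt.comp (f := fun y => (ρ, y)) (hW.ca (mem_O2.2 hρ)) (by fun_prop)

theorem EN_nonneg {X Y : ℝ × ℝ → ℂ} {Λ r : ℝ} (h : 0 ≤ Λ - Real.log r) : 0 ≤ EN X Y Λ r :=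
  intervalIntegral.integral_nonneg (by linarith) fun _ _ => by positivity

theorem EN_split {X Y : ℝ × ℝ → ℂ} (hX : Sm O2 X) (hY : Sm O2 Y) {Λ r : ℝ} (hr : 1 < r) :
    EN X Y Λ r = (∫ y in (-(Λ - Real.log r))..(Λ - Real.log r), ‖X (r, y)‖ ^ 2) +
      ∫ y in (-(Λ - Real.log r))..(Λ - Real.log r), ‖Y (r, y)‖ ^ 2 := by
  unfold EN
  rw [intervalIntegral.integral_add]
  · exact ((hX.slice hr).norm.pow 2).intervalIntegrable _ _
  · exact ((hY.slice hr).norm.pow 2).intervalIntegrable _ _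

theorem sup_e {X Y : ℝ × ℝ → ℂ} (hX : Sm O2 X) (hY : Sm O2 Y) {Λ r : ℝ} (hr : 1 < r)
    (hl : 1 ≤ Λ - Real.log r) {c : ℝ} (hc : 0 < c) {y : ℝ}
    (hy : y ∈ Set.Icc (-(Λ - Real.log r)) (Λ - Real.log r)) :
    ‖X (r, y)‖ ^ 2 + ‖Y (r, y)‖ ^ 2 ≤ (1 / 2 + c) * EN X Y Λ r + c⁻¹ * EN (d2 X) (d2 Y) Λ r := by
  rw [EN_split hX hY hr, EN_split hX.d2 hY.d2 hr]
  have h1 := sob_int (f := fun y => X (r, y)) (f' := fun y => d2 X (r, y)) (by linarith) hc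
    (fun q _ => hX.hd2 (mem_O2.2 hr)) (hX.d2.slice hr).continuousOn hy
  have h2 := sob_int (f := fun y => Y (r, y)) (f' := fun y => d2 Y (r, y)) (by linarith) hc
    (fun q _ => hY.hd2 (mem_O2.2 hr)) (hY.d2.slice hr).continuousOn hy
  linarith

theorem log_mono_cone {Λ ρ ρ1 : ℝ} (h0 : 0 < ρ) (h : ρ ≤ ρ1) (hl : 1 ≤ Λ - Real.log ρ1) :
    1 ≤ Λ - Real.log ρ := by
  have := Real.log_le_log h0 h
  linarith

theorem alg1 {κ x w x2 w2 F G M : ℝ} (hκ0 : 0 ≤ κ) (hκ : κ ≤ 1) (hx : 0 ≤ x) (hw : 0 ≤ w)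
    (hx2 : 0 ≤ x2) (hw2 : 0 ≤ w2)
    (c1 : F ≤ κ ^ 2 * (2 * w2 + x2) + κ * (2 * w ^ 2 + 4 * w * x))
    (c2 : G ≤ κ ^ 2 * (2 * x2 + w2) + κ * (2 * x ^ 2 + 4 * x * w))
    (c3 : x ^ 2 + w ^ 2 ≤ M) :
    2 * (F * x2 + G * w2) ≤ 10 * κ * (x2 ^ 2 + w2 ^ 2) + 8 * κ * M * (x ^ 2 + w ^ 2) := by
  have d1 := mul_le_mul_of_nonneg_right c1 hx2
  have d2 := mul_le_mul_of_nonneg_right c2 hw2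
  have d3 : κ ^ 2 * (3 * (x2 ^ 2 + w2 ^ 2)) ≤ κ * (3 * (x2 ^ 2 + w2 ^ 2)) := by
    gcongr; nlinarith
  have d4 : 0 ≤ κ ^ 2 * (x2 - w2) ^ 2 := by positivity
  obtain ⟨e, he⟩ : ∃ e, e = x ^ 2 + w ^ 2 := ⟨_, rfl⟩
  have he0 : 0 ≤ e := by rw [he]; positivity
  have d5 : κ * (2 * w ^ 2 + 4 * w * x) * x2 ≤ κ * (4 * e) * x2 := by
    gcongr; nlinarith [sq_nonneg (x - w), sq_nonneg x]
  have d6 : κ * (2 * x ^ 2 + 4 * x * w) * w2 ≤ κ * (4 * e) * w2 := by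
    gcongr; nlinarith [sq_nonneg (x - w), sq_nonneg w]
  have d7 : 0 ≤ κ * ((e - x2) ^ 2 + (e - w2) ^ 2) := by positivity
  rw [← he] at c3 ⊢
  have d8 : κ * (e * e) ≤ κ * (M * e) := by gcongr
  linarith

set_option maxHeartbeats 1000000 in
theorem growth {U V : ℝ × ℝ → ℂ} (S : Sys U V) {a κ ρ0 ρ1 Λ : ℝ} (h0 : 1 < ρ0)
    (hκ0 : 0 ≤ κ) (hκ : κ ≤ 1 / 400) (ha : 0 < a) (ha1 : a ≤ 1) (hl : 1 ≤ Λ - Real.log ρ1)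
    (hb : ∀ ρ ∈ Set.Icc ρ0 ρ1, ∀ y ∈ Set.Icc (-(Λ - Real.log ρ)) (Λ - Real.log ρ),
      ‖U (ρ, y)‖ ≤ κ ∧ ‖V (ρ, y)‖ ≤ κ)
    (hE1 : EN (d2 U) (d2 V) Λ ρ0 ≤ a ^ 2) (hE2 : EN (d2 (d2 U)) (d2 (d2 V)) Λ ρ0 ≤ a ^ 2) :
    ∀ ρ ∈ Set.Icc ρ0 ρ1, EN (d2 U) (d2 V) Λ ρ ≤ 2 * a ^ 2 * ρ ^ (2/45 : ℝ) ∧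
      EN (d2 (d2 U)) (d2 (d2 V)) Λ ρ ≤ 4 * a ^ 2 * ρ ^ (2/15 : ℝ) := by
  have hU := S.smU
  have hV := S.smV
  have hU1 := hU.d2
  have hV1 := hV.d2
  have hU2 := hU1.d2
  have hV2 := hV1.d2
  have hNU := (hV.T3 hV hU)
  have hNV := (hU.T3 hU hV)
  have L1U := S.eqU.diff hU hV hNU
  have L1V := S.eqV.diff hV hU hNV
  have L2U := L1U.diff hU1 hV1 hNU.d2
  have L2V := L1V.diff hV1 hU1 hNV.d2
  have H1 : ∀ ρ ∈ Set.Icc ρ0 ρ1, EN (d2 U) (d2 V) Λ ρ ≤ 2 * a ^ 2 * ρ ^ (2/45 : ℝ) := by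
    refine fence_pow h0.le ?_ ?_
    · have : 1 ≤ ρ0 ^ (2/45 : ℝ) := Real.one_le_rpow h0.le (by norm_num)
      nlinarith [sq_nonneg a]
    · intro ρ hρ
      have h1ρ : 1 < ρ := h0.trans_le hρ.1
      have hlρ := log_mono_cone (by linarith) hρ.2 hl
      obtain ⟨D, hD, hDle⟩ := energy hU1 hV1 hNU.d2 hNV.d2 L1U L1V Λ h1ρ (by linarith)
      refine ⟨D, hD, fun heq => ?_⟩
      have hbd : ∫ y in (-(Λ - Real.log ρ))..(Λ - Real.log ρ),
          2 * (‖d2 (T3 V V U) (ρ, y)‖ * ‖d2 U (ρ, y)‖ + ‖d2 (T3 U U V) (ρ, y)‖ * ‖d2 V (ρ, y)‖)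
          ≤ 6 * κ ^ 2 * EN (d2 U) (d2 V) Λ ρ := by
        unfold EN
        rw [← intervalIntegral.integral_const_mul]
        refine intervalIntegral.integral_mono_on (by linarith) ?_ ?_ fun y hy => ?_
        · exact (continuous_const.mul (((hNU.d2.slice h1ρ).norm.mul (hU1.slice h1ρ).norm).add
            ((hNV.d2.slice h1ρ).norm.mul (hV1.slice h1ρ).norm))).intervalIntegrable _ _
        · exact (continuous_const.mul (((hU1.slice h1ρ).norm.pow 2).add
            ((hV1.slice h1ρ).norm.pow 2))).intervalIntegrable _ _
        · obtain ⟨bu, bv⟩ := hb ρ hρ y hy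
          have c1 := d2c_bound hV hU (mem_O2.2 h1ρ) bv bu
          have c2 := d2c_bound hU hV (mem_O2.2 h1ρ) bu bv
          set x := ‖d2 U (ρ, y)‖
          set w := ‖d2 V (ρ, y)‖
          have hx : 0 ≤ x := norm_nonneg _
          have hw : 0 ≤ w := norm_nonneg _
          have d1 := mul_le_mul_of_nonneg_right c1 hx
          have d2 := mul_le_mul_of_nonneg_right c2 hw
          nlinarith [mul_nonneg (sq_nonneg κ) (sq_nonneg (x - w))]
      rw [heq] at hbd
      have hpos : 0 < 2 * a ^ 2 * ρ ^ (2/45 : ℝ) := by positivity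
      have hinv : 0 < ρ⁻¹ := by positivity
      calc D ≤ _ := hDle
        _ ≤ ρ⁻¹ * (6 * κ ^ 2 * (2 * a ^ 2 * ρ ^ (2/45 : ℝ))) := by gcongr
        _ < ρ⁻¹ * (2/45 * (2 * a ^ 2 * ρ ^ (2/45 : ℝ))) := by
            have : 6 * κ ^ 2 < 2 / 45 := by nlinarith
            gcongr
        _ = _ := by ring
  have H2 : ∀ ρ ∈ Set.Icc ρ0 ρ1, EN (d2 (d2 U)) (d2 (d2 V)) Λ ρ ≤ 4 * a ^ 2 * ρ ^ (2/15 : ℝ) := by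
    refine fence_pow h0.le ?_ ?_
    · have : 1 ≤ ρ0 ^ (2/15 : ℝ) := Real.one_le_rpow h0.le (by norm_num)
      nlinarith [sq_nonneg a]
    · intro ρ hρ
      have h1ρ : 1 < ρ := h0.trans_le hρ.1
      have hlρ := log_mono_cone (by linarith) hρ.2 hl
      obtain ⟨D, hD, hDle⟩ := energy hU2 hV2 hNU.d2.d2 hNV.d2.d2 L2U L2V Λ h1ρ (by linarith)
      refine ⟨D, hD, fun heq => ?_⟩
      set E1 := EN (d2 U) (d2 V) Λ ρ with hE1d
      set E2 := EN (d2 (d2 U)) (d2 (d2 V)) Λ ρ with hE2d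
      have hE1n : 0 ≤ E1 := EN_nonneg (by linarith)
      have hE2n : 0 ≤ E2 := EN_nonneg (by linarith)
      have hbd : ∫ y in (-(Λ - Real.log ρ))..(Λ - Real.log ρ),
          2 * (‖d2 (d2 (T3 V V U)) (ρ, y)‖ * ‖d2 (d2 U) (ρ, y)‖
            + ‖d2 (d2 (T3 U U V)) (ρ, y)‖ * ‖d2 (d2 V) (ρ, y)‖)
          ≤ 10 * κ * E2 + 8 * κ * (((1/2 + (1 + E1)) * E1 + (1 + E1)⁻¹ * E2) * E1) := by
        have : 10 * κ * E2 + 8 * κ * (((1/2 + (1 + E1)) * E1 + (1 + E1)⁻¹ * E2) * E1) =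
          ∫ y in (-(Λ - Real.log ρ))..(Λ - Real.log ρ),
            (10 * κ * (‖d2 (d2 U) (ρ, y)‖ ^ 2 + ‖d2 (d2 V) (ρ, y)‖ ^ 2) +
             8 * κ * (((1/2 + (1 + E1)) * E1 + (1 + E1)⁻¹ * E2)) *
               (‖d2 U (ρ, y)‖ ^ 2 + ‖d2 V (ρ, y)‖ ^ 2)) := by
          rw [intervalIntegral.integral_add, intervalIntegral.integral_const_mul,
            intervalIntegral.integral_const_mul]
          · simp only [hE1d, hE2d, EN]; ring
          · exact (continuous_const.mul (((hU2.slice h1ρ).norm.pow 2).add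
              ((hV2.slice h1ρ).norm.pow 2))).intervalIntegrable _ _
          · exact (continuous_const.mul (((hU1.slice h1ρ).norm.pow 2).add
              ((hV1.slice h1ρ).norm.pow 2))).intervalIntegrable _ _
        rw [this]
        refine intervalIntegral.integral_mono_on (by linarith) ?_ ?_ fun y hy => ?_
        · exact (continuous_const.mul (((hNU.d2.d2.slice h1ρ).norm.mul (hU2.slice h1ρ).norm).add
            ((hNV.d2.d2.slice h1ρ).norm.mul (hV2.slice h1ρ).norm))).intervalIntegrable _ _
        · exact ((continuous_const.mul (((hU2.slice h1ρ).norm.pow 2).add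
              ((hV2.slice h1ρ).norm.pow 2))).add (continuous_const.mul (((hU1.slice h1ρ).norm.pow 2).add
              ((hV1.slice h1ρ).norm.pow 2)))).intervalIntegrable _ _
        · obtain ⟨bu, bv⟩ := hb ρ hρ y hy
          have c1 := d22c_bound hV hU (mem_O2.2 h1ρ) bv bu
          have c2 := d22c_bound hU hV (mem_O2.2 h1ρ) bu bv
          have c3 := sup_e hU1 hV1 h1ρ hlρ (c := 1 + E1) (by linarith) hy
          rw [← hE1d, ← hE2d] at c3
          set M := (1/2 + (1 + E1)) * E1 + (1 + E1)⁻¹ * E2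
          set x := ‖d2 U (ρ, y)‖
          set w := ‖d2 V (ρ, y)‖
          set x2 := ‖d2 (d2 U) (ρ, y)‖
          set w2 := ‖d2 (d2 V) (ρ, y)‖
          have hx : 0 ≤ x := norm_nonneg _
          have hw : 0 ≤ w := norm_nonneg _
          have hx2 : 0 ≤ x2 := norm_nonneg _
          have hw2 : 0 ≤ w2 := norm_nonneg _
          exact alg1 hκ0 (by linarith) hx hw hx2 hw2 c1 c2 c3
      have hbd2 : 10 * κ * E2 + 8 * κ * (((1/2 + (1 + E1)) * E1 + (1 + E1)⁻¹ * E2) * E1) ≤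
          κ * (18 * E2 + 16 * E1 ^ 2 + 8 * E1 ^ 3) := by
        have : (1 + E1)⁻¹ * E1 ≤ 1 := by
          rw [inv_mul_le_iff₀ (by linarith)]; linarith
        have h3 := mul_le_mul_of_nonneg_right this hE2n
        have h4 : ((1/2 + (1 + E1)) * E1 + (1 + E1)⁻¹ * E2) * E1 ≤ 2 * E1 ^ 2 + E1 ^ 3 + E2 := by
          nlinarith [sq_nonneg E1]
        nlinarith [mul_le_mul_of_nonneg_left h4 hκ0]
      have hr1 : (1:ℝ) ≤ ρ ^ (2/45 : ℝ) := Real.one_le_rpow h1ρ.le (by norm_num)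
      have hr3 : (ρ ^ (2/45 : ℝ)) ^ 3 = ρ ^ (2/15 : ℝ) := by
        rw [← Real.rpow_natCast, ← Real.rpow_mul (by linarith)]; norm_num
      set τ := ρ ^ (2/45 : ℝ)
      rw [← hr3] at heq ⊢
      have hE1le : E1 ≤ 2 * a ^ 2 * τ := H1 ρ hρ
      have g1 : E1 ^ 2 ≤ (2 * a ^ 2 * τ) ^ 2 := by gcongr
      have g2 : E1 ^ 3 ≤ (2 * a ^ 2 * τ) ^ 3 := by gcongr
      have a2 : a ^ 2 ≤ 1 := by nlinarith
      have g3 : (2 * a ^ 2 * τ) ^ 2 ≤ 4 * a ^ 2 * τ ^ 3 := by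
        have : (2 * a ^ 2 * τ) ^ 2 = 4 * a ^ 2 * τ ^ 2 * a ^ 2 := by ring
        rw [this]
        have h6 : τ ^ 2 ≤ τ ^ 3 := pow_le_pow_right₀ hr1 (by norm_num)
        calc 4 * a ^ 2 * τ ^ 2 * a ^ 2 ≤ 4 * a ^ 2 * τ ^ 3 * 1 := by gcongr
          _ = _ := by ring
      have g4 : (2 * a ^ 2 * τ) ^ 3 ≤ 8 * a ^ 2 * τ ^ 3 := by
        have : (2 * a ^ 2 * τ) ^ 3 = 8 * a ^ 2 * τ ^ 3 * (a ^ 2) ^ 2 := by ring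
        rw [this]
        have h6 : (a ^ 2) ^ 2 ≤ 1 := by nlinarith [sq_nonneg a]
        calc 8 * a ^ 2 * τ ^ 3 * (a ^ 2) ^ 2 ≤ 8 * a ^ 2 * τ ^ 3 * 1 := by gcongr
          _ = _ := by ring
      have hpos : 0 < a ^ 2 * τ ^ 3 := by positivity
      have hinv : 0 < ρ⁻¹ := by positivity
      have hfin : κ * (18 * E2 + 16 * E1 ^ 2 + 8 * E1 ^ 3) < 2 / 15 * (4 * a ^ 2 * τ ^ 3) := by
        have : 18 * E2 + 16 * E1 ^ 2 + 8 * E1 ^ 3 ≤ 200 * (a ^ 2 * τ ^ 3) := by nlinarith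
        nlinarith [mul_le_mul_of_nonneg_left this hκ0]
      calc D ≤ _ := hDle
        _ ≤ ρ⁻¹ * (κ * (18 * E2 + 16 * E1 ^ 2 + 8 * E1 ^ 3)) := by
          gcongr; exact hbd.trans hbd2
        _ < ρ⁻¹ * (2 / 15 * (4 * a ^ 2 * τ ^ 3)) := by gcongr
        _ = _ := by ring
  exact fun ρ hρ => ⟨H1 ρ hρ, H2 ρ hρ⟩

/-! ### Part E: the asymptotic ODE along rays -/

/-- oscillating phase -/
def ph (c : ℝ) (r : ℝ) : ℂ := Complex.exp (Complex.I * ((c * r : ℝ) : ℂ))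

theorem norm_ph (c r : ℝ) : ‖ph c r‖ = 1 := by
  unfold ph; rw [mul_comm, Complex.norm_exp_ofReal_mul_I]

theorem ph_deriv (c r : ℝ) : HasDerivAt (ph c) (Complex.I * c * ph c r) r := by
  unfold ph
  have h1 : HasDerivAt (fun r : ℝ => c * r) c r := by simpa using (hasDerivAt_id r).const_mul c
  have h2 := ((h1.ofReal_comp).const_mul Complex.I).cexp
  refine h2.congr_deriv ?_
  ring

theorem ph_mul (c d r : ℝ) : ph c r * ph d r = ph (c + d) r := by
  unfold ph; rw [← Complex.exp_add]; congr 1; push_cast; ring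

theorem ph_zero (r : ℝ) : ph 0 r = 1 := by simp [ph]

theorem ph_conj (c r : ℝ) : (starRingEnd ℂ) (ph c r) = ph (-c) r := by
  unfold ph; rw [← Complex.exp_conj]; congr 1
  simp [Complex.conj_ofReal]

theorem sm_ph (c : ℝ) : Sm O2 (fun z => ph c z.1) := by
  refine Sm.ofCD O2_open ?_
  unfold ph
  have h1 : ContDiff ℝ (⊤ : ℕ∞) (fun z : ℝ × ℝ => ((c * z.1 : ℝ) : ℂ)) :=
    Complex.ofRealCLM.contDiff.comp (contDiff_const.mul contDiff_fst)
  exact (contDiff_const.mul h1).cexp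

/-- profile system -/
structure ABS (ς : ℝ) (A B : ℝ × ℝ → ℂ) : Prop where
  smA : Sm O2 A
  smB : Sm O2 B
  eqA : ∀ z ∈ O2, d1 A z = -rc z * ph (-2 * ς) z.1 * d2 B z +
    Complex.I * rc z * (T3 A A A z - ph (-4 * ς) z.1 * T3 B A B z)
  eqB : ∀ z ∈ O2, d1 B z = -rc z * ph (2 * ς) z.1 * d2 A z +
    Complex.I * rc z * (T3 B B B z - ph (4 * ς) z.1 * T3 A B A z)

/-- profiles -/
def prof (ς : ℝ) (U V : ℝ × ℝ → ℂ) (z : ℝ × ℝ) : ℂ := ph (-ς) z.1 * ((U z + ς * V z) / 2)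

theorem ABS.symm {ς : ℝ} {A B : ℝ × ℝ → ℂ} (h : ABS ς A B) : ABS (-ς) B A where
  smA := h.smB
  smB := h.smA
  eqA := fun z hz => by
    rw [h.eqB z hz, show -2 * -ς = 2 * ς by ring, show -4 * -ς = 4 * ς by ring]
  eqB := fun z hz => by
    rw [h.eqA z hz, show 2 * -ς = -2 * ς by ring, show 4 * -ς = -4 * ς by ring]

theorem sm_prof {U V : ℝ × ℝ → ℂ} (S : Sys U V) (ς : ℝ) : Sm O2 (prof ς U V) := by
  have h1 := ((sm_ph (-ς)).mul (S.smU.add (S.smV.cmul ς))).cmul (1/2)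
  refine h1.congr fun z _ => ?_
  simp only [prof]; ring

theorem prof_d2 {U V : ℝ × ℝ → ℂ} (S : Sys U V) (ς : ℝ) {z} (hz : z ∈ O2) :
    d2 (prof ς U V) z = ph (-ς) z.1 * ((d2 U z + ς * d2 V z) / 2) := by
  obtain ⟨p, q⟩ := z
  refine (sm_prof S ς).d2_eq hz ?_
  exact (((S.smU.hd2 hz).add ((S.smV.hd2 hz).const_mul (ς:ℂ))).div_const 2).const_mul (ph (-ς) p)

theorem prof_d22 {U V : ℝ × ℝ → ℂ} (S : Sys U V) (ς : ℝ) {z} (hz : z ∈ O2) :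
    d2 (d2 (prof ς U V)) z = ph (-ς) z.1 * ((d2 (d2 U) z + ς * d2 (d2 V) z) / 2) := by
  rw [d2_congr O2_open (fun z hz => prof_d2 S ς hz) z hz]
  obtain ⟨p, q⟩ := z
  refine ((((sm_ph (-ς)).mul (S.smU.d2.add (S.smV.d2.cmul ς))).cmul (1/2)).congr ?_).d2_eq hz ?_
  · intro z _; ring
  exact (((S.smU.d2.hd2 hz).add ((S.smV.d2.hd2 hz).const_mul (ς:ℂ))).div_const 2).const_mul (ph (-ς) p)

theorem prof_eq {U V : ℝ × ℝ → ℂ} (S : Sys U V) {ς : ℝ} (hς : ς = 1 ∨ ς = -1) : ∀ z ∈ O2,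
    d1 (prof ς U V) z = -rc z * ph (-2 * ς) z.1 * d2 (prof (-ς) U V) z +
    Complex.I * rc z * (T3 (prof ς U V) (prof ς U V) (prof ς U V) z -
      ph (-4 * ς) z.1 * T3 (prof (-ς) U V) (prof ς U V) (prof (-ς) U V) z) := by
  intro z hz
  have hd : d1 (prof ς U V) z = Complex.I * (-ς : ℝ) * ph (-ς) z.1 * ((U z + ς * V z) / 2) +
      ph (-ς) z.1 * ((d1 U z + ς * d1 V z) / 2) := by
    obtain ⟨p, q⟩ := z
    refine (sm_prof S ς).d1_eq hz ?_
    exact (ph_deriv (-ς) p).mul (((S.smU.hd1 hz).add ((S.smV.hd1 hz).const_mul (ς:ℂ))).div_const 2)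
  rw [hd, prof_d2 S _ hz, S.eqU z hz, S.eqV z hz]
  have e2 : ph (-2 * ς) z.1 = ph (-ς) z.1 * ph (-ς) z.1 := by rw [ph_mul]; congr 1; ring
  have e4 : ph (-4 * ς) z.1 = ph (-ς) z.1 * ph (-ς) z.1 * (ph (-ς) z.1 * ph (-ς) z.1) := by
    rw [ph_mul, ph_mul]; congr 1; ring
  have hef : ph (-ς) z.1 * ph ς z.1 = 1 := by rw [ph_mul]; simp [ph_zero]
  rw [e2, e4]
  simp only [T3, prof, map_mul, ph_conj, map_add, map_div₀, Complex.conj_ofReal, neg_neg,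
    Complex.ofReal_neg, map_ofNat]
  generalize ph (-ς) z.1 = e at *
  generalize ph ς z.1 = f at *
  generalize rc z = r at *
  generalize (starRingEnd ℂ) (U z) = Uc at *
  generalize (starRingEnd ℂ) (V z) = Vc at *
  generalize U z = u at *
  generalize V z = v at *
  generalize d2 U z = u1 at *
  generalize d2 V z = v1 at *
  have k1 : e * e * f = e := by linear_combination e * hef
  have k2 : e * e * (e * e) * (f * f * f) = e := by
    linear_combination e * ((e*f)^2 + e*f + 1) * hef
  have hf1 : -r * (e * e) * (f * ((u1 + -(ς:ℂ) * v1) / 2)) = -r * e * ((u1 + -(ς:ℂ) * v1) / 2) := by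
    linear_combination -r * ((u1 + -(ς:ℂ) * v1) / 2) * k1
  rw [hf1]
  have hf2 : e * ((u + ς * v) / 2) * (f * ((Uc + ς * Vc) / 2)) * (e * ((u + ς * v) / 2)) -
      e * e * (e * e) * (f * ((u + -(ς:ℂ) * v) / 2) * (f * ((Uc + ς * Vc) / 2)) * (f * ((u + -(ς:ℂ) * v) / 2)))
      = e * ((u + ς * v) / 2 * ((Uc + ς * Vc) / 2) * ((u + ς * v) / 2) -
        (u + -(ς:ℂ) * v) / 2 * ((Uc + ς * Vc) / 2) * ((u + -(ς:ℂ) * v) / 2)) := by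
    linear_combination ((u + ς * v) / 2 * ((Uc + ς * Vc) / 2) * ((u + ς * v) / 2)) * k1 -
      ((u + -(ς:ℂ) * v) / 2 * ((Uc + ς * Vc) / 2) * ((u + -(ς:ℂ) * v) / 2)) * k2
  rw [hf2]
  rcases hς with rfl | rfl <;> push_cast <;> ring

theorem prof_ABS {U V : ℝ × ℝ → ℂ} (S : Sys U V) {ς : ℝ} (hς : ς = 1 ∨ ς = -1) :
    ABS ς (prof ς U V) (prof (-ς) U V) where
  smA := sm_prof S ς
  smB := sm_prof S (-ς)
  eqA := prof_eq S hς
  eqB := fun z hz => by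
    have := prof_eq S (ς := -ς) (by rcases hς with h | h <;> simp [h]) z hz
    rw [this, show -2 * -ς = 2 * ς by ring, show -4 * -ς = 4 * ς by ring, neg_neg]

/-- derivative of the corrected profile -/
theorem W_deriv {ς : ℝ} (hς : ς = 1 ∨ ς = -1) {At Q T : ℝ → ℂ} {Θ : ℝ → ℝ} {ρ n : ℝ} (hρ : 0 < ρ)
    {Err Q' T' : ℂ}
    (hA : HasDerivAt At (-((ρ⁻¹ : ℝ) : ℂ) * ph (-2 * ς) ρ * Q ρ +
      Complex.I * ((ρ⁻¹ : ℝ) : ℂ) * (n * At ρ - ph (-4 * ς) ρ * T ρ) + Err) ρ)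
    (hQ : HasDerivAt Q Q' ρ) (hT : HasDerivAt T T' ρ) (hΘ : HasDerivAt Θ (n * ρ⁻¹) ρ) :
    ∃ D, HasDerivAt (fun r => Complex.exp (Complex.I * ((-Θ r : ℝ) : ℂ)) * (At r +
      (Complex.I * ς / 2) * (((r⁻¹ : ℝ) : ℂ) * (ph (-2 * ς) r * Q r)) -
      (ς / 4) * (((r⁻¹ : ℝ) : ℂ) * (ph (-4 * ς) r * T r)))) D ρ ∧
      ‖D‖ ≤ ‖Err‖ + (|n| + 1) * ρ⁻¹ ^ 2 * (‖Q ρ‖ / 2 + ‖T ρ‖ / 4) + ρ⁻¹ * (‖Q'‖ / 2 + ‖T'‖ / 4) := by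
  have hi : HasDerivAt (fun r : ℝ => ((r⁻¹ : ℝ) : ℂ)) ((-(ρ ^ 2)⁻¹ : ℝ) : ℂ) ρ :=
    (hasDerivAt_inv hρ.ne').ofReal_comp
  have h1 := (hi.mul ((ph_deriv (-2 * ς) ρ).mul hQ)).const_mul (Complex.I * ς / 2)
  have h2 := (hi.mul ((ph_deriv (-4 * ς) ρ).mul hT)).const_mul ((ς : ℂ) / 4)
  have h3 := ((hΘ.neg.ofReal_comp).const_mul Complex.I).cexp
  have h4 := h3.mul ((hA.add h1).sub h2)
  refine ⟨_, h4, ?_⟩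
  set E := Complex.exp (Complex.I * ((-Θ ρ : ℝ) : ℂ)) with hE
  have hEn : ‖E‖ = 1 := by rw [hE, mul_comm, Complex.norm_exp_ofReal_mul_I]
  have hp2 := norm_ph (-2 * ς) ρ
  have hp4 := norm_ph (-4 * ς) ρ
  have hsn : ‖(ς : ℂ)‖ = 1 := by rcases hς with h | h <;> simp [h]
  have hs2 : (ς : ℂ) * ς = 1 := by rcases hς with h | h <;> simp [h]
  set p2 := ph (-2 * ς) ρ
  set p4 := ph (-4 * ς) ρ
  have hinvsq : ((-(ρ ^ 2)⁻¹ : ℝ) : ℂ) = -(((ρ⁻¹ : ℝ) : ℂ) ^ 2) := by push_cast; rw [inv_pow]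
  have hrn : ‖((ρ⁻¹ : ℝ) : ℂ)‖ = ρ⁻¹ := by rw [Complex.norm_real, Real.norm_of_nonneg (by positivity)]
  have key : ∀ (x y : ℂ), x = E * y → ‖x‖ = ‖y‖ := by rintro x y rfl; rw [norm_mul, hEn, one_mul]
  rw [key _ (Err + ((n + Complex.I * (-1)) * (((ρ⁻¹ : ℝ) : ℂ) ^ 2) * ((ς : ℂ) * p2 * Q ρ / 2)) +
     ((Complex.I * n + 1) * (((ρ⁻¹ : ℝ) : ℂ) ^ 2) * ((ς : ℂ) * p4 * T ρ / 4)) +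
     (((ρ⁻¹ : ℝ) : ℂ) * (Complex.I * ς * p2 * Q' / 2)) - (((ρ⁻¹ : ℝ) : ℂ) * ((ς : ℂ) * p4 * T' / 4)))]
  · have n1 : ‖((n : ℂ) + Complex.I * (-1))‖ ≤ |n| + 1 := by
      refine (norm_add_le _ _).trans ?_
      simp
    have n2 : ‖(Complex.I * (n : ℂ) + 1)‖ ≤ |n| + 1 := by
      refine (norm_add_le _ _).trans ?_
      simp
    refine (norm_sub_le _ _).trans ?_
    refine (add_le_add (norm_add_le _ _) le_rfl).trans ?_
    refine (add_le_add (add_le_add (norm_add_le _ _) le_rfl) le_rfl).trans ?_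
    refine (add_le_add (add_le_add (add_le_add (norm_add_le _ _) le_rfl) le_rfl) le_rfl).trans ?_
    simp only [norm_mul, norm_div, norm_pow, hsn, hp2, hp4, hrn, Complex.norm_I, Complex.norm_ofNat]
    have m1 := mul_le_mul_of_nonneg_right n1 (by positivity : 0 ≤ ρ⁻¹ ^ 2 * (‖Q ρ‖ / 2))
    have m2 := mul_le_mul_of_nonneg_right n2 (by positivity : 0 ≤ ρ⁻¹ ^ 2 * (‖T ρ‖ / 4))
    linarith
  · simp only [Pi.mul_apply, Pi.add_apply, Pi.sub_apply]
    rw [hinvsq]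
    push_cast
    linear_combination (E * ((ρ:ℂ)⁻¹ * p2 * Q ρ) + Complex.I * E * (ρ:ℂ)⁻¹ * p4 * T ρ) * hs2 -
      E * p2 * Q ρ * ((n:ℂ) * (ρ:ℂ)⁻¹ ^ 2 * ς / 2 + (ρ:ℂ)⁻¹ * ς ^ 2) * Complex.I_sq

/-! ### Part F: averages -/

/-- average over a window of width r^(-2/3) -/
def avg (F : ℝ × ℝ → ℂ) (σ y r : ℝ) : ℂ := ∫ s in (0:ℝ)..1, F (r, y + σ * r ^ (-(2:ℝ)/3) * s)

theorem avg_deriv {F : ℝ × ℝ → ℂ} (hF : Sm O2 F) (σ y : ℝ) {ρ : ℝ} (hρ : 1 < ρ) :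
    HasDerivAt (avg F σ y) (avg (d1 F) σ y ρ + ((σ * (-(2:ℝ)/3 * ρ ^ (-(5:ℝ)/3)) : ℝ) : ℂ) *
      ∫ s in (0:ℝ)..1, (s : ℂ) * d2 F (ρ, y + σ * ρ ^ (-(2:ℝ)/3) * s)) ρ := by
  set Ψ : ℝ × ℝ → ℂ := fun z => F (z.1, y + σ * z.1 ^ (-(2:ℝ)/3) * z.2) with hΨ
  have hsm : Sm O2 Ψ := by
    refine ⟨O2_open, ?_⟩
    have h1 : ContDiffOn ℝ (⊤ : ℕ∞) (fun z : ℝ × ℝ => z.1 ^ (-(2:ℝ)/3)) O2 :=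
      contDiff_fst.contDiffOn.rpow_const_of_ne (fun z (hz : 1 < z.1) => by positivity)
    have h2 : ContDiffOn ℝ (⊤ : ℕ∞) (fun z : ℝ × ℝ => (z.1, y + σ * z.1 ^ (-(2:ℝ)/3) * z.2)) O2 :=
      contDiff_fst.contDiffOn.prodMk
        (contDiffOn_const.add ((contDiffOn_const.mul h1).mul contDiff_snd.contDiffOn))
    exact hF.2.comp h2 (fun z hz => hz)
  have hL := leib_fixed hsm (a := 0) (b := 1) (p := ρ) (fun q _ => mem_O2.2 hρ)
  refine hL.congr_deriv ?_
  have hm : ∀ q, (ρ, q) ∈ O2 := fun q => mem_O2.2 hρ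
  have hd : ∀ s, d1 Ψ (ρ, s) = d1 F (ρ, y + σ * ρ ^ (-(2:ℝ)/3) * s) +
      ((σ * (-(2:ℝ)/3 * ρ ^ (-(5:ℝ)/3)) : ℝ) : ℂ) * ((s : ℂ) * d2 F (ρ, y + σ * ρ ^ (-(2:ℝ)/3) * s)) := by
    intro s
    refine hsm.d1_eq (hm s) ?_
    have hp : HasDerivAt (fun r : ℝ => y + σ * r ^ (-(2:ℝ)/3) * s)
        (σ * (-(2:ℝ)/3 * ρ ^ (-(5:ℝ)/3)) * s) ρ := by
      have h0 := Real.hasDerivAt_rpow_const (p := -(2:ℝ)/3) (x := ρ) (Or.inl (by positivity))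
      have := ((h0.const_mul σ).mul_const s).const_add y
      refine this.congr_deriv ?_
      rw [show (-(2:ℝ)/3 - 1) = -(5:ℝ)/3 by norm_num]
    have := hF.chain (hasDerivAt_id' ρ) hp (hm _)
    refine this.congr_deriv ?_
    simp only [one_smul, Complex.real_smul]; push_cast; ring
  have hc : ∀ G : ℝ × ℝ → ℂ, Sm O2 G → Continuous (fun s => G (ρ, y + σ * ρ ^ (-(2:ℝ)/3) * s)) :=
    fun G hG => (hG.slice hρ).comp (by fun_prop)
  simp only [hd]
  rw [intervalIntegral.integral_add, intervalIntegral.integral_const_mul]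
  · rfl
  · exact (hc _ hF.d1).intervalIntegrable _ _
  · exact (continuous_const.mul (Complex.continuous_ofReal.mul (hc _ hF.d2))).intervalIntegrable _ _

theorem window_mem {y σ ℓ : ℝ} (hℓ : 1 ≤ ℓ) (hy : y ∈ Set.Icc (-ℓ) ℓ)
    (hσ : σ = if 0 ≤ y then -1 else 1) {t : ℝ} (ht : t ∈ Set.Icc (0:ℝ) 1) :
    y + σ * t ∈ Set.Icc (-ℓ) ℓ := by
  obtain ⟨h1, h2⟩ := hy
  obtain ⟨h3, h4⟩ := ht
  split_ifs at hσ with h <;> subst hσ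
  · constructor <;> linarith
  · push Not at h; constructor <;> linarith

theorem window_L2 {G : ℝ × ℝ → ℂ} (hG : Sm O2 G) {y σ ℓ ρ k X : ℝ} (hρ : 1 < ρ) (hℓ : 1 ≤ ℓ)
    (hy : y ∈ Set.Icc (-ℓ) ℓ) (hσ : σ = if 0 ≤ y then -1 else 1) (hk : 0 < k) (hk1 : k ≤ 1)
    (hX : ∫ q in (-ℓ)..ℓ, ‖G (ρ, q)‖ ^ 2 ≤ k * X ^ 2) :
    ∫ s in (0:ℝ)..1, ‖G (ρ, y + σ * k * s)‖ ^ 2 ≤ X ^ 2 := by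
  have hσ0 : σ = 1 ∨ σ = -1 := by split_ifs at hσ <;> simp [hσ]
  have hne : σ * k ≠ 0 := by rcases hσ0 with h | h <;> simp [h, hk.ne']
  have h1 := intervalIntegral.integral_comp_add_mul (a := 0) (b := 1)
    (fun q => ‖G (ρ, q)‖ ^ 2) hne y
  have h1k := window_mem hℓ hy hσ (t := k) ⟨hk.le, hk1⟩
  have hci : ∀ a b, IntervalIntegrable (fun q => ‖G (ρ, q)‖ ^ 2) volume a b :=
    fun a b => ((hG.slice hρ).norm.pow 2).intervalIntegrable _ _
  have mono : ∀ a b, -ℓ ≤ a → a ≤ b → b ≤ ℓ → ∫ q in a..b, ‖G (ρ, q)‖ ^ 2 ≤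
      ∫ q in (-ℓ)..ℓ, ‖G (ρ, q)‖ ^ 2 := fun a b h1 h2 h3 =>
    intervalIntegral.integral_mono_interval h1 h2 h3 (Filter.Eventually.of_forall fun _ => by
      simp only [Pi.zero_apply]; positivity) (hci _ _)
  rw [h1, smul_eq_mul, mul_zero, mul_one, add_zero]
  rcases hσ0 with h | h
  · rw [h] at h1k ⊢
    simp only [one_mul] at h1k ⊢
    have := mono y (y + k) hy.1 (by linarith) h1k.2
    rw [inv_mul_le_iff₀ hk]; linarith
  · rw [h] at h1k ⊢
    rw [intervalIntegral.integral_symm]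
    have h2 : (-1 * k)⁻¹ * -(∫ q in (y + -1 * k)..y, ‖G (ρ, q)‖ ^ 2) =
        k⁻¹ * ∫ q in (y + -1 * k)..y, ‖G (ρ, q)‖ ^ 2 := by
      rw [neg_one_mul, inv_neg]; ring
    rw [h2]
    have := mono (y + -1 * k) y h1k.1 (by linarith) hy.2
    rw [inv_mul_le_iff₀ hk]; linarith

theorem window_diff {G : ℝ × ℝ → ℂ} (hG : Sm O2 G) {ℓ ρ M : ℝ} (hρ : 1 < ρ)
    (hb : ∀ q ∈ Set.Icc (-ℓ) ℓ, ‖d2 G (ρ, q)‖ ≤ M) {q q' : ℝ} (hq : q ∈ Set.Icc (-ℓ) ℓ)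
    (hq' : q' ∈ Set.Icc (-ℓ) ℓ) : ‖G (ρ, q') - G (ρ, q)‖ ≤ M * |q' - q| := by
  have := Convex.norm_image_sub_le_of_norm_hasDerivWithin_le (f := fun q => G (ρ, q))
    (f' := fun q => d2 G (ρ, q)) (s := Set.Icc (-ℓ) ℓ) (C := M)
    (fun x _ => (hG.hd2 (mem_O2.2 hρ)).hasDerivWithinAt) hb (convex_Icc _ _) hq hq'
  simpa using this

/-- bounds on a slice of the cone -/
structure CB (A B : ℝ × ℝ → ℂ) (κ M ρ ℓ : ℝ) : Prop where
  bA : ∀ y ∈ Set.Icc (-ℓ) ℓ, ‖A (ρ, y)‖ ≤ κ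
  bB : ∀ y ∈ Set.Icc (-ℓ) ℓ, ‖B (ρ, y)‖ ≤ κ
  bA1 : ∀ y ∈ Set.Icc (-ℓ) ℓ, ‖d2 A (ρ, y)‖ ≤ M
  bB1 : ∀ y ∈ Set.Icc (-ℓ) ℓ, ‖d2 B (ρ, y)‖ ≤ M
  bA2 : ∫ y in (-ℓ)..ℓ, ‖d2 (d2 A) (ρ, y)‖ ^ 2 ≤ M ^ 2
  bB2 : ∫ y in (-ℓ)..ℓ, ‖d2 (d2 B) (ρ, y)‖ ^ 2 ≤ M ^ 2

theorem T3_diff (a b c a' b' c' : ℂ) {κ δ : ℝ} (hκ : 0 ≤ κ) (_ha : ‖a‖ ≤ κ) (hb : ‖b'‖ ≤ κ) (hb0 : ‖b‖ ≤ κ) (hc : ‖c‖ ≤ κ)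
    (ha' : ‖a'‖ ≤ κ)
    (h1 : ‖a' - a‖ ≤ δ) (h2 : ‖b' - b‖ ≤ δ) (h3 : ‖c' - c‖ ≤ δ) :
    ‖a' * (starRingEnd ℂ) b' * c' - a * (starRingEnd ℂ) b * c‖ ≤ 3 * κ ^ 2 * δ := by
  have hδ : 0 ≤ δ := (norm_nonneg _).trans h1
  have : a' * (starRingEnd ℂ) b' * c' - a * (starRingEnd ℂ) b * c =
    a' * (starRingEnd ℂ) b' * (c' - c) + a' * (starRingEnd ℂ) (b' - b) * c +
      (a' - a) * (starRingEnd ℂ) b * c := by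
    rw [map_sub]; ring
  rw [this]
  refine norm_add₃_le.trans ?_
  simp only [norm_mul, RCLike.norm_conj]
  have e1 : ‖a'‖ * ‖b'‖ * ‖c' - c‖ ≤ κ * κ * δ := by gcongr
  have e2 : ‖a'‖ * ‖b' - b‖ * ‖c‖ ≤ κ * δ * κ := by gcongr
  have e3 : ‖a' - a‖ * ‖b‖ * ‖c‖ ≤ δ * κ * κ := by gcongr
  linarith

/-- pointwise (in ρ) estimates for the averaged profile -/
theorem avg_est {ς : ℝ} {A B : ℝ × ℝ → ℂ} (H : ABS ς A B) {κ M ρ ℓ y σ : ℝ}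
    (hρ : 1 < ρ) (hℓ : 1 ≤ ℓ) (hκ0 : 0 ≤ κ) (hM : 0 < M) (C : CB A B κ M ρ ℓ)
    (hy : y ∈ Set.Icc (-ℓ) ℓ) (hσ : σ = if 0 ≤ y then -1 else 1) :
    (∃ Err : ℂ, HasDerivAt (avg A σ y) (-((ρ⁻¹ : ℝ) : ℂ) * ph (-2 * ς) ρ * avg (d2 B) σ y ρ +
      Complex.I * ((ρ⁻¹ : ℝ) : ℂ) * (((‖A (ρ, y)‖ ^ 2 : ℝ) : ℂ) * avg A σ y ρ - ph (-4 * ς) ρ * T3 B A B (ρ, y))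
        + Err) ρ ∧ ‖Err‖ ≤ (1 + 5 * κ ^ 2) * (ρ ^ (-(5:ℝ)/3) * M)) ∧
    (∃ Q', HasDerivAt (avg (d2 B) σ y) Q' ρ ∧ ‖Q'‖ ≤ (2 + 6 * κ ^ 2) * (ρ ^ (-(2:ℝ)/3) * M)) ∧
    (∃ T', HasDerivAt (fun r => T3 B A B (r, y)) T' ρ ∧ ‖T'‖ ≤ 3 * κ ^ 2 * (ρ⁻¹ * (M + 2 * κ ^ 3))) ∧
    ‖avg (d2 B) σ y ρ‖ ≤ M ∧ ‖avg A σ y ρ - A (ρ, y)‖ ≤ ρ ^ (-(2:ℝ)/3) * M := by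
  have hρ0 : 0 < ρ := by linarith
  obtain ⟨k, hkdef⟩ : ∃ k, k = ρ ^ (-(2:ℝ)/3) := ⟨_, rfl⟩
  have hk : 0 < k := by rw [hkdef]; positivity
  have hk1 : k ≤ 1 := by
    rw [hkdef]; exact Real.rpow_le_one_of_one_le_of_nonpos hρ.le (by norm_num)
  have hρk : ρ ^ (-(5:ℝ)/3) = ρ⁻¹ * k := by
    rw [hkdef, ← Real.rpow_neg_one, ← Real.rpow_add hρ0]; norm_num
  obtain ⟨g, hgdef⟩ : ∃ g, g = ρ ^ ((1:ℝ)/3) := ⟨_, rfl⟩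
  have hg : 0 < g := by rw [hgdef]; positivity
  have hkg : k * g ^ 2 = 1 := by
    rw [hkdef, hgdef, ← Real.rpow_natCast, ← Real.rpow_mul hρ0.le, ← Real.rpow_add hρ0]; norm_num
  have hρg : ρ⁻¹ * g = k := by
    rw [hkdef, hgdef, ← Real.rpow_neg_one, ← Real.rpow_add hρ0]; norm_num
  have hg1 : 1 ≤ g := by rw [hgdef]; exact Real.one_le_rpow hρ.le (by norm_num)
  have hσ0 : σ = 1 ∨ σ = -1 := by split_ifs at hσ <;> simp [hσ]
  have hσn : |σ| = 1 := by rcases hσ0 with h | h <;> simp [h]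
  have hm : ∀ q, (ρ, q) ∈ O2 := fun q => mem_O2.2 hρ
  have hw : ∀ s ∈ Set.Icc (0:ℝ) 1, y + σ * k * s ∈ Set.Icc (-ℓ) ℓ := by
    intro s hs
    rw [mul_assoc]
    refine window_mem hℓ hy hσ ⟨mul_nonneg hk.le hs.1, ?_⟩
    nlinarith [hs.1, hs.2]
  have hws : ∀ s ∈ Set.Icc (0:ℝ) 1, |y + σ * k * s - y| ≤ k := by
    intro s hs
    rw [add_sub_cancel_left, abs_mul, abs_mul, hσn, abs_of_pos hk, abs_of_nonneg hs.1]
    nlinarith [hs.2]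
  have hI : ∀ s ∈ Set.uIoc (0:ℝ) 1, s ∈ Set.Icc (0:ℝ) 1 := by
    intro s hs; rw [Set.uIoc_of_le zero_le_one] at hs; exact ⟨hs.1.le, hs.2⟩
  have hc : ∀ G : ℝ × ℝ → ℂ, Sm O2 G → Continuous (fun s => G (ρ, y + σ * k * s)) :=
    fun G hG => (hG.slice hρ).comp (by fun_prop)
  have hA := H.smA
  have hB := H.smB
  have dA : ∀ s ∈ Set.Icc (0:ℝ) 1, ‖A (ρ, y + σ * k * s) - A (ρ, y)‖ ≤ k * M := by
    intro s hs
    refine (window_diff hA hρ C.bA1 hy (hw s hs)).trans ?_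
    rw [mul_comm]; gcongr; exact hws s hs
  have dB : ∀ s ∈ Set.Icc (0:ℝ) 1, ‖B (ρ, y + σ * k * s) - B (ρ, y)‖ ≤ k * M := by
    intro s hs
    refine (window_diff hB hρ C.bB1 hy (hw s hs)).trans ?_
    rw [mul_comm]; gcongr; exact hws s hs
  -- L2 windows
  have W2 : ∀ G : ℝ × ℝ → ℂ, Sm O2 G → ∫ q in (-ℓ)..ℓ, ‖G (ρ, q)‖ ^ 2 ≤ M ^ 2 →
      ‖∫ s in (0:ℝ)..1, G (ρ, y + σ * k * s)‖ ≤ g * M ∧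
      ‖∫ s in (0:ℝ)..1, (s:ℂ) * G (ρ, y + σ * k * s)‖ ≤ g * M := by
    intro G hG hb
    have h1 := window_L2 hG hρ hℓ hy hσ hk hk1 (X := g * M) (by
      have : k * (g * M) ^ 2 = k * g ^ 2 * M ^ 2 := by ring
      rw [this, hkg, one_mul]; exact hb)
    refine ⟨avg_bound (hc G hG).continuousOn (by positivity) h1, ?_⟩
    refine avg_bound (Complex.continuous_ofReal.mul (hc G hG)).continuousOn (by positivity) (le_trans ?_ h1)
    refine intervalIntegral.integral_mono_on (by norm_num) ?_ ?_ fun s hs => ?_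
    · exact ((Complex.continuous_ofReal.mul (hc G hG)).norm.pow 2).intervalIntegrable _ _
    · exact ((hc G hG).norm.pow 2).intervalIntegrable _ _
    · show ‖(s:ℂ) * G (ρ, y + σ * k * s)‖ ^ 2 ≤ ‖G (ρ, y + σ * k * s)‖ ^ 2
      rw [norm_mul, Complex.norm_real, Real.norm_of_nonneg hs.1]
      exact pow_le_pow_left₀ (mul_nonneg hs.1 (norm_nonneg _))
        (mul_le_of_le_one_left (norm_nonneg _) hs.2) 2
  have hrn : ‖((ρ⁻¹ : ℝ) : ℂ)‖ = ρ⁻¹ := by rw [Complex.norm_real, Real.norm_of_nonneg (by positivity)]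
  have hcoef : ‖((σ * (-(2:ℝ)/3 * ρ ^ (-(5:ℝ)/3)) : ℝ) : ℂ)‖ ≤ ρ⁻¹ * k := by
    rw [hρk, Complex.norm_real, Real.norm_eq_abs, abs_mul, hσn, one_mul, abs_mul,
      abs_of_pos (by positivity : 0 < ρ⁻¹ * k)]
    have : |(-(2:ℝ)/3)| ≤ 1 := by rw [abs_le]; constructor <;> norm_num
    exact mul_le_of_le_one_left (by positivity) this
  refine ⟨?_, ?_, ?_, ?_, ?_⟩
  · have hd := avg_deriv hA σ y hρ
    rw [← hkdef] at hd
    refine ⟨Complex.I * ((ρ⁻¹ : ℝ) : ℂ) * (∫ s in (0:ℝ)..1, ((T3 A A A (ρ, y + σ * k * s) -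
        ((‖A (ρ, y)‖ ^ 2 : ℝ) : ℂ) * A (ρ, y + σ * k * s)) -
        ph (-4 * ς) ρ * (T3 B A B (ρ, y + σ * k * s) - T3 B A B (ρ, y)))) +
        ((σ * (-(2:ℝ)/3 * ρ ^ (-(5:ℝ)/3)) : ℝ) : ℂ) *
          ∫ s in (0:ℝ)..1, (s : ℂ) * d2 A (ρ, y + σ * k * s), hd.congr_deriv ?_, ?_⟩
    · have hTA := hA.T3 hA hA
      have hTB := hB.T3 hA hB
      have e : avg (d1 A) σ y ρ = -((ρ⁻¹ : ℝ) : ℂ) * ph (-2 * ς) ρ * avg (d2 B) σ y ρ +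
         Complex.I * ((ρ⁻¹ : ℝ) : ℂ) * (avg (T3 A A A) σ y ρ - ph (-4 * ς) ρ * avg (T3 B A B) σ y ρ) := by
        simp only [avg, ← hkdef]
        rw [← intervalIntegral.integral_const_mul, ← intervalIntegral.integral_const_mul,
          ← intervalIntegral.integral_sub, ← intervalIntegral.integral_const_mul,
          ← intervalIntegral.integral_add]
        · refine intervalIntegral.integral_congr fun s _ => ?_
          simp only [H.eqA _ (hm _), rc]
        · exact (continuous_const.mul (hc _ hB.d2)).intervalIntegrable _ _
        · exact (continuous_const.mul ((hc _ hTA).sub (continuous_const.mul (hc _ hTB)))).intervalIntegrable _ _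
        · exact (hc _ hTA).intervalIntegrable _ _
        · exact (continuous_const.mul (hc _ hTB)).intervalIntegrable _ _
      have e2 : (∫ s in (0:ℝ)..1, ((T3 A A A (ρ, y + σ * k * s) -
        ((‖A (ρ, y)‖ ^ 2 : ℝ) : ℂ) * A (ρ, y + σ * k * s)) -
        ph (-4 * ς) ρ * (T3 B A B (ρ, y + σ * k * s) - T3 B A B (ρ, y)))) =
        avg (T3 A A A) σ y ρ - ((‖A (ρ, y)‖ ^ 2 : ℝ) : ℂ) * avg A σ y ρ -
          ph (-4 * ς) ρ * (avg (T3 B A B) σ y ρ - T3 B A B (ρ, y)) := by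
        simp only [avg, ← hkdef]
        rw [intervalIntegral.integral_sub, intervalIntegral.integral_sub,
          intervalIntegral.integral_const_mul, intervalIntegral.integral_const_mul,
          intervalIntegral.integral_sub, intervalIntegral.integral_const]
        · simp
        · exact (hc _ hTB).intervalIntegrable _ _
        · simp
        · exact (hc _ hTA).intervalIntegrable _ _
        · exact (continuous_const.mul (hc _ hA)).intervalIntegrable _ _
        · exact ((hc _ hTA).sub (continuous_const.mul (hc _ hA))).intervalIntegrable _ _
        · exact (continuous_const.mul ((hc _ hTB).sub continuous_const)).intervalIntegrable _ _
      rw [e, e2]; ring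
    · have b1 : ‖∫ s in (0:ℝ)..1, ((T3 A A A (ρ, y + σ * k * s) -
        ((‖A (ρ, y)‖ ^ 2 : ℝ) : ℂ) * A (ρ, y + σ * k * s)) -
        ph (-4 * ς) ρ * (T3 B A B (ρ, y + σ * k * s) - T3 B A B (ρ, y)))‖ ≤ 5 * κ ^ 2 * (k * M) * |1 - 0| := by
        refine intervalIntegral.norm_integral_le_of_norm_le_const fun s hs => ?_
        have hs' := hI s hs
        have f1 := dA s hs'
        have f2 := dB s hs'
        have g1 := C.bA _ (hw s hs')
        have g2 := C.bB _ (hw s hs')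
        have g3 := C.bA _ hy
        have g4 := C.bB _ hy
        have t1 := T3_diff (B (ρ, y)) (A (ρ, y)) (B (ρ, y)) _ _ _ hκ0 g4 g1 g3 g4 g2 f2 f1 f2
        refine (norm_sub_le _ _).trans ?_
        rw [norm_mul, norm_ph, one_mul]
        have t2 : ‖T3 A A A (ρ, y + σ * k * s) -
            ((‖A (ρ, y)‖ ^ 2 : ℝ) : ℂ) * A (ρ, y + σ * k * s)‖ ≤ 2 * κ ^ 2 * (k * M) := by
          have : T3 A A A (ρ, y + σ * k * s) - ((‖A (ρ, y)‖ ^ 2 : ℝ) : ℂ) * A (ρ, y + σ * k * s) =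
            ((‖A (ρ, y + σ * k * s)‖ ^ 2 - ‖A (ρ, y)‖ ^ 2 : ℝ) : ℂ) * A (ρ, y + σ * k * s) := by
            simp only [T3, Complex.mul_conj, Complex.normSq_eq_norm_sq]; push_cast; ring
          rw [this, norm_mul, Complex.norm_real, Real.norm_eq_abs]
          have h5 : |‖A (ρ, y + σ * k * s)‖ ^ 2 - ‖A (ρ, y)‖ ^ 2| ≤ (k * M) * (2 * κ) := by
            rw [sq_sub_sq, mul_comm, abs_mul]
            have h6 := abs_norm_sub_norm_le (A (ρ, y + σ * k * s)) (A (ρ, y))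
            have h7 : |‖A (ρ, y + σ * k * s)‖ + ‖A (ρ, y)‖| ≤ 2 * κ := by
              rw [abs_of_nonneg (by positivity)]; linarith
            gcongr
            exact h6.trans f1
          calc _ ≤ (k * M) * (2 * κ) * κ := by gcongr
            _ = _ := by ring
        simp only [T3] at t1 t2 ⊢
        linarith
      have b2 : ‖∫ s in (0:ℝ)..1, (s : ℂ) * d2 A (ρ, y + σ * k * s)‖ ≤ M * |1 - 0| := by
        refine intervalIntegral.norm_integral_le_of_norm_le_const fun s hs => ?_
        have hs' := hI s hs
        rw [norm_mul, Complex.norm_real, Real.norm_of_nonneg hs'.1]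
        exact (mul_le_of_le_one_left (norm_nonneg _) hs'.2).trans (C.bA1 _ (hw s hs'))
      rw [sub_zero, abs_one, mul_one] at b1 b2
      refine (norm_add_le _ _).trans ?_
      rw [norm_mul, norm_mul, norm_mul, Complex.norm_I, one_mul, hrn, hρk]
      have c1 := mul_le_mul_of_nonneg_left b1 (inv_pos.2 hρ0).le
      have c2 := mul_le_mul hcoef b2 (norm_nonneg _) (by positivity)
      rw [hρk] at c2
      linarith
  · have hd := avg_deriv hB.d2 σ y hρ
    rw [← hkdef] at hd
    refine ⟨_, hd, ?_⟩
    have hTB := hB.T3 hB hB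
    have hTA := hA.T3 hB hA
    have hpt : ∀ q, d1 (d2 B) (ρ, q) = -((ρ⁻¹ : ℝ) : ℂ) * ph (2 * ς) ρ * d2 (d2 A) (ρ, q) +
        Complex.I * ((ρ⁻¹ : ℝ) : ℂ) * (d2 (T3 B B B) (ρ, q) - ph (4 * ς) ρ * d2 (T3 A B A) (ρ, q)) := by
      intro q
      rw [hB.comm (hm q), d2_congr O2_open H.eqB _ (hm q)]
      refine Sm.d2_eq ((hB.d1).congr (fun z hz => (H.eqB z hz).symm)) (hm q) ?_
      exact ((hA.d2.hd2 (hm q)).const_mul (-((ρ⁻¹ : ℝ) : ℂ) * ph (2 * ς) ρ)).add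
        (((hTB.hd2 (hm q)).sub ((hTA.hd2 (hm q)).const_mul (ph (4 * ς) ρ))).const_mul
          (Complex.I * ((ρ⁻¹ : ℝ) : ℂ)))
    have e : avg (d1 (d2 B)) σ y ρ = -((ρ⁻¹ : ℝ) : ℂ) * ph (2 * ς) ρ *
        (∫ s in (0:ℝ)..1, d2 (d2 A) (ρ, y + σ * k * s)) +
        Complex.I * ((ρ⁻¹ : ℝ) : ℂ) * ∫ s in (0:ℝ)..1, (d2 (T3 B B B) (ρ, y + σ * k * s) -
          ph (4 * ς) ρ * d2 (T3 A B A) (ρ, y + σ * k * s)) := by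
      simp only [avg, ← hkdef, hpt]
      rw [intervalIntegral.integral_add, intervalIntegral.integral_const_mul,
        intervalIntegral.integral_const_mul]
      · exact (continuous_const.mul (hc _ hA.d2.d2)).intervalIntegrable _ _
      · exact (continuous_const.mul ((hc _ hTB.d2).sub (continuous_const.mul (hc _ hTA.d2)))).intervalIntegrable _ _
    have b3 : ‖∫ s in (0:ℝ)..1, (d2 (T3 B B B) (ρ, y + σ * k * s) -
          ph (4 * ς) ρ * d2 (T3 A B A) (ρ, y + σ * k * s))‖ ≤ 6 * κ ^ 2 * M * |1 - 0| := by
      refine intervalIntegral.norm_integral_le_of_norm_le_const fun s hs => ?_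
      have hs' := hI s hs
      have g1 := C.bA _ (hw s hs')
      have g2 := C.bB _ (hw s hs')
      have g3 := C.bA1 _ (hw s hs')
      have g4 := C.bB1 _ (hw s hs')
      refine (norm_sub_le _ _).trans ?_
      rw [norm_mul, norm_ph, one_mul, d2_T3 hB hB hB _ (hm _), d2_T3 hA hB hA _ (hm _)]
      have gen : ∀ P Q R : ℝ × ℝ → ℂ, ∀ z, ∀ x1 x2 x3 : ℝ, 0 ≤ x1 → 0 ≤ x2 → ‖P z‖ ≤ x1 → ‖Q z‖ ≤ x2 → ‖R z‖ ≤ x3 →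
          ‖T3 P Q R z‖ ≤ x1 * x2 * x3 := by
        intro P Q R z x1 x2 x3 p1 p2 h1 h2 h3
        rw [norm_T3]; gcongr
      have n1 := norm_add₃_le (a := T3 (d2 B) B B (ρ, y + σ * k * s)) (b := T3 B (d2 B) B (ρ, y + σ * k * s)) (c := T3 B B (d2 B) (ρ, y + σ * k * s))
      have n2 := norm_add₃_le (a := T3 (d2 A) B A (ρ, y + σ * k * s)) (b := T3 A (d2 B) A (ρ, y + σ * k * s)) (c := T3 A B (d2 A) (ρ, y + σ * k * s))
      have := gen _ _ _ _ _ _ _ hM.le hκ0 g4 g2 g2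
      have := gen _ _ _ _ _ _ _ hκ0 hM.le g2 g4 g2
      have := gen _ _ _ _ _ _ _ hκ0 hκ0 g2 g2 g4
      have := gen _ _ _ _ _ _ _ hM.le hκ0 g3 g2 g1
      have := gen _ _ _ _ _ _ _ hκ0 hM.le g1 g4 g1
      have := gen _ _ _ _ _ _ _ hκ0 hκ0 g1 g2 g3
      linarith
    rw [sub_zero, abs_one, mul_one] at b3
    have b1 := (W2 _ hA.d2.d2 C.bA2).1
    have b2 := (W2 _ hB.d2.d2 C.bB2).2
    rw [e]
    refine norm_add₃_le.trans ?_
    simp only [norm_mul, norm_neg, norm_ph, Complex.norm_I, hrn, one_mul, mul_one]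
    have c1 := mul_le_mul_of_nonneg_left b1 (inv_pos.2 hρ0).le
    have c3 := mul_le_mul_of_nonneg_left b3 (inv_pos.2 hρ0).le
    have c2 := mul_le_mul hcoef b2 (norm_nonneg _) (by positivity)
    rw [← hkdef]
    have e1 : ρ⁻¹ * (g * M) = k * M := by rw [← mul_assoc, hρg]
    have e2 : ρ⁻¹ * k * (g * M) ≤ k * M := by
      have : ρ⁻¹ * k * (g * M) = (ρ⁻¹ * g) * k * M := by ring
      rw [this, hρg]
      have : k * k ≤ k * 1 := by gcongr
      nlinarith
    have e3 : ρ⁻¹ * (6 * κ ^ 2 * M) ≤ 6 * κ ^ 2 * (k * M) := by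
      have : ρ⁻¹ ≤ k := by rw [← hρg]; exact le_mul_of_one_le_right (by positivity) hg1
      calc ρ⁻¹ * (6 * κ ^ 2 * M) ≤ k * (6 * κ ^ 2 * M) := by gcongr
        _ = _ := by ring
    linarith
  · refine ⟨_, (hB.T3 hA hB).hd1 (hm y), ?_⟩
    rw [d1_T3 hB hA hB _ (hm y)]
    have g1 := C.bA _ hy
    have g2 := C.bB _ hy
    have nA : ‖d1 A (ρ, y)‖ ≤ ρ⁻¹ * (M + 2 * κ ^ 3) := by
      rw [H.eqA _ (hm y)]
      refine (norm_add_le _ _).trans ?_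
      simp only [norm_mul, norm_neg, norm_ph, Complex.norm_I, rc, hrn, one_mul, mul_one]
      rw [← mul_add]
      gcongr
      · exact C.bB1 _ hy
      · refine (norm_sub_le _ _).trans ?_
        rw [norm_mul, norm_ph, one_mul, norm_T3, norm_T3]
        have : ‖A (ρ, y)‖ * ‖A (ρ, y)‖ * ‖A (ρ, y)‖ ≤ κ * κ * κ := by gcongr
        have : ‖B (ρ, y)‖ * ‖A (ρ, y)‖ * ‖B (ρ, y)‖ ≤ κ * κ * κ := by gcongr
        linarith
    have nB : ‖d1 B (ρ, y)‖ ≤ ρ⁻¹ * (M + 2 * κ ^ 3) := by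
      rw [H.eqB _ (hm y)]
      refine (norm_add_le _ _).trans ?_
      simp only [norm_mul, norm_neg, norm_ph, Complex.norm_I, rc, hrn, one_mul, mul_one]
      rw [← mul_add]
      gcongr
      · exact C.bA1 _ hy
      · refine (norm_sub_le _ _).trans ?_
        rw [norm_mul, norm_ph, one_mul, norm_T3, norm_T3]
        have : ‖B (ρ, y)‖ * ‖B (ρ, y)‖ * ‖B (ρ, y)‖ ≤ κ * κ * κ := by gcongr
        have : ‖A (ρ, y)‖ * ‖B (ρ, y)‖ * ‖A (ρ, y)‖ ≤ κ * κ * κ := by gcongr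
        linarith
    refine norm_add₃_le.trans ?_
    simp only [norm_T3]
    have hN : 0 ≤ ρ⁻¹ * (M + 2 * κ ^ 3) := by positivity
    set N := ρ⁻¹ * (M + 2 * κ ^ 3)
    have : ‖d1 B (ρ, y)‖ * ‖A (ρ, y)‖ * ‖B (ρ, y)‖ ≤ N * κ * κ := by gcongr
    have : ‖B (ρ, y)‖ * ‖d1 A (ρ, y)‖ * ‖B (ρ, y)‖ ≤ κ * N * κ := by gcongr
    have : ‖B (ρ, y)‖ * ‖A (ρ, y)‖ * ‖d1 B (ρ, y)‖ ≤ κ * κ * N := by gcongr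
    linarith
  · have : ‖avg (d2 B) σ y ρ‖ ≤ M * |1 - 0| := by
      unfold avg; rw [← hkdef]
      exact intervalIntegral.norm_integral_le_of_norm_le_const fun s hs => C.bB1 _ (hw s (hI s hs))
    simpa using this
  · have e : avg A σ y ρ - A (ρ, y) = ∫ s in (0:ℝ)..1, (A (ρ, y + σ * k * s) - A (ρ, y)) := by
      rw [intervalIntegral.integral_sub ((hc A hA).intervalIntegrable _ _) (by simp)]
      simp [avg, ← hkdef]
    rw [e, ← hkdef]
    have : ‖∫ s in (0:ℝ)..1, (A (ρ, y + σ * k * s) - A (ρ, y))‖ ≤ k * M * |1 - 0| :=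
      intervalIntegral.norm_integral_le_of_norm_le_const fun s hs => dA s (hI s hs)
    simpa using this


theorem norm_expI (x : ℝ) : ‖Complex.exp (Complex.I * ((x : ℝ) : ℂ))‖ = 1 := by
  rw [mul_comm]; exact Complex.norm_exp_ofReal_mul_I x

set_option maxHeartbeats 1000000 in
/-- estimate along a ray -/
theorem ray_est {ς : ℝ} (hς : ς = 1 ∨ ς = -1) {A B : ℝ × ℝ → ℂ} (H : ABS ς A B) {κ m r1 r2 y : ℝ}
    {ℓ Θ : ℝ → ℝ}
    (hr1 : 1 < r1) (hr : r1 ≤ r2) (hκ0 : 0 ≤ κ) (hκ : κ ≤ 1 / 400) (hm : 0 < m)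
    (hℓ : ∀ r ∈ Set.Icc r1 r2, 1 ≤ ℓ r) (hy : ∀ r ∈ Set.Icc r1 r2, y ∈ Set.Icc (-ℓ r) (ℓ r))
    (C : ∀ r ∈ Set.Icc r1 r2, CB A B κ (m * r ^ (1/15 : ℝ)) r (ℓ r))
    (hΘ : ∀ r ∈ Set.Icc r1 r2, HasDerivAt Θ (‖A (r, y)‖ ^ 2 * r⁻¹) r) :
    ‖Complex.exp (Complex.I * ((-Θ r2 : ℝ) : ℂ)) * A (r2, y) -
      Complex.exp (Complex.I * ((-Θ r1 : ℝ) : ℂ)) * A (r1, y)‖ ≤ 9 * (m + κ ^ 3) * r1 ^ (-(3:ℝ)/5) := by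
  obtain ⟨σ, hσ⟩ : ∃ σ : ℝ, σ = if 0 ≤ y then -1 else 1 := ⟨_, rfl⟩
  set W : ℝ → ℂ := fun r => Complex.exp (Complex.I * ((-Θ r : ℝ) : ℂ)) * (avg A σ y r +
      (Complex.I * ς / 2) * (((r⁻¹ : ℝ) : ℂ) * (ph (-2 * ς) r * avg (d2 B) σ y r)) -
      (ς / 4) * (((r⁻¹ : ℝ) : ℂ) * (ph (-4 * ς) r * T3 B A B (r, y)))) with hW
  have hςn : ‖(ς : ℂ)‖ = 1 := by rcases hς with h | h <;> simp [h]
  have hκ2 : κ ^ 2 ≤ 1 / 160000 := by nlinarith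
  have hκ3 : 0 ≤ κ ^ 3 := by positivity
  have key : ∀ r ∈ Set.Icc r1 r2, (∃ D, HasDerivAt W D r ∧ ‖D‖ ≤ 3 * (m + κ ^ 3) * r ^ (-(8:ℝ)/5)) ∧
      ‖W r - Complex.exp (Complex.I * ((-Θ r : ℝ) : ℂ)) * A (r, y)‖ ≤ 2 * (m + κ ^ 3) * r ^ (-(3:ℝ)/5) := by
    intro r hrr
    have hr' : 1 < r := lt_of_lt_of_le hr1 hrr.1
    have hr0 : 0 < r := by linarith
    have hT : ‖T3 B A B (r, y)‖ ≤ κ ^ 3 := by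
      rw [norm_T3]
      have h1 := (C r hrr).bA y (hy r hrr)
      have h2 := (C r hrr).bB y (hy r hrr)
      calc _ ≤ κ * κ * κ := by gcongr
        _ = _ := by ring
    obtain ⟨⟨Err, hE, nE⟩, ⟨Q', hQ, nQ'⟩, ⟨T', hT', nT'⟩, nQ, nA⟩ :=
      avg_est H hr' (hℓ r hrr) hκ0 (by positivity) (C r hrr) (hy r hrr) hσ
    have hAn : ‖A (r, y)‖ ^ 2 ≤ κ ^ 2 := by
      have h1 := (C r hrr).bA y (hy r hrr)
      gcongr
    obtain ⟨D, hD, nD⟩ := W_deriv (At := avg A σ y) (Q := avg (d2 B) σ y)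
      (T := fun r => T3 B A B (r, y)) (Θ := Θ) (n := ‖A (r, y)‖ ^ 2) hς hr0 hE hQ hT' (hΘ r hrr)
    obtain ⟨R, hR⟩ : ∃ R, R = r ^ (-(8:ℝ)/5) := ⟨_, rfl⟩
    have hRp : 0 < R := by rw [hR]; positivity
    have i1 : r ^ (-(5:ℝ)/3) * (m * r ^ (1/15 : ℝ)) = m * R := by
      have : r ^ (-(5:ℝ)/3) * r ^ (1/15 : ℝ) = R := by rw [hR, ← Real.rpow_add hr0]; norm_num
      rw [← this]; ring
    have i2 : r⁻¹ * (r ^ (-(2:ℝ)/3) * (m * r ^ (1/15 : ℝ))) = m * R := by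
      have : r⁻¹ * (r ^ (-(2:ℝ)/3) * r ^ (1/15 : ℝ)) = R := by
        rw [hR, ← Real.rpow_neg_one, ← Real.rpow_add hr0, ← Real.rpow_add hr0]; norm_num
      rw [← this]; ring
    have i3 : r⁻¹ ^ 2 * (m * r ^ (1/15 : ℝ)) ≤ m * R := by
      have : r⁻¹ ^ 2 * r ^ (1/15 : ℝ) ≤ R := by
        rw [hR, ← Real.rpow_neg_one, ← Real.rpow_natCast, ← Real.rpow_mul hr0.le, ← Real.rpow_add hr0]
        exact Real.rpow_le_rpow_of_exponent_le hr'.le (by norm_num)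
      nlinarith
    have i4 : r⁻¹ ^ 2 ≤ R := by
      rw [hR, ← Real.rpow_neg_one, ← Real.rpow_natCast, ← Real.rpow_mul hr0.le]
      exact Real.rpow_le_rpow_of_exponent_le hr'.le (by norm_num)
    have hri : 0 < r⁻¹ := by positivity
    constructor
    · refine ⟨D, hD, nD.trans ?_⟩
      rw [abs_of_nonneg (by positivity), ← hR]
      rw [i1] at nE
      have j1 := mul_le_mul_of_nonneg_left nQ' hri.le
      have j2 := mul_le_mul_of_nonneg_left nT' hri.le
      have e1 : r⁻¹ * ((2 + 6 * κ ^ 2) * (r ^ (-(2:ℝ)/3) * (m * r ^ (1/15 : ℝ)))) = (2 + 6 * κ ^ 2) * (m * R) := by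
        rw [← i2]; ring
      rw [e1] at j1
      have e2 : r⁻¹ * (3 * κ ^ 2 * (r⁻¹ * (m * r ^ (1/15 : ℝ) + 2 * κ ^ 3))) ≤
          3 * κ ^ 2 * (m * R + 2 * κ ^ 3 * R) := by
        have : r⁻¹ * (3 * κ ^ 2 * (r⁻¹ * (m * r ^ (1/15 : ℝ) + 2 * κ ^ 3))) =
          3 * κ ^ 2 * (r⁻¹ ^ 2 * (m * r ^ (1/15 : ℝ)) + 2 * κ ^ 3 * r⁻¹ ^ 2) := by ring
        rw [this]
        gcongr
      have e3 : (‖A (r, y)‖ ^ 2 + 1) * r⁻¹ ^ 2 * (‖avg (d2 B) σ y r‖ / 2 + ‖T3 B A B (r, y)‖ / 4) ≤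
          (κ ^ 2 + 1) * (m * R / 2 + κ ^ 3 * R / 4) := by
        calc _ ≤ (κ ^ 2 + 1) * r⁻¹ ^ 2 * (m * r ^ (1/15 : ℝ) / 2 + κ ^ 3 / 4) := by gcongr
          _ = (κ ^ 2 + 1) * (r⁻¹ ^ 2 * (m * r ^ (1/15 : ℝ)) / 2 + κ ^ 3 * r⁻¹ ^ 2 / 4) := by ring
          _ ≤ _ := by gcongr
      have p1 : 0 ≤ m * R := by positivity
      have p2 : 0 ≤ κ ^ 3 * R := by positivity
      have q1 : κ ^ 2 * (m * R) ≤ 1 / 160000 * (m * R) := by gcongr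
      have q2 : κ ^ 2 * (κ ^ 3 * R) ≤ 1 / 160000 * (κ ^ 3 * R) := by gcongr
      nlinarith
    · have e : W r - Complex.exp (Complex.I * ((-Θ r : ℝ) : ℂ)) * A (r, y) =
        Complex.exp (Complex.I * ((-Θ r : ℝ) : ℂ)) * ((avg A σ y r - A (r, y)) +
        (Complex.I * ς / 2) * (((r⁻¹ : ℝ) : ℂ) * (ph (-2 * ς) r * avg (d2 B) σ y r)) +
        (-(ς / 4) * (((r⁻¹ : ℝ) : ℂ) * (ph (-4 * ς) r * T3 B A B (r, y))))) := by
        rw [hW]; ring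
      rw [e, norm_mul, norm_expI, one_mul]
      refine norm_add₃_le.trans ?_
      have hrn : ‖((r⁻¹ : ℝ) : ℂ)‖ = r⁻¹ := by rw [Complex.norm_real, Real.norm_of_nonneg (by positivity)]
      simp only [norm_mul, norm_div, norm_neg, norm_ph, Complex.norm_I, hςn, hrn, one_mul]
      obtain ⟨S, hS⟩ : ∃ S, S = r ^ (-(3:ℝ)/5) := ⟨_, rfl⟩
      have hSp : 0 < S := by rw [hS]; positivity
      rw [← hS]
      have k1 : r ^ (-(2:ℝ)/3) * (m * r ^ (1/15 : ℝ)) = m * S := by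
        have : r ^ (-(2:ℝ)/3) * r ^ (1/15 : ℝ) = S := by rw [hS, ← Real.rpow_add hr0]; norm_num
        rw [← this]; ring
      have k2 : r⁻¹ * (m * r ^ (1/15 : ℝ)) ≤ m * S := by
        have : r⁻¹ * r ^ (1/15 : ℝ) ≤ S := by
          rw [hS, ← Real.rpow_neg_one, ← Real.rpow_add hr0]
          exact Real.rpow_le_rpow_of_exponent_le hr'.le (by norm_num)
        nlinarith
      have k3 : r⁻¹ ≤ S := by
        rw [hS, ← Real.rpow_neg_one]
        exact Real.rpow_le_rpow_of_exponent_le hr'.le (by norm_num)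
      have l2 : r⁻¹ * ‖avg (d2 B) σ y r‖ ≤ m * S := (by gcongr : _ ≤ r⁻¹ * (m * r ^ (1/15 : ℝ))).trans k2
      have l3 : r⁻¹ * ‖T3 B A B (r, y)‖ ≤ S * κ ^ 3 := by gcongr
      have n2 : ‖(2:ℂ)‖ = 2 := by simp
      have n4 : ‖(4:ℂ)‖ = 4 := by simp
      rw [n2, n4]
      rw [k1] at nA
      have : 0 ≤ κ ^ 3 * S := by positivity
      have : 0 ≤ m * S := by positivity
      linarith
  choose! W' hW' using fun r hr => (key r hr).1
  have t := tail_bound (W := W) (W' := W') (c := 3 * (m + κ ^ 3)) (by linarith) hr (by positivity)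
    (fun r hr => (hW' r hr).1) (fun r hr => (hW' r hr).2)
  have a1 := (key r1 ⟨le_rfl, hr⟩).2
  have a2 := (key r2 ⟨hr, le_rfl⟩).2
  have mono : r2 ^ (-(3:ℝ)/5) ≤ r1 ^ (-(3:ℝ)/5) :=
    Real.rpow_le_rpow_of_nonpos (by linarith) hr (by norm_num)
  set X1 := Complex.exp (Complex.I * ((-Θ r1 : ℝ) : ℂ)) * A (r1, y)
  set X2 := Complex.exp (Complex.I * ((-Θ r2 : ℝ) : ℂ)) * A (r2, y)
  have e : X2 - X1 = -(W r2 - X2) + (W r2 - W r1) + (W r1 - X1) := by ring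
  rw [e]
  refine norm_add₃_le.trans ?_
  rw [norm_neg]
  have : 2 * (m + κ ^ 3) * r2 ^ (-(3:ℝ)/5) ≤ 2 * (m + κ ^ 3) * r1 ^ (-(3:ℝ)/5) := by gcongr
  linarith

/-! ### Part G: bootstrap -/

/-- initial energy bounds -/
structure Init (U V : ℝ × ℝ → ℂ) (a ρ0 : ℝ) : Prop where
  e0 : ∀ Λ, 0 ≤ Λ - Real.log ρ0 → EN U V Λ ρ0 ≤ a ^ 2
  e1 : ∀ Λ, 0 ≤ Λ - Real.log ρ0 → EN (d2 U) (d2 V) Λ ρ0 ≤ a ^ 2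
  e2 : ∀ Λ, 0 ≤ Λ - Real.log ρ0 → EN (d2 (d2 U)) (d2 (d2 V)) Λ ρ0 ≤ a ^ 2

theorem half_norm (c : ℝ) (r : ℝ) (X Y : ℂ) {ς : ℝ} (hς : ς = 1 ∨ ς = -1) :
    ‖ph c r * ((X + ς * Y) / 2)‖ ≤ (‖X‖ + ‖Y‖) / 2 := by
  have hςn : ‖(ς : ℂ)‖ = 1 := by rcases hς with h | h <;> simp [h]
  rw [norm_mul, norm_ph, one_mul, norm_div]
  have h := norm_add_le X (ς * Y)
  rw [norm_mul, hςn, one_mul] at h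
  have n2 : ‖(2:ℂ)‖ = 2 := by simp
  rw [n2]; linarith

theorem half_norm_sq (c : ℝ) (r : ℝ) (X Y : ℂ) {ς : ℝ} (hς : ς = 1 ∨ ς = -1) :
    ‖ph c r * ((X + ς * Y) / 2)‖ ^ 2 ≤ (‖X‖ ^ 2 + ‖Y‖ ^ 2) / 2 := by
  have h := half_norm c r X Y hς
  have h0 := norm_nonneg (ph c r * ((X + ς * Y) / 2))
  nlinarith [sq_nonneg (‖X‖ - ‖Y‖)]

theorem prof_CB {U V : ℝ × ℝ → ℂ} (S : Sys U V) {ς : ℝ} (hς : ς = 1 ∨ ς = -1) {a κ Λ ρ : ℝ} (hρ : 1 < ρ)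
    (ha : 0 < a) (hl : 1 ≤ Λ - Real.log ρ)
    (hb : ∀ y ∈ Set.Icc (-(Λ - Real.log ρ)) (Λ - Real.log ρ), ‖U (ρ, y)‖ ≤ κ ∧ ‖V (ρ, y)‖ ≤ κ)
    (hE1 : EN (d2 U) (d2 V) Λ ρ ≤ 2 * a ^ 2 * ρ ^ (2/45 : ℝ))
    (hE2 : EN (d2 (d2 U)) (d2 (d2 V)) Λ ρ ≤ 4 * a ^ 2 * ρ ^ (2/15 : ℝ)) :
    CB (prof ς U V) (prof (-ς) U V) κ (3 * a * ρ ^ (1/15 : ℝ)) ρ (Λ - Real.log ρ) := by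
  have hm : ∀ q, (ρ, q) ∈ O2 := fun q => mem_O2.2 hρ
  have hρ0 : 0 < ρ := by linarith
  have hς' : -ς = 1 ∨ -ς = -1 := by rcases hς with h | h <;> simp [h]
  have hsq : (3 * a * ρ ^ (1/15 : ℝ)) ^ 2 = 9 * a ^ 2 * ρ ^ (2/15 : ℝ) := by
    have : (ρ ^ (1/15 : ℝ)) ^ 2 = ρ ^ (2/15 : ℝ) := by
      rw [← Real.rpow_natCast, ← Real.rpow_mul hρ0.le]; norm_num
    rw [mul_pow, this]; ring
  have hP : 0 ≤ a ^ 2 * ρ ^ (2/15 : ℝ) := by positivity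
  have g0 : ∀ ς : ℝ, ς = 1 ∨ ς = -1 → ∀ y ∈ Set.Icc (-(Λ - Real.log ρ)) (Λ - Real.log ρ),
      ‖prof ς U V (ρ, y)‖ ≤ κ := by
    intro ς hς y hy
    have := half_norm (-ς) ρ (U (ρ, y)) (V (ρ, y)) hς
    have h2 := hb y hy
    unfold prof
    linarith
  have g1 : ∀ ς : ℝ, ς = 1 ∨ ς = -1 → ∀ y ∈ Set.Icc (-(Λ - Real.log ρ)) (Λ - Real.log ρ),
      ‖d2 (prof ς U V) (ρ, y)‖ ≤ 3 * a * ρ ^ (1/15 : ℝ) := by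
    intro ς hς y hy
    rw [prof_d2 S ς (hm y)]
    refine (pow_le_pow_iff_left₀ (norm_nonneg _) (by positivity) two_ne_zero).1 ?_
    refine (half_norm_sq (-ς) ρ _ _ hς).trans ?_
    have h1 := sup_e S.smU.d2 S.smV.d2 hρ hl one_pos hy
    have h3 : ρ ^ (2/45 : ℝ) ≤ ρ ^ (2/15 : ℝ) := Real.rpow_le_rpow_of_exponent_le hρ.le (by norm_num)
    have h4 : a ^ 2 * ρ ^ (2/45 : ℝ) ≤ a ^ 2 * ρ ^ (2/15 : ℝ) := by gcongr
    rw [hsq]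
    linarith
  have g2 : ∀ ς : ℝ, ς = 1 ∨ ς = -1 →
      ∫ y in (-(Λ - Real.log ρ))..(Λ - Real.log ρ), ‖d2 (d2 (prof ς U V)) (ρ, y)‖ ^ 2 ≤
        (3 * a * ρ ^ (1/15 : ℝ)) ^ 2 := by
    intro ς hς
    have h1 : ∫ y in (-(Λ - Real.log ρ))..(Λ - Real.log ρ), ‖d2 (d2 (prof ς U V)) (ρ, y)‖ ^ 2 ≤
        ∫ y in (-(Λ - Real.log ρ))..(Λ - Real.log ρ), (‖d2 (d2 U) (ρ, y)‖ ^ 2 + ‖d2 (d2 V) (ρ, y)‖ ^ 2) := by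
      refine intervalIntegral.integral_mono_on (by linarith) ?_ ?_ fun y _ => ?_
      · exact (((sm_prof S ς).d2.d2.slice hρ).norm.pow 2).intervalIntegrable _ _
      · exact (((S.smU.d2.d2.slice hρ).norm.pow 2).add ((S.smV.d2.d2.slice hρ).norm.pow 2)).intervalIntegrable _ _
      · rw [prof_d22 S ς (hm y)]
        refine (half_norm_sq (-ς) ρ _ _ hς).trans ?_
        have : 0 ≤ ‖d2 (d2 U) (ρ, y)‖ ^ 2 + ‖d2 (d2 V) (ρ, y)‖ ^ 2 := by positivity
        linarith
    refine h1.trans ?_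
    change EN (d2 (d2 U)) (d2 (d2 V)) Λ ρ ≤ _
    rw [hsq]; linarith
  exact ⟨g0 ς hς, g0 _ hς', g1 ς hς, g1 _ hς', g2 ς hς, g2 _ hς'⟩

/-- the phase -/
def Th (A : ℝ × ℝ → ℂ) (ρ0 y r : ℝ) : ℝ := ∫ s in ρ0..r, ‖A (s, y)‖ ^ 2 * s⁻¹

theorem Th_deriv {A : ℝ × ℝ → ℂ} (hA : Sm O2 A) {ρ0 y r : ℝ} (h0 : 1 < ρ0) (hr : 1 < r) :
    HasDerivAt (Th A ρ0 y) (‖A (r, y)‖ ^ 2 * r⁻¹) r := by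
  have hc : ContinuousOn (fun s : ℝ => ‖A (s, y)‖ ^ 2 * s⁻¹) (Set.Ioi 1) := by
    refine ContinuousOn.mul ((ContinuousOn.comp hA.co (by fun_prop) (fun s hs => mem_O2.2 hs)).norm.pow 2) ?_
    exact continuousOn_inv₀.mono fun s (hs : 1 < s) => by
      have : (0:ℝ) < s := by linarith
      exact this.ne'
  refine intervalIntegral.integral_hasDerivAt_right ?_ ?_ (hc.continuousAt (Ioi_mem_nhds hr))
  · refine (hc.mono ?_).intervalIntegrable
    intro s hs
    have := hs.1
    exact lt_of_lt_of_le (lt_min h0 hr) this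
  · exact hc.stronglyMeasurableAtFilter isOpen_Ioi r hr

theorem Th_self (A : ℝ × ℝ → ℂ) (ρ0 y : ℝ) : Th A ρ0 y ρ0 = 0 := by simp [Th]

theorem uv_prof (U V : ℝ × ℝ → ℂ) (z : ℝ × ℝ) :
    U z = ph 1 z.1 * prof 1 U V z + ph (-1) z.1 * prof (-1) U V z ∧
    V z = ph 1 z.1 * prof 1 U V z - ph (-1) z.1 * prof (-1) U V z := by
  simp only [prof, ← mul_assoc, ph_mul, neg_neg]
  norm_num [ph_zero]
  constructor <;> ring

theorem prof_ray {U V : ℝ × ℝ → ℂ} (S : Sys U V) {ς : ℝ} (hς : ς = 1 ∨ ς = -1) {a κ Λ ρ0 ρ1 : ℝ}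
    (I : Init U V a ρ0) (h0 : 1 < ρ0) (hκ0 : 0 ≤ κ) (hκ : κ ≤ 1 / 400) (ha : 0 < a) (ha1 : a ≤ 1)
    (h01 : ρ0 ≤ ρ1) (hl : 1 ≤ Λ - Real.log ρ1)
    (hb : ∀ ρ ∈ Set.Icc ρ0 ρ1, ∀ y ∈ Set.Icc (-(Λ - Real.log ρ)) (Λ - Real.log ρ),
      ‖U (ρ, y)‖ ≤ κ ∧ ‖V (ρ, y)‖ ≤ κ) {r1 r2 y : ℝ} (hr1 : ρ0 ≤ r1) (hr : r1 ≤ r2) (hr2 : r2 ≤ ρ1)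
    (hy : y ∈ Set.Icc (-(Λ - Real.log r2)) (Λ - Real.log r2)) :
    ‖Complex.exp (Complex.I * ((-Th (prof ς U V) ρ0 y r2 : ℝ) : ℂ)) * prof ς U V (r2, y) -
      Complex.exp (Complex.I * ((-Th (prof ς U V) ρ0 y r1 : ℝ) : ℂ)) * prof ς U V (r1, y)‖
      ≤ 9 * (3 * a + κ ^ 3) * r1 ^ (-(3:ℝ)/5) := by
  have hlog : ∀ r ∈ Set.Icc r1 r2, Real.log r ≤ Real.log r2 := fun r hr' =>
    Real.log_le_log (by linarith [hr'.1]) hr'.2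
  have hl0 : 1 ≤ Λ - Real.log ρ0 := log_mono_cone (by linarith) h01 hl
  have hg := growth S h0 hκ0 hκ ha ha1 hl hb (I.e1 Λ (by linarith)) (I.e2 Λ (by linarith))
  refine ray_est hς (prof_ABS S hς) (ℓ := fun r => Λ - Real.log r) (by linarith) hr hκ0 hκ (by positivity)
    ?_ ?_ ?_ ?_
  · intro r hrr
    exact log_mono_cone (by linarith [hrr.1]) (by linarith [hrr.2]) hl
  · intro r hrr
    have := hlog r hrr
    exact ⟨by linarith [hy.1], by linarith [hy.2]⟩
  · intro r hrr
    have hm : r ∈ Set.Icc ρ0 ρ1 := ⟨by linarith [hrr.1], by linarith [hrr.2]⟩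
    exact prof_CB S hς (by linarith [hrr.1]) ha (log_mono_cone (by linarith [hrr.1]) hm.2 hl) (hb r hm)
      (hg r hm).1 (hg r hm).2
  · intro r hrr
    exact Th_deriv (sm_prof S ς) h0 (by linarith [hrr.1])

theorem init_sup {U V : ℝ × ℝ → ℂ} (S : Sys U V) {a ρ0 : ℝ} (I : Init U V a ρ0) (h0 : 1 < ρ0)
    (ha : 0 < a) (y : ℝ) : ‖U (ρ0, y)‖ ≤ 2 * a ∧ ‖V (ρ0, y)‖ ≤ 2 * a := by
  set Λ := Real.log ρ0 + 1 + |y|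
  have hy0 : 0 ≤ |y| := abs_nonneg y
  have hl : 1 ≤ Λ - Real.log ρ0 := by simp only [Λ]; linarith
  have hy : y ∈ Set.Icc (-(Λ - Real.log ρ0)) (Λ - Real.log ρ0) := by
    exact abs_le.1 (by simp only [Λ]; linarith)
  have h1 := sup_e S.smU S.smV h0 hl one_pos hy
  have h2 := I.e0 Λ (by linarith)
  have h3 := I.e1 Λ (by linarith)
  constructor <;> refine (pow_le_pow_iff_left₀ (norm_nonneg _) (by positivity) two_ne_zero).1 ?_ <;>
    nlinarith [sq_nonneg (‖U (ρ0, y)‖), sq_nonneg (‖V (ρ0, y)‖)]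

theorem boot_step {U V : ℝ × ℝ → ℂ} (S : Sys U V) {a Λ ρ0 ρ1 : ℝ}
    (I : Init U V a ρ0) (h0 : 1 < ρ0) (ha : 0 < a) (ha1 : a ≤ 1 / 160000)
    (h01 : ρ0 ≤ ρ1) (hl : 1 ≤ Λ - Real.log ρ1)
    (hb : ∀ ρ ∈ Set.Icc ρ0 ρ1, ∀ y ∈ Set.Icc (-(Λ - Real.log ρ)) (Λ - Real.log ρ),
      ‖U (ρ, y)‖ ≤ 1/400 ∧ ‖V (ρ, y)‖ ≤ 1/400) :
    ∀ y ∈ Set.Icc (-(Λ - Real.log ρ1)) (Λ - Real.log ρ1),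
      ‖U (ρ1, y)‖ ≤ 1/800 ∧ ‖V (ρ1, y)‖ ≤ 1/800 := by
  intro y hy
  have g : ∀ ς : ℝ, ς = 1 ∨ ς = -1 → ‖prof ς U V (ρ1, y)‖ ≤ 1 / 1600 := by
    intro ς hς
    have h := prof_ray S hς I h0 (by norm_num) le_rfl ha (by linarith) h01 hl hb le_rfl h01 le_rfl hy
    rw [Th_self] at h
    have hi := init_sup S I h0 ha y
    have h3 : ‖prof ς U V (ρ0, y)‖ ≤ 2 * a := by
      have := half_norm (-ς) ρ0 (U (ρ0, y)) (V (ρ0, y)) hς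
      unfold prof; linarith
    have h4 : ρ0 ^ (-(3:ℝ)/5) ≤ 1 := Real.rpow_le_one_of_one_le_of_nonpos h0.le (by norm_num)
    have h5 : 9 * (3 * a + (1/400)^3) * ρ0 ^ (-(3:ℝ)/5) ≤ 9 * (3 * a + (1/400)^3) * 1 := by gcongr
    have h6 := (norm_sub_norm_le _ _).trans h
    rw [norm_mul, norm_mul, norm_expI, norm_expI] at h6
    norm_num at h5 h6
    linarith
  have g1 := g 1 (Or.inl rfl)
  have g2 := g (-1) (Or.inr rfl)
  obtain ⟨e1, e2⟩ := uv_prof U V (ρ1, y)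
  rw [e1, e2]
  have n1 : ‖ph 1 ρ1 * prof 1 U V (ρ1, y)‖ ≤ 1/1600 := by rw [norm_mul, norm_ph, one_mul]; exact g1
  have n2 : ‖ph (-1) ρ1 * prof (-1) U V (ρ1, y)‖ ≤ 1/1600 := by rw [norm_mul, norm_ph, one_mul]; exact g2
  exact ⟨(norm_add_le _ _).trans (by linarith), (norm_sub_le _ _).trans (by linarith)⟩

theorem boot_cone {U V : ℝ × ℝ → ℂ} (S : Sys U V) {a Λ ρ0 ρ1 : ℝ}
    (I : Init U V a ρ0) (h0 : 1 < ρ0) (ha : 0 < a) (ha1 : a ≤ 1 / 160000)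
    (hl : 1 ≤ Λ - Real.log ρ1) :
    ∀ ρ ∈ Set.Icc ρ0 ρ1, ∀ y ∈ Set.Icc (-(Λ - Real.log ρ)) (Λ - Real.log ρ),
      ‖U (ρ, y)‖ ≤ 1/400 ∧ ‖V (ρ, y)‖ ≤ 1/400 := by
  set K : Set (ℝ × ℝ) := Set.Icc ρ0 ρ1 ×ˢ Set.Icc (-Λ) Λ with hK
  have hKc : IsCompact K := isCompact_Icc.prod isCompact_Icc
  have hKO : K ⊆ O2 := fun z hz => lt_of_lt_of_le h0 hz.1.1
  set g : ℝ × ℝ → ℝ × ℝ := fun z => (Λ - Real.log z.1 - |z.2|, max ‖U z‖ ‖V z‖) with hg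
  have hgc : ContinuousOn g K := by
    refine ContinuousOn.prodMk ?_ ?_
    · refine ContinuousOn.sub (continuousOn_const.sub (ContinuousOn.log continuous_fst.continuousOn ?_))
        (continuous_snd.abs.continuousOn)
      intro z hz
      have : 1 < z.1 := hKO hz
      positivity
    · exact ((S.smU.co.mono hKO).norm).sup ((S.smV.co.mono hKO).norm)
  set bad := K ∩ g ⁻¹' (Set.Ici 0 ×ˢ Set.Ici (1/400)) with hbad
  have hbc : IsCompact bad := by
    refine hKc.of_isClosed_subset (hgc.preimage_isClosed_of_isClosed hKc.isClosed
      (isClosed_Ici.prod isClosed_Ici)) Set.inter_subset_left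
  have hcone : ∀ ρ ∈ Set.Icc ρ0 ρ1, ∀ y ∈ Set.Icc (-(Λ - Real.log ρ)) (Λ - Real.log ρ),
      1/400 ≤ max ‖U (ρ, y)‖ ‖V (ρ, y)‖ → (ρ, y) ∈ bad := by
    intro ρ hρ y hy hm
    have hlr : 0 ≤ Real.log ρ := Real.log_nonneg (by linarith [hρ.1])
    refine ⟨⟨hρ, ⟨by linarith [hy.1], by linarith [hy.2]⟩⟩, ?_, hm⟩
    have : |y| ≤ Λ - Real.log ρ := abs_le.2 hy
    show 0 ≤ Λ - Real.log ρ - |y|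
    linarith
  by_cases hne : bad.Nonempty
  · exfalso
    obtain ⟨⟨ρs, ys⟩, hmem, hmin⟩ := hbc.exists_isMinOn hne continuous_fst.continuousOn
    have hρs : ρs ∈ Set.Icc ρ0 ρ1 := hmem.1.1
    have hys : ys ∈ Set.Icc (-(Λ - Real.log ρs)) (Λ - Real.log ρs) := by
      have h1 : 0 ≤ Λ - Real.log ρs - |ys| := hmem.2.1
      exact abs_le.1 (by linarith)
    have hls : 1 ≤ Λ - Real.log ρs := log_mono_cone (by linarith [hρs.1]) hρs.2 hl
    have hlt : ∀ ρ ∈ Set.Ico ρ0 ρs, ∀ y ∈ Set.Icc (-(Λ - Real.log ρ)) (Λ - Real.log ρ),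
        max ‖U (ρ, y)‖ ‖V (ρ, y)‖ ≤ 1/400 := by
      intro ρ hρ y hy
      by_contra hcon
      push Not at hcon
      have hb := hcone ρ ⟨hρ.1, by linarith [hρ.2, hρs.2]⟩ y hy hcon.le
      have h3 : ρs ≤ ρ := hmin hb
      linarith [hρ.2]
    have hle : ∀ ρ ∈ Set.Icc ρ0 ρs, ∀ y ∈ Set.Icc (-(Λ - Real.log ρ)) (Λ - Real.log ρ),
        ‖U (ρ, y)‖ ≤ 1/400 ∧ ‖V (ρ, y)‖ ≤ 1/400 := by
      intro ρ hρ y hy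
      rcases lt_or_eq_of_le hρ.2 with h | h
      · have := hlt ρ ⟨hρ.1, h⟩ y hy
        exact ⟨(le_max_left _ _).trans this, (le_max_right _ _).trans this⟩
      · rcases lt_or_eq_of_le hρs.1 with h' | h'
        · subst h
          have hcl : ∀ W : ℝ × ℝ → ℂ, Sm O2 W → (∀ r ∈ Set.Ico ρ0 ρ, ‖W (r, y)‖ ≤ 1/400) →
              ‖W (ρ, y)‖ ≤ 1/400 := by
            intro W hW hb
            have hc : ContinuousAt (fun r => ‖W (r, y)‖) ρ :=
              (hW.hd1 (mem_O2.2 (by linarith))).continuousAt.norm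
            have ht : Filter.Tendsto (fun r => ‖W (r, y)‖) (nhdsWithin ρ (Set.Iio ρ)) (nhds ‖W (ρ, y)‖) :=
              hc.tendsto.mono_left nhdsWithin_le_nhds
            refine le_of_tendsto ht ?_
            filter_upwards [Ico_mem_nhdsLT h'] with r hr using hb r hr
          have hyr : ∀ r ∈ Set.Ico ρ0 ρ, y ∈ Set.Icc (-(Λ - Real.log r)) (Λ - Real.log r) := by
            intro r hr
            have := Real.log_le_log (by linarith [hr.1]) hr.2.le
            exact ⟨by linarith [hy.1], by linarith [hy.2]⟩
          exact ⟨hcl U S.smU fun r hr => (le_max_left _ _).trans (hlt r hr y (hyr r hr)),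
            hcl V S.smV fun r hr => (le_max_right _ _).trans (hlt r hr y (hyr r hr))⟩
        · rw [h, ← h']
          have := init_sup S I h0 ha y
          exact ⟨by linarith [this.1], by linarith [this.2]⟩
    have hf := boot_step S I h0 ha ha1 hρs.1 hls hle ys hys
    have hbd : 1/400 ≤ max ‖U (ρs, ys)‖ ‖V (ρs, ys)‖ := hmem.2.2
    have := max_le hf.1 hf.2
    linarith
  · intro ρ hρ y hy
    by_contra hcon
    refine hne ⟨_, hcone ρ hρ y hy ?_⟩
    by_contra h
    push Not at h
    exact hcon ⟨((le_max_left _ _).trans h.le), ((le_max_right _ _).trans h.le)⟩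

theorem boot {U V : ℝ × ℝ → ℂ} (S : Sys U V) {a ρ0 : ℝ}
    (I : Init U V a ρ0) (h0 : 1 < ρ0) (ha : 0 < a) (ha1 : a ≤ 1 / 160000) :
    (∀ ρ y, ρ0 ≤ ρ → ‖U (ρ, y)‖ ≤ 1/400 ∧ ‖V (ρ, y)‖ ≤ 1/400) ∧
    ∀ ς : ℝ, ς = 1 ∨ ς = -1 → ∀ r1 r2 y, ρ0 ≤ r1 → r1 ≤ r2 →
      ‖Complex.exp (Complex.I * ((-Th (prof ς U V) ρ0 y r2 : ℝ) : ℂ)) * prof ς U V (r2, y) -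
      Complex.exp (Complex.I * ((-Th (prof ς U V) ρ0 y r1 : ℝ) : ℂ)) * prof ς U V (r1, y)‖
      ≤ 1 * r1 ^ (-(3:ℝ)/5) := by
  constructor
  · intro ρ y hρ
    refine boot_cone S I h0 ha ha1 (Λ := Real.log ρ + 1 + |y|) (ρ1 := ρ) ?_ ρ ⟨hρ, le_rfl⟩ y (abs_le.1 ?_)
    · linarith [abs_nonneg y]
    · linarith [abs_nonneg y]
  · intro ς hς r1 r2 y h1 h2
    have hl : 1 ≤ Real.log r2 + 1 + |y| - Real.log r2 := by linarith [abs_nonneg y]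
    refine (prof_ray S hς I h0 (by norm_num) le_rfl ha (by linarith) (h1.trans h2) hl
      (boot_cone S I h0 ha ha1 hl) h1 h2 le_rfl (abs_le.1 (by linarith))).trans ?_
    have : 0 < r1 ^ (-(3:ℝ)/5) := Real.rpow_pos_of_pos (by linarith) _
    gcongr
    norm_num
    linarith

/-! ### Part H: scattering -/

theorem rpow_tend (c : ℝ) : Filter.Tendsto (fun r : ℝ => c * r ^ (-(3:ℝ)/5)) Filter.atTop (nhds 0) := by
  have h := (tendsto_rpow_neg_atTop (y := (3:ℝ)/5) (by norm_num)).const_mul c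
  rw [mul_zero] at h
  refine h.congr fun r => ?_
  rw [neg_div]

theorem lim_rate {F : ℝ → ℂ} {c ρ0 : ℝ}
    (h : ∀ r1 r2, ρ0 ≤ r1 → r1 ≤ r2 → ‖F r2 - F r1‖ ≤ c * r1 ^ (-(3:ℝ)/5)) :
    ∃ L, Filter.Tendsto F Filter.atTop (nhds L) ∧ ∀ r, ρ0 ≤ r → ‖F r - L‖ ≤ c * r ^ (-(3:ℝ)/5) := by
  have hC : CauchySeq F := by
    rw [Metric.cauchySeq_iff']
    intro ε hε
    have h1 := (rpow_tend c).eventually (gt_mem_nhds hε)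
    obtain ⟨N, hN1, hN2⟩ := (h1.and (Filter.eventually_ge_atTop ρ0)).exists
    refine ⟨N, fun n hn => ?_⟩
    rw [dist_eq_norm]
    exact (h N n hN2 hn).trans_lt hN1
  obtain ⟨L, hL⟩ := cauchySeq_tendsto_of_complete hC
  refine ⟨L, hL, fun r hr => ?_⟩
  have h2 : Filter.Tendsto (fun s => ‖F r - F s‖) Filter.atTop (nhds ‖F r - L‖) :=
    (tendsto_const_nhds.sub hL).norm
  refine le_of_tendsto h2 ?_
  filter_upwards [Filter.eventually_ge_atTop r] with s hs
  rw [norm_sub_rev]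
  exact h r s hr hs

theorem exp_lip (a b : ℝ) : ‖Complex.exp (Complex.I * (a : ℂ)) - Complex.exp (Complex.I * (b : ℂ))‖ ≤ |a - b| := by
  have h := Real.norm_exp_I_mul_ofReal_sub_one_le (x := a - b)
  have e : Complex.exp (Complex.I * (a : ℂ)) - Complex.exp (Complex.I * (b : ℂ)) =
      Complex.exp (Complex.I * (b : ℂ)) * (Complex.exp (Complex.I * ((a - b : ℝ) : ℂ)) - 1) := by
    rw [mul_sub, ← Complex.exp_add]; push_cast; ring_nf
  rw [e, norm_mul, norm_expI, one_mul]
  exact h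

theorem expI_add (a b : ℝ) : Complex.exp (Complex.I * ((a + b : ℝ) : ℂ)) =
    Complex.exp (Complex.I * (a : ℂ)) * Complex.exp (Complex.I * (b : ℂ)) := by
  rw [← Complex.exp_add]; push_cast; ring_nf

/-- scattering along one ray -/
theorem scat_ray {A : ℝ × ℝ → ℂ} (hA : Sm O2 A) {ρ0 y : ℝ} (h0 : 1 < ρ0)
    (hb : ∀ r, ρ0 ≤ r → ‖A (r, y)‖ ≤ 1/400)
    (hC : ∀ r1 r2, ρ0 ≤ r1 → r1 ≤ r2 →
      ‖Complex.exp (Complex.I * ((-Th A ρ0 y r2 : ℝ) : ℂ)) * A (r2, y) -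
      Complex.exp (Complex.I * ((-Th A ρ0 y r1 : ℝ) : ℂ)) * A (r1, y)‖ ≤ 1 * r1 ^ (-(3:ℝ)/5)) :
    ∃ f : ℂ, ‖f‖ ≤ 1/400 ∧ ∀ r, ρ0 ≤ r →
      |‖A (r, y)‖ - ‖f‖| ≤ r ^ (-(3:ℝ)/5) ∧
      ‖A (r, y) - Complex.exp (Complex.I * ((‖f‖ ^ 2 * Real.log r : ℝ) : ℂ)) * f‖ ≤ 2 * r ^ (-(3:ℝ)/5) := by
  obtain ⟨G, hGt, hG⟩ := lim_rate hC
  have nG : ‖G‖ ≤ 1/400 := by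
    refine le_of_tendsto hGt.norm ?_
    filter_upwards [Filter.eventually_ge_atTop ρ0] with r hr
    rw [norm_mul, norm_expI, one_mul]; exact hb r hr
  have hd : ∀ r, ρ0 ≤ r → |‖A (r, y)‖ - ‖G‖| ≤ r ^ (-(3:ℝ)/5) := by
    intro r hr
    have := (abs_norm_sub_norm_le _ _).trans (hG r hr)
    rw [norm_mul, norm_expI, one_mul, one_mul] at this
    exact this
  set P : ℝ → ℂ := fun r => ((Th A ρ0 y r - ‖G‖ ^ 2 * Real.log r : ℝ) : ℂ) with hP
  have hPd : ∀ r, ρ0 ≤ r → HasDerivAt P ((‖A (r, y)‖ ^ 2 * r⁻¹ - ‖G‖ ^ 2 * r⁻¹ : ℝ) : ℂ) r := by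
    intro r hr
    exact ((Th_deriv hA h0 (by linarith)).sub ((Real.hasDerivAt_log (by linarith)).const_mul _)).ofReal_comp
  have hPC : ∀ r1 r2, ρ0 ≤ r1 → r1 ≤ r2 → ‖P r2 - P r1‖ ≤ 5/3 * (1/200) * r1 ^ (-(3:ℝ)/5) := by
    intro r1 r2 h1 h2
    refine tail_bound (by linarith) h2 (by norm_num) (fun r hr => hPd r (by linarith [hr.1])) ?_
    intro r hr
    have hr0 : 0 < r := by linarith [hr.1]
    rw [Complex.norm_real, Real.norm_eq_abs]
    have e : ‖A (r, y)‖ ^ 2 * r⁻¹ - ‖G‖ ^ 2 * r⁻¹ = (‖A (r, y)‖ + ‖G‖) * ((‖A (r, y)‖ - ‖G‖) * r⁻¹) := by ring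
    have e2 : r ^ (-(8:ℝ)/5) = r ^ (-(3:ℝ)/5) * r⁻¹ := by
      rw [← Real.rpow_neg_one, ← Real.rpow_add hr0]; norm_num
    rw [e, abs_mul, abs_mul, e2, abs_of_nonneg (by positivity : 0 ≤ ‖A (r, y)‖ + ‖G‖),
      abs_of_pos (inv_pos.2 hr0)]
    have := hb r (by linarith [hr.1])
    have h4 := hd r (by linarith [hr.1])
    have h5 : ‖A (r, y)‖ + ‖G‖ ≤ 1/200 := by linarith
    gcongr
  obtain ⟨p', hPt, hPl⟩ := lim_rate hPC
  have hpr : ∃ p : ℝ, p' = p := by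
    have him : Filter.Tendsto (fun r => (P r).im) Filter.atTop (nhds p'.im) :=
      (Complex.continuous_im.tendsto _).comp hPt
    have : p'.im = 0 := by
      refine tendsto_nhds_unique him ?_
      simp only [hP, Complex.ofReal_im]; exact tendsto_const_nhds
    exact ⟨p'.re, by apply Complex.ext <;> simp [this]⟩
  obtain ⟨p, rfl⟩ := hpr
  have nf : ‖Complex.exp (Complex.I * (p : ℂ)) * G‖ = ‖G‖ := by rw [norm_mul, norm_expI, one_mul]
  refine ⟨Complex.exp (Complex.I * (p : ℂ)) * G, nf.le.trans nG, fun r hr => ?_⟩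
  rw [nf]
  refine ⟨hd r hr, ?_⟩
  have hr0 : 0 < r ^ (-(3:ℝ)/5) := Real.rpow_pos_of_pos (by linarith) _
  obtain ⟨q, hq⟩ : ∃ q, q = Th A ρ0 y r - ‖G‖ ^ 2 * Real.log r := ⟨_, rfl⟩
  have hPr : |q - p| ≤ 5/3 * (1/200) * r ^ (-(3:ℝ)/5) := by
    have := hPl r hr
    simp only [hP, ← hq] at this
    rwa [← Complex.ofReal_sub, Complex.norm_real, Real.norm_eq_abs] at this
  have hGr := hG r hr
  set Gr := Complex.exp (Complex.I * ((-Th A ρ0 y r : ℝ) : ℂ)) * A (r, y) with hGrdef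
  have eA : A (r, y) = Complex.exp (Complex.I * ((‖G‖ ^ 2 * Real.log r : ℝ) : ℂ)) *
      (Complex.exp (Complex.I * (q : ℂ)) * Gr) := by
    rw [hGrdef, ← mul_assoc, ← mul_assoc, ← expI_add, ← expI_add, hq]
    have : ‖G‖ ^ 2 * Real.log r + (Th A ρ0 y r - ‖G‖ ^ 2 * Real.log r) + -Th A ρ0 y r = 0 := by ring
    rw [this]; simp
  rw [eA, ← mul_sub, norm_mul, norm_expI, one_mul]
  have e3 : Complex.exp (Complex.I * (q : ℂ)) * Gr - Complex.exp (Complex.I * (p : ℂ)) * G =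
     Complex.exp (Complex.I * (q : ℂ)) * (Gr - G) +
     (Complex.exp (Complex.I * (q : ℂ)) - Complex.exp (Complex.I * (p : ℂ))) * G := by ring
  rw [e3]
  refine (norm_add_le _ _).trans ?_
  rw [norm_mul, norm_mul, norm_expI, one_mul]
  have h6 := exp_lip q p
  have h7 : ‖Complex.exp (Complex.I * (q : ℂ)) - Complex.exp (Complex.I * (p : ℂ))‖ * ‖G‖ ≤
      (5/3 * (1/200) * r ^ (-(3:ℝ)/5)) * (1/400) := by
    gcongr
    exact h6.trans hPr
  linarith

theorem scat {A : ℝ × ℝ → ℂ} (hA : Sm O2 A) {ρ0 : ℝ} (h0 : 1 < ρ0)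
    (hb : ∀ r y, ρ0 ≤ r → ‖A (r, y)‖ ≤ 1/400)
    (hC : ∀ r1 r2 y, ρ0 ≤ r1 → r1 ≤ r2 →
      ‖Complex.exp (Complex.I * ((-Th A ρ0 y r2 : ℝ) : ℂ)) * A (r2, y) -
      Complex.exp (Complex.I * ((-Th A ρ0 y r1 : ℝ) : ℂ)) * A (r1, y)‖ ≤ 1 * r1 ^ (-(3:ℝ)/5)) :
    ∃ f : ℝ → ℂ, Continuous f ∧ (∀ y, ‖f y‖ ≤ 1/400) ∧ ∀ r y, ρ0 ≤ r →
      ‖A (r, y) - Complex.exp (Complex.I * ((‖f y‖ ^ 2 * Real.log r : ℝ) : ℂ)) * f y‖ ≤ 2 * r ^ (-(3:ℝ)/5) := by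
  choose f hf1 hf2 using fun y => scat_ray hA h0 (fun r => hb r y) (fun r1 r2 => hC r1 r2 y)
  have hnf : Continuous fun y => ‖f y‖ := by
    have hu : TendstoUniformly (fun r y => ‖A (r, y)‖) (fun y => ‖f y‖) Filter.atTop := by
      rw [Metric.tendstoUniformly_iff]
      intro ε hε
      have h1 := (rpow_tend 1).eventually (gt_mem_nhds hε)
      filter_upwards [h1, Filter.eventually_ge_atTop ρ0] with r hr1 hr2 y
      rw [dist_comm, Real.dist_eq]
      have := (hf2 y r hr2).1
      linarith
    refine hu.continuous (Filter.Eventually.frequently ?_)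
    filter_upwards [Filter.eventually_ge_atTop ρ0] with r hr
    exact (hA.slice (by linarith)).norm
  refine ⟨f, ?_, hf1, fun r y hr => (hf2 y r hr).2⟩
  have hu : TendstoUniformly (fun r y => Complex.exp (Complex.I * ((-(‖f y‖ ^ 2 * Real.log r) : ℝ) : ℂ)) * A (r, y))
      f Filter.atTop := by
    rw [Metric.tendstoUniformly_iff]
    intro ε hε
    have h1 := (rpow_tend 2).eventually (gt_mem_nhds hε)
    filter_upwards [h1, Filter.eventually_ge_atTop ρ0] with r hr1 hr2 y
    rw [dist_comm, dist_eq_norm]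
    have h3 := (hf2 y r hr2).2
    refine lt_of_le_of_lt ?_ hr1
    refine le_trans (le_of_eq ?_) h3
    obtain ⟨x, hx⟩ : ∃ x, x = ‖f y‖ ^ 2 * Real.log r := ⟨_, rfl⟩
    rw [← hx]
    have : Complex.exp (Complex.I * ((-x : ℝ) : ℂ)) * A (r, y) - f y =
      Complex.exp (Complex.I * ((-x : ℝ) : ℂ)) * (A (r, y) - Complex.exp (Complex.I * ((x : ℝ) : ℂ)) * f y) := by
      rw [mul_sub, ← mul_assoc, ← expI_add]; simp
    rw [this, norm_mul, norm_expI, one_mul]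
  refine hu.continuous (Filter.Eventually.frequently ?_)
  filter_upwards [Filter.eventually_ge_atTop ρ0] with r hr
  refine Continuous.mul ?_ (hA.slice (by linarith))
  fun_prop

/-! ### Part I: abstract exterior energy estimate in null coordinates -/

/-- domain of null coordinates -/
def N2 : Set (ℝ × ℝ) := {z | 2 < z.1 + z.2}
theorem N2_open : IsOpen N2 := isOpen_lt continuous_const (continuous_fst.add continuous_snd)
theorem mem_N2 {p q : ℝ} : (p, q) ∈ N2 ↔ 2 < p + q := Iff.rfl

theorem hyp_le {T p : ℝ} (hp : 0 < p) : 2 * T - p ≤ T ^ 2 / p := by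
  rw [le_div_iff₀ hp]; nlinarith [sq_nonneg (p - T)]

/-- bound by the bottom value plus the integral of a majorant of the derivative -/
theorem ftc_bound {F g : ℝ × ℝ → ℝ} (hF : Sm N2 F) (hg : Sm N2 g) {p lo hi : ℝ} (hlo : 2 < p + lo)
    (h0 : ∀ q, lo ≤ q → q ≤ hi → 0 ≤ g (p, q))
    (h : ∀ q, lo ≤ q → q ≤ hi → d2 F (p, q) ≤ g (p, q)) :
    ∀ q, lo ≤ q → q ≤ hi → F (p, q) ≤ F (p, lo) + ∫ s in lo..hi, g (p, s) := by
  intro q hq hq2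
  have hseg : ∀ c d, lo ≤ c → lo ≤ d → ∀ s ∈ Set.uIcc c d, (p, s) ∈ N2 := by
    intro c d hc hd s hs
    rw [mem_N2]; have := hs.1; have : lo ≤ s := le_trans (le_min hc hd) this
    linarith
  have e1 : ∫ s in lo..q, d2 F (p, s) = F (p, q) - F (p, lo) := by
    refine intervalIntegral.integral_eq_sub_of_hasDerivAt (f := fun s => F (p, s)) ?_ (hF.d2.ii (hseg _ _ le_rfl hq))
    intro s hs
    exact hF.hd2 (hseg _ _ le_rfl hq s hs)
  have e2 : ∫ s in lo..q, d2 F (p, s) ≤ ∫ s in lo..q, g (p, s) := by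
    refine intervalIntegral.integral_mono_on hq (hF.d2.ii (hseg _ _ le_rfl hq)) (hg.ii (hseg _ _ le_rfl hq)) ?_
    intro s hs; exact h s hs.1 (hs.2.trans hq2)
  have e3 : ∫ s in lo..q, g (p, s) ≤ ∫ s in lo..hi, g (p, s) := by
    rw [← intervalIntegral.integral_add_adjacent_intervals (hg.ii (hseg lo q le_rfl hq))
      (hg.ii (hseg q hi hq (hq.trans hq2)))]
    have : 0 ≤ ∫ s in q..hi, g (p, s) :=
      intervalIntegral.integral_nonneg hq2 fun s hs => h0 s (hq.trans hs.1) hs.2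
    linarith
  linarith

theorem ext_energy {a b ev nu mu : ℝ × ℝ → ℝ} (ha : Sm N2 a) (hb : Sm N2 b) (hev : Sm N2 ev)
    (hnu : Sm N2 nu) (hmu : Sm N2 mu)
    (a0 : ∀ z, z.2 ≤ 2 → 0 ≤ a z) (b0 : ∀ z, z.2 ≤ 2 → 0 ≤ b z) (ev0 : ∀ z, 0 ≤ ev z)
    (h1 : ∀ z ∈ N2, z.2 ≤ 2 → d1 a z + d2 b z ≤ -ev z + 90 * (nu z * a z + mu z * ev z))
    (h2 : ∀ z ∈ N2, z.2 ≤ 2 → d2 nu z ≤ ev z) (h2' : ∀ z, z.2 ≤ 2 → nu z ≤ b z)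
    (h3 : ∀ z ∈ N2, z.2 ≤ 2 → d2 mu z ≤ a z) (h3' : ∀ z, z.2 ≤ 2 → mu z ≤ a z)
    {T D0 : ℝ} (hT : 1 < T) (hT2 : T ≤ 2) (hD : 0 < D0) (hD1 : D0 ≤ 1 / 630)
    (hd : ∀ x : ℝ, 0 ≤ x → a (T + x, T - x) + b (T + x, T - x) ≤ D0 / (1 + x) ^ 2) :
    ∀ P, T ≤ P → ∫ s in T..P, (b (s, T ^ 2 / s) + T ^ 2 / s ^ 2 * a (s, T ^ 2 / s)) ≤ 3 * D0 := by
  intro P hP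
  have hT0 : 0 < T := by linarith
  have hin : ∀ p q, 0 < p → 2 * T - p ≤ q → (p, q) ∈ N2 := by
    intro p q hp hq; rw [mem_N2]; linarith
  have htop : ∀ p, 0 < p → (p, T ^ 2 / p) ∈ N2 := fun p hp => hin p _ hp (hyp_le hp)
  have htop2 : ∀ p, T ≤ p → T ^ 2 / p ≤ 2 := by
    intro p hp; rw [div_le_iff₀ (by linarith)]; nlinarith
  have hseg : ∀ p, 0 < p → ∀ q ∈ Set.uIcc (2 * T - p) (T ^ 2 / p), (p, q) ∈ N2 := by
    intro p hp q hq
    rw [Set.uIcc_of_le (hyp_le hp)] at hq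
    exact hin p q hp hq.1
  set bd : ℝ → ℝ := fun s => b (s, T ^ 2 / s) + T ^ 2 / s ^ 2 * a (s, T ^ 2 / s) with hbd
  have hbdc : ContinuousOn bd (Set.Ioi 0) := by
    have c1 : ContinuousOn (fun s : ℝ => (s, T ^ 2 / s)) (Set.Ioi 0) := by
      refine continuousOn_id.prodMk (continuousOn_const.div continuousOn_id ?_)
      intro x hx; exact (ne_of_gt hx)
    have c2 : Set.MapsTo (fun s : ℝ => (s, T ^ 2 / s)) (Set.Ioi 0) N2 := fun s hs => htop s hs
    refine (hb.co.comp c1 c2).add (ContinuousOn.mul ?_ (ha.co.comp c1 c2))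
    refine continuousOn_const.div (by fun_prop) ?_
    intro x hx; have : (0:ℝ) < x := hx; positivity
  have hbd0 : ∀ s, T ≤ s → 0 ≤ bd s := by
    intro s hs
    have := a0 (s, T ^ 2 / s) (htop2 s hs)
    have := b0 (s, T ^ 2 / s) (htop2 s hs)
    simp only [hbd]; positivity
  have hbi : ∀ c d, 0 < c → 0 < d → IntervalIntegrable bd volume c d := by
    intro c d hc hd
    refine (hbdc.mono ?_).intervalIntegrable
    intro x hx
    exact lt_of_lt_of_le (lt_min hc hd) hx.1
  set Z : ℝ → ℝ := fun p => (∫ q in (2 * T - p)..(T ^ 2 / p), a (p, q)) + ∫ s in T..p, bd s with hZ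
  set B : ℝ → ℝ := fun p => 3 * D0 * (1 - (1 + (p - T))⁻¹) with hB
  have main : ∀ r ∈ Set.Icc T P, Z r ≤ B r := by
    refine fence (B' := fun p => 3 * D0 * (1 / (1 + (p - T)) ^ 2)) ?_ ?_ ?_
    · intro r hr
      have h0 : HasDerivAt (fun p : ℝ => 1 + (p - T)) 1 r := by
        simpa using ((hasDerivAt_id r).sub_const T).const_add 1
      have hne : 1 + (r - T) ≠ 0 := by have := hr.1; linarith
      have := ((h0.inv hne).const_sub 1).const_mul (3 * D0)
      refine this.congr_deriv ?_
      ring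
    · have e : T ^ 2 / T = T := by field_simp
      simp only [hZ, hB, e]
      simp [two_mul]
    · intro p hp
      have hpT : T ≤ p := hp.1
      have hp0 : 0 < p := by linarith
      have hα : HasDerivAt (fun r : ℝ => 2 * T - r) (-1) p := by
        simpa using (hasDerivAt_id p).const_sub (2 * T)
      have hβ : HasDerivAt (fun r : ℝ => T ^ 2 / r) (-(T ^ 2 / p ^ 2)) p := by
        have := (hasDerivAt_inv hp0.ne').const_mul (T ^ 2)
        simpa [div_eq_mul_inv] using this
      have hL := leib ha (α := fun r => 2 * T - r) (α' := -1) (β := fun r => T ^ 2 / r) hα hβ (p := p) (hseg p hp0)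
      have hR : HasDerivAt (fun p => ∫ s in T..p, bd s) (bd p) p := by
        refine intervalIntegral.integral_hasDerivAt_right (hbi T p hT0 hp0) ?_ (hbdc.continuousAt (Ioi_mem_nhds hp0))
        exact hbdc.stronglyMeasurableAtFilter isOpen_Ioi p hp0
      refine ⟨_, hL.add hR, ?_⟩
      intro hZB
      have hs0 := hseg p hp0
      have hle := hyp_le (T := T) hp0
      have ib : ∫ q in (2 * T - p)..(T ^ 2 / p), d2 b (p, q) = b (p, T ^ 2 / p) - b (p, 2 * T - p) := by
        refine intervalIntegral.integral_eq_sub_of_hasDerivAt (f := fun s => b (p, s)) ?_ (hb.d2.ii hs0)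
        intro s hs
        exact hb.hd2 (hs0 s hs)
      have hq2 : ∀ q, q ≤ T ^ 2 / p → q ≤ 2 := fun q hq => hq.trans (htop2 p hpT)
      set d := a (p, 2 * T - p) + b (p, 2 * T - p) with hdd
      set s := ∫ q in (2 * T - p)..(T ^ 2 / p), ev (p, q) with hs
      set A := ∫ q in (2 * T - p)..(T ^ 2 / p), a (p, q) with hA
      have hs_nn : 0 ≤ s := intervalIntegral.integral_nonneg hle fun q _ => ev0 _
      have hA_nn : 0 ≤ A := intervalIntegral.integral_nonneg hle fun q hq => a0 _ (hq2 _ hq.2)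
      have hdx : d ≤ D0 / (1 + (p - T)) ^ 2 := by
        have := hd (p - T) (by linarith)
        have e1 : T + (p - T) = p := by ring
        have e2 : T - (p - T) = 2 * T - p := by ring
        rw [e1, e2] at this; exact this
      have hd_nn : 0 ≤ d := add_nonneg (a0 _ (hq2 _ hle)) (b0 _ (hq2 _ hle))
      have hbot : 2 < p + (2 * T - p) := by linarith
      have nub : ∀ q, 2 * T - p ≤ q → q ≤ T ^ 2 / p → nu (p, q) ≤ d + s := by
        intro q hq hq'
        have := ftc_bound hnu hev hbot (fun q _ _ => ev0 _) (fun q h h' => h2 _ (hin p q hp0 h) (hq2 _ h')) q hq hq'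
        have h5 := h2' (p, 2 * T - p) (hq2 _ hle)
        have h6 := a0 (p, 2 * T - p) (hq2 _ hle)
        linarith
      have mub : ∀ q, 2 * T - p ≤ q → q ≤ T ^ 2 / p → mu (p, q) ≤ d + A := by
        intro q hq hq'
        have := ftc_bound hmu ha hbot (fun q _ h => a0 _ (hq2 _ h)) (fun q h h' => h3 _ (hin p q hp0 h) (hq2 _ h')) q hq hq'
        have h5 := h3' (p, 2 * T - p) (hq2 _ hle)
        have h6 := b0 (p, 2 * T - p) (hq2 _ hle)
        linarith
      have hIntg : (∫ q in (2 * T - p)..(T ^ 2 / p), (d1 a (p, q) + d2 b (p, q))) ≤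
          ∫ q in (2 * T - p)..(T ^ 2 / p), ((90 * (d + s)) * a (p, q) + (90 * (d + A) - 1) * ev (p, q)) := by
        refine intervalIntegral.integral_mono_on hle ((ha.d1.ii hs0).add (hb.d2.ii hs0))
          (((ha.ii hs0).const_mul _).add ((hev.ii hs0).const_mul _)) ?_
        intro q hq
        have k1 := h1 (p, q) (hin p q hp0 hq.1) (hq2 _ hq.2)
        have k2 := mul_le_mul_of_nonneg_right (nub q hq.1 hq.2) (a0 (p, q) (hq2 _ hq.2))
        have k3 := mul_le_mul_of_nonneg_right (mub q hq.1 hq.2) (ev0 (p, q))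
        linarith
      rw [intervalIntegral.integral_add (ha.d1.ii hs0) (hb.d2.ii hs0), ib,
        intervalIntegral.integral_add ((ha.ii hs0).const_mul _) ((hev.ii hs0).const_mul _),
        intervalIntegral.integral_const_mul, intervalIntegral.integral_const_mul, ← hA, ← hs] at hIntg
      have hJ : 0 ≤ ∫ s in T..p, bd s := intervalIntegral.integral_nonneg hpT fun s hs => hbd0 s hs.1
      have hx1 : (1:ℝ) ≤ 1 + (p - T) := by linarith
      have hAZ : A ≤ 3 * D0 := by
        have : A ≤ B p := by rw [← hZB]; simp only [hZ]; linarith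
        have h7 : 0 ≤ (1 + (p - T))⁻¹ := by positivity
        simp only [hB] at this
        nlinarith
      have hdD : d ≤ D0 := by
        refine hdx.trans (div_le_self hD.le ?_)
        nlinarith
      have hpos : 0 < D0 / (1 + (p - T)) ^ 2 := by positivity
      have e3 : 3 * D0 * (1 / (1 + (p - T)) ^ 2) = 3 * (D0 / (1 + (p - T)) ^ 2) := by ring
      rw [e3]
      simp only [hbd, smul_eq_mul]
      have k5 : d * A ≤ d * (3 * D0) := mul_le_mul_of_nonneg_left hAZ hd_nn
      have k6 : s * A ≤ s * (3 * D0) := mul_le_mul_of_nonneg_left hAZ hs_nn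
      have k7 : s * d ≤ s * D0 := mul_le_mul_of_nonneg_left hdD hs_nn
      have k8 : s * D0 ≤ s * (1/630) := mul_le_mul_of_nonneg_left hD1 hs_nn
      have k9 : d * D0 ≤ d * (1/630) := mul_le_mul_of_nonneg_left hD1 hd_nn
      nlinarith
  have hf := main P ⟨hP, le_rfl⟩
  have hA_nn : 0 ≤ ∫ q in (2 * T - P)..(T ^ 2 / P), a (P, q) :=
    intervalIntegral.integral_nonneg (hyp_le (by linarith)) fun q hq => a0 _ (hq.2.trans (htop2 P hP))
  have h7 : 0 ≤ (1 + (P - T))⁻¹ := by have : (0:ℝ) < 1 + (P - T) := by linarith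
                                      positivity
  simp only [hZ, hB] at hf
  nlinarith

/-! ### Part J: the system in null coordinates and its commuted versions -/

/-- linear null system with sources -/
structure NL (X Y F G : ℝ × ℝ → ℂ) : Prop where
  sX : Sm N2 X
  sY : Sm N2 Y
  sF : Sm N2 F
  sG : Sm N2 G
  eX : ∀ z ∈ N2, 2 * d1 X z = Complex.I * (Y z + F z)
  eY : ∀ z ∈ N2, 2 * d2 Y z = Complex.I * (X z + G z)

/-- weighted boost field -/
def Dm (c : ℝ) (F : ℝ × ℝ → ℂ) (z : ℝ × ℝ) : ℂ :=
  (z.1 : ℂ) * d1 F z - (z.2 : ℂ) * d2 F z + (c : ℂ) * F z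

theorem sm_fst : Sm N2 (fun z : ℝ × ℝ => (z.1 : ℂ)) :=
  Sm.ofCD N2_open (Complex.ofRealCLM.contDiff.comp contDiff_fst)
theorem sm_snd : Sm N2 (fun z : ℝ × ℝ => (z.2 : ℂ)) :=
  Sm.ofCD N2_open (Complex.ofRealCLM.contDiff.comp contDiff_snd)

theorem Sm.Dm {F : ℝ × ℝ → ℂ} (hF : Sm N2 F) (c : ℝ) : Sm N2 (Dm c F) :=
  ((sm_fst.mul hF.d1).sub (sm_snd.mul hF.d2)).add (hF.cmul c)

theorem Dm_congr {F G : ℝ × ℝ → ℂ} (c : ℝ) (h : ∀ z ∈ N2, F z = G z) : ∀ z ∈ N2, Dm c F z = Dm c G z := by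
  intro z hz
  simp only [Dm, d1_congr N2_open h z hz, d2_congr N2_open h z hz, h z hz]

theorem Dm_add {F G : ℝ × ℝ → ℂ} (c : ℝ) (hF : Sm N2 F) (hG : Sm N2 G) : ∀ z ∈ N2,
    Dm c (fun z => F z + G z) z = Dm c F z + Dm c G z := by
  intro z hz
  simp only [Dm, d1_add hF hG z hz, d2_add hF hG z hz]; ring

theorem Dm_T3 {P Q R : ℝ × ℝ → ℂ} {a a1 a2 a3 : ℝ} (ha : a = a1 + a2 + a3) (hP : Sm N2 P) (hQ : Sm N2 Q)
    (hR : Sm N2 R) : ∀ z ∈ N2,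
    Dm a (T3 P Q R) z = T3 (Dm a1 P) Q R z + T3 P (Dm a2 Q) R z + T3 P Q (Dm a3 R) z := by
  intro z hz
  simp only [Dm, d1_T3 hP hQ hR z hz, d2_T3 hP hQ hR z hz, ha]
  simp only [T3, Dm, map_add, map_sub, map_mul, Complex.conj_ofReal]
  push_cast; ring

theorem d1_Dm {F : ℝ × ℝ → ℂ} (hF : Sm N2 F) (c : ℝ) : ∀ z ∈ N2, d1 (Dm c F) z = Dm (c + 1) (d1 F) z := by
  rintro ⟨p, q⟩ hz
  refine (hF.Dm c).d1_eq hz ?_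
  have h1 := ((((hasDerivAt_id p).ofReal_comp).mul (hF.d1.hd1 hz)).sub
    ((hF.d2.hd1 hz).const_mul (q : ℂ))).add ((hF.hd1 hz).const_mul (c : ℂ))
  refine h1.congr_deriv ?_
  simp only [Dm, hF.comm hz]; push_cast; simp; ring

theorem d2_Dm {F : ℝ × ℝ → ℂ} (hF : Sm N2 F) (c : ℝ) : ∀ z ∈ N2, d2 (Dm c F) z = Dm (c - 1) (d2 F) z := by
  rintro ⟨p, q⟩ hz
  refine (hF.Dm c).d2_eq hz ?_
  have h1 := (((hF.d1.hd2 hz).const_mul (p : ℂ)).sub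
    (((hasDerivAt_id q).ofReal_comp).mul (hF.d2.hd2 hz))).add ((hF.hd2 hz).const_mul (c : ℂ))
  refine h1.congr_deriv ?_
  simp only [Dm, hF.comm hz]; push_cast; simp; ring

theorem d1_cm {F : ℝ × ℝ → ℂ} (hF : Sm N2 F) (c : ℂ) : ∀ z ∈ N2, d1 (fun z => c * F z) z = c * d1 F z := by
  rintro ⟨p, q⟩ hz
  exact (hF.cmul c).d1_eq hz ((hF.hd1 hz).const_mul c)
theorem d2_cm {F : ℝ × ℝ → ℂ} (hF : Sm N2 F) (c : ℂ) : ∀ z ∈ N2, d2 (fun z => c * F z) z = c * d2 F z := by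
  rintro ⟨p, q⟩ hz
  exact (hF.cmul c).d2_eq hz ((hF.hd2 hz).const_mul c)
theorem Dm_cm {F : ℝ × ℝ → ℂ} (hF : Sm N2 F) (b : ℝ) (c : ℂ) : ∀ z ∈ N2,
    Dm b (fun z => c * F z) z = c * Dm b F z := by
  intro z hz
  simp only [Dm, d1_cm hF c z hz, d2_cm hF c z hz]; ring

theorem NL.q {X Y F G : ℝ × ℝ → ℂ} (h : NL X Y F G) : NL (d2 X) (d2 Y) (d2 F) (d2 G) := by
  refine ⟨h.sX.d2, h.sY.d2, h.sF.d2, h.sG.d2, ?_, ?_⟩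
  · intro z hz
    rw [h.sX.comm hz, ← d2_cm h.sX.d1 2 z hz, d2_congr N2_open h.eX z hz,
      d2_cm (h.sY.add h.sF) _ z hz, d2_add h.sY h.sF z hz]
  · intro z hz
    rw [← d2_cm h.sY.d2 2 z hz, d2_congr N2_open h.eY z hz,
      d2_cm (h.sX.add h.sG) _ z hz, d2_add h.sX h.sG z hz]

theorem NL.D {X Y F G : ℝ × ℝ → ℂ} (h : NL X Y F G) :
    NL (Dm (-1/2) X) (Dm (1/2) Y) (Dm (1/2) F) (Dm (-1/2) G) := by
  refine ⟨h.sX.Dm _, h.sY.Dm _, h.sF.Dm _, h.sG.Dm _, ?_, ?_⟩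
  · intro z hz
    rw [d1_Dm h.sX _ z hz, ← Dm_cm h.sX.d1 _ 2 z hz, Dm_congr _ h.eX z hz,
      Dm_cm (h.sY.add h.sF) _ _ z hz, Dm_add _ h.sY h.sF z hz]
    norm_num
  · intro z hz
    rw [d2_Dm h.sY _ z hz, ← Dm_cm h.sY.d2 _ 2 z hz, Dm_congr _ h.eY z hz,
      Dm_cm (h.sX.add h.sG) _ _ z hz, Dm_add _ h.sX h.sG z hz]
    norm_num

/-- first order cubic -/
def C1 (v vA u uA : ℝ × ℝ → ℂ) (z : ℝ × ℝ) : ℂ := T3 vA v u z + T3 v vA u z + T3 v v uA z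
/-- second order cubic -/
def C2 (v vA vB vAB u uA uB uAB : ℝ × ℝ → ℂ) (z : ℝ × ℝ) : ℂ :=
  (T3 vAB v u z + T3 vB vA u z + T3 vB v uA z) + (T3 vA vB u z + T3 v vAB u z + T3 v vB uA z) +
    (T3 vA v uB z + T3 v vA uB z + T3 v v uAB z)

theorem d2_C1 {v vB u uB : ℝ × ℝ → ℂ} (h1 : Sm N2 v) (h2 : Sm N2 vB) (h3 : Sm N2 u) (h4 : Sm N2 uB) :
    ∀ z ∈ N2, d2 (C1 v vB u uB) z = C2 v (d2 v) vB (d2 vB) u (d2 u) uB (d2 uB) z := by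
  intro z hz
  unfold C1
  rw [d2_add ((h2.T3 h1 h3).add (h1.T3 h2 h3)) (h1.T3 h1 h4) z hz, d2_add (h2.T3 h1 h3) (h1.T3 h2 h3) z hz,
    d2_T3 h2 h1 h3 z hz, d2_T3 h1 h2 h3 z hz, d2_T3 h1 h1 h4 z hz]
  rfl

theorem Dm_C1 {v vB u uB : ℝ × ℝ → ℂ} {a b c : ℝ} (ha : a = b + b + c)
    (h1 : Sm N2 v) (h2 : Sm N2 vB) (h3 : Sm N2 u) (h4 : Sm N2 uB) :
    ∀ z ∈ N2, Dm a (C1 v vB u uB) z = C2 v (Dm b v) vB (Dm b vB) u (Dm c u) uB (Dm c uB) z := by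
  intro z hz
  unfold C1
  rw [Dm_add _ ((h2.T3 h1 h3).add (h1.T3 h2 h3)) (h1.T3 h1 h4) z hz, Dm_add _ (h2.T3 h1 h3) (h1.T3 h2 h3) z hz,
    Dm_T3 ha h2 h1 h3 z hz, Dm_T3 ha h1 h2 h3 z hz, Dm_T3 ha h1 h1 h4 z hz]
  rfl

/-- full energy density -/
def E5 (c : ℝ) (F : ℝ × ℝ → ℂ) (z : ℝ × ℝ) : ℝ :=
  ‖F z‖ ^ 2 + ‖d2 F z‖ ^ 2 + ‖Dm c F z‖ ^ 2 + ‖d2 (Dm c F) z‖ ^ 2 + ‖Dm c (Dm c F) z‖ ^ 2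
/-- low energy density -/
def M2 (c : ℝ) (F : ℝ × ℝ → ℂ) (z : ℝ × ℝ) : ℝ := ‖F z‖ ^ 2 + ‖Dm c F z‖ ^ 2

theorem sm_E5 {c : ℝ} {F : ℝ × ℝ → ℂ} (h : Sm N2 F) : Sm N2 (E5 c F) :=
  ((((h.nsq).radd h.d2.nsq).radd (h.Dm c).nsq).radd (h.Dm c).d2.nsq).radd ((h.Dm c).Dm c).nsq
theorem sm_M2 {c : ℝ} {F : ℝ × ℝ → ℂ} (h : Sm N2 F) : Sm N2 (M2 c F) := (h.nsq).radd (h.Dm c).nsq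

theorem E5_nn (c : ℝ) (F : ℝ × ℝ → ℂ) (z : ℝ × ℝ) : 0 ≤ E5 c F z := by unfold E5; positivity
theorem M2_nn (c : ℝ) (F : ℝ × ℝ → ℂ) (z : ℝ × ℝ) : 0 ≤ M2 c F z := by unfold M2; positivity
theorem M2_le_E5 (c : ℝ) (F : ℝ × ℝ → ℂ) (z : ℝ × ℝ) : M2 c F z ≤ E5 c F z := by
  unfold M2 E5; nlinarith [sq_nonneg ‖d2 F z‖, sq_nonneg ‖d2 (Dm c F) z‖, sq_nonneg ‖Dm c (Dm c F) z‖]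

theorem d2_M2_le {c : ℝ} {F : ℝ × ℝ → ℂ} (h : Sm N2 F) : ∀ z ∈ N2, d2 (M2 c F) z ≤ E5 c F z := by
  rintro ⟨p, q⟩ hz
  have e : d2 (M2 c F) (p, q) = 2 * inner ℝ (F (p, q)) (d2 F (p, q)) +
      2 * inner ℝ (Dm c F (p, q)) (d2 (Dm c F) (p, q)) :=
    (sm_M2 h).d2_eq hz ((h.hd2 hz).norm_sq.add ((h.Dm c).hd2 hz).norm_sq)
  rw [e]
  have k : ∀ a b : ℂ, 2 * inner ℝ a b ≤ ‖a‖ ^ 2 + ‖b‖ ^ 2 := by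
    intro a b
    nlinarith [real_inner_le_norm a b, sq_nonneg (‖a‖ - ‖b‖)]
  have := k (F (p, q)) (d2 F (p, q))
  have := k (Dm c F (p, q)) (d2 (Dm c F) (p, q))
  unfold E5
  nlinarith [sq_nonneg ‖Dm c (Dm c F) (p, q)‖]

theorem mul3 {x y w a b c M : ℝ} (hx : 0 ≤ x) (hy : 0 ≤ y) (hw : 0 ≤ w) (h1 : x ≤ a) (h2 : y ≤ b) (h3 : w ≤ c)
    (hM : a * b * c ≤ M) : x * y * w ≤ M :=
  (mul_le_mul (mul_le_mul h1 h2 hy (hx.trans h1)) h3 hw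
    (mul_nonneg (hx.trans h1) (hy.trans h2))).trans hM

theorem C1_bd {v vA u uA : ℝ × ℝ → ℂ} {z : ℝ × ℝ} {ν μ ev eu : ℝ}
    (hν : 0 ≤ ν) (hμ : 0 ≤ μ) (hev : 0 ≤ ev) (heu : 0 ≤ eu) (h1 : ‖v z‖ ≤ ν) (h2 : ‖vA z‖ ≤ ev) (h3 : ‖u z‖ ≤ μ) (h4 : ‖uA z‖ ≤ eu) :
    ‖C1 v vA u uA z‖ ≤ 9 * (ν * μ * ev + ν ^ 2 * eu) := by
  have p1 : 0 ≤ ν * μ * ev := by positivity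
  have p2 : 0 ≤ ν ^ 2 * eu := by positivity
  have e1 := norm_add₃_le (a := T3 vA v u z) (b := T3 v vA u z) (c := T3 v v uA z)
  simp only [norm_T3] at e1
  have n := fun F : ℝ × ℝ → ℂ => norm_nonneg (F z)
  have t1 := mul3 (M := ν * μ * ev + ν ^ 2 * eu) (n vA) (n v) (n u) h2 h1 h3 (by nlinarith)
  have t2 := mul3 (M := ν * μ * ev + ν ^ 2 * eu) (n v) (n vA) (n u) h1 h2 h3 (by nlinarith)
  have t3 := mul3 (M := ν * μ * ev + ν ^ 2 * eu) (n v) (n v) (n uA) h1 h1 h4 (by nlinarith)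
  unfold C1
  linarith

theorem C2_bd {v vA vB vAB u uA uB uAB : ℝ × ℝ → ℂ} {z : ℝ × ℝ} {ν μ ev eu : ℝ}
    (hν : 0 ≤ ν) (hμ : 0 ≤ μ) (hev : 0 ≤ ev) (heu : 0 ≤ eu) (h1 : ‖v z‖ ≤ ν) (h2 : ‖vA z‖ ≤ ev)
    (h3 : ‖vB z‖ ≤ ν) (h4 : ‖vAB z‖ ≤ ev)
    (k1 : ‖u z‖ ≤ μ) (k2 : ‖uA z‖ ≤ eu) (k3 : ‖uB z‖ ≤ μ) (k4 : ‖uAB z‖ ≤ eu) :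
    ‖C2 v vA vB vAB u uA uB uAB z‖ ≤ 9 * (ν * μ * ev + ν ^ 2 * eu) := by
  have p1 : 0 ≤ ν * μ * ev := by positivity
  have p2 : 0 ≤ ν ^ 2 * eu := by positivity
  have n := fun F : ℝ × ℝ → ℂ => norm_nonneg (F z)
  set M := ν * μ * ev + ν ^ 2 * eu with hM
  have m1 : ev * ν * μ ≤ M := by nlinarith
  have m2 : ν * ev * μ ≤ M := by nlinarith
  have m3 : ν * ν * eu ≤ M := by nlinarith
  have t1 : ‖T3 vAB v u z‖ ≤ M := by rw [norm_T3]; exact mul3 (n _) (n _) (n _) h4 h1 k1 m1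
  have t2 : ‖T3 vB vA u z‖ ≤ M := by rw [norm_T3]; exact mul3 (n _) (n _) (n _) h3 h2 k1 m2
  have t3 : ‖T3 vB v uA z‖ ≤ M := by rw [norm_T3]; exact mul3 (n _) (n _) (n _) h3 h1 k2 m3
  have t4 : ‖T3 vA vB u z‖ ≤ M := by rw [norm_T3]; exact mul3 (n _) (n _) (n _) h2 h3 k1 m1
  have t5 : ‖T3 v vAB u z‖ ≤ M := by rw [norm_T3]; exact mul3 (n _) (n _) (n _) h1 h4 k1 m2
  have t6 : ‖T3 v vB uA z‖ ≤ M := by rw [norm_T3]; exact mul3 (n _) (n _) (n _) h1 h3 k2 m3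
  have t7 : ‖T3 vA v uB z‖ ≤ M := by rw [norm_T3]; exact mul3 (n _) (n _) (n _) h2 h1 k3 m1
  have t8 : ‖T3 v vA uB z‖ ≤ M := by rw [norm_T3]; exact mul3 (n _) (n _) (n _) h1 h2 k3 m2
  have t9 : ‖T3 v v uAB z‖ ≤ M := by rw [norm_T3]; exact mul3 (n _) (n _) (n _) h1 h1 k4 m3
  unfold C2
  refine (norm_add₃_le).trans ?_
  have a1 := norm_add₃_le (a := T3 vAB v u z) (b := T3 vB vA u z) (c := T3 vB v uA z)
  have a2 := norm_add₃_le (a := T3 vA vB u z) (b := T3 v vAB u z) (c := T3 v vB uA z)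
  have a3 := norm_add₃_le (a := T3 vA v uB z) (b := T3 v vA uB z) (c := T3 v v uAB z)
  linarith

/-- energy identity, pointwise -/
theorem NL.en {X Y F G : ℝ × ℝ → ℂ} (h : NL X Y F G) {z : ℝ × ℝ} (hz : z ∈ N2) {x y f g : ℝ}
    (hx : ‖X z‖ ≤ x) (hy : ‖Y z‖ ≤ y) (hf : ‖F z‖ ≤ f) (hg : ‖G z‖ ≤ g) :
    2 * inner ℝ (X z) (d1 X z) + 2 * inner ℝ (Y z) (d2 Y z) ≤ x * f + y * g := by
  have e1 : d1 X z = (1/2) * (Complex.I * (Y z + F z)) := by rw [← h.eX z hz]; ring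
  have e2 : d2 Y z = (1/2) * (Complex.I * (X z + G z)) := by rw [← h.eY z hz]; ring
  have b1 : inner ℝ (X z) (Complex.I * F z) ≤ x * f := by
    refine (real_inner_le_norm _ _).trans ?_
    rw [norm_mul, Complex.norm_I, one_mul]
    exact mul_le_mul hx hf (norm_nonneg _) ((norm_nonneg _).trans hx)
  have b2 : inner ℝ (Y z) (Complex.I * G z) ≤ y * g := by
    refine (real_inner_le_norm _ _).trans ?_
    rw [norm_mul, Complex.norm_I, one_mul]
    exact mul_le_mul hy hg (norm_nonneg _) ((norm_nonneg _).trans hy)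
  rw [e1, e2]
  have c1 : ((1:ℂ)/2) = ((1/2 : ℝ) : ℂ) := by push_cast; ring
  rw [c1]
  simp only [Complex.inner] at b1 b2 ⊢
  simp only [Complex.mul_re, Complex.mul_im, Complex.add_re, Complex.add_im, Complex.conj_re,
      Complex.conj_im, Complex.I_re, Complex.I_im, Complex.ofReal_re, Complex.ofReal_im] at b1 b2 ⊢
  linarith

theorem NL.congr {X Y F G F' G' : ℝ × ℝ → ℂ} (h : NL X Y F G) (hF : ∀ z ∈ N2, F z = F' z)
    (hG : ∀ z ∈ N2, G z = G' z) : NL X Y F' G' :=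
  ⟨h.sX, h.sY, h.sF.congr fun z hz => (hF z hz).symm, h.sG.congr fun z hz => (hG z hz).symm,
    fun z hz => by rw [h.eX z hz, hF z hz], fun z hz => by rw [h.eY z hz, hG z hz]⟩

/-- the Thirring system in null coordinates -/
def NS (u v : ℝ × ℝ → ℂ) : Prop := NL u v (T3 v v u) (T3 u u v)

theorem exM (c : ℝ) (F : ℝ × ℝ → ℂ) (z : ℝ × ℝ) : ∃ ν : ℝ, 0 ≤ ν ∧ ν ^ 2 = M2 c F z ∧
    ‖F z‖ ≤ ν ∧ ‖Dm c F z‖ ≤ ν := by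
  refine ⟨Real.sqrt (M2 c F z), Real.sqrt_nonneg _, Real.sq_sqrt (M2_nn _ _ _), ?_, ?_⟩ <;>
    refine Real.le_sqrt_of_sq_le ?_ <;> unfold M2 <;>
      nlinarith [sq_nonneg ‖F z‖, sq_nonneg ‖Dm c F z‖]

theorem exE (c : ℝ) (F : ℝ × ℝ → ℂ) (z : ℝ × ℝ) : ∃ ν : ℝ, 0 ≤ ν ∧ ν ^ 2 = E5 c F z ∧
    ‖F z‖ ≤ ν ∧ ‖d2 F z‖ ≤ ν ∧ ‖Dm c F z‖ ≤ ν ∧ ‖d2 (Dm c F) z‖ ≤ ν ∧ ‖Dm c (Dm c F) z‖ ≤ ν := by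
  refine ⟨Real.sqrt (E5 c F z), Real.sqrt_nonneg _, Real.sq_sqrt (E5_nn _ _ _), ?_, ?_, ?_, ?_, ?_⟩ <;>
    refine Real.le_sqrt_of_sq_le ?_ <;> unfold E5 <;>
      nlinarith [sq_nonneg ‖F z‖, sq_nonneg ‖Dm c F z‖, sq_nonneg ‖d2 F z‖, sq_nonneg ‖d2 (Dm c F) z‖,
        sq_nonneg ‖Dm c (Dm c F) z‖]

theorem smw : Sm N2 (fun z : ℝ × ℝ => 3 - z.2) := Sm.ofCD N2_open (contDiff_const.sub contDiff_snd)

theorem d1_wE5 {c : ℝ} {u : ℝ × ℝ → ℂ} (hu : Sm N2 u) {p q : ℝ} (hz : (p, q) ∈ N2) :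
    d1 (fun z => (3 - z.2) * E5 c u z) (p, q) = (3 - q) * (2 * inner ℝ (u (p, q)) (d1 u (p, q)) +
      2 * inner ℝ (d2 u (p, q)) (d1 (d2 u) (p, q)) + 2 * inner ℝ (Dm c u (p, q)) (d1 (Dm c u) (p, q)) +
      2 * inner ℝ (d2 (Dm c u) (p, q)) (d1 (d2 (Dm c u)) (p, q)) +
      2 * inner ℝ (Dm c (Dm c u) (p, q)) (d1 (Dm c (Dm c u)) (p, q))) := by
  have hu' := hu.Dm c
  have hu2 := hu'.Dm c
  refine (smw.rmul (sm_E5 hu)).d1_eq hz ?_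
  have k := ((((((hu.hd1 hz).norm_sq).add (hu.d2.hd1 hz).norm_sq).add (hu'.hd1 hz).norm_sq).add
      (hu'.d2.hd1 hz).norm_sq).add (hu2.hd1 hz).norm_sq)
  have k' : HasDerivAt (fun r => E5 c u (r, q)) _ p := k
  exact k'.const_mul (3 - q)

theorem d2_wE5 {c : ℝ} {v : ℝ × ℝ → ℂ} (hv : Sm N2 v) {p q : ℝ} (hz : (p, q) ∈ N2) :
    d2 (fun z => (3 - z.2) * E5 c v z) (p, q) = (-1) * E5 c v (p, q) +
      (3 - q) * (2 * inner ℝ (v (p, q)) (d2 v (p, q)) +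
      2 * inner ℝ (d2 v (p, q)) (d2 (d2 v) (p, q)) + 2 * inner ℝ (Dm c v (p, q)) (d2 (Dm c v) (p, q)) +
      2 * inner ℝ (d2 (Dm c v) (p, q)) (d2 (d2 (Dm c v)) (p, q)) +
      2 * inner ℝ (Dm c (Dm c v) (p, q)) (d2 (Dm c (Dm c v)) (p, q))) := by
  have hu' := hv.Dm c
  have hu2 := hu'.Dm c
  refine (smw.rmul (sm_E5 hv)).d2_eq hz ?_
  have k := ((((((hv.hd2 hz).norm_sq).add (hv.d2.hd2 hz).norm_sq).add (hu'.hd2 hz).norm_sq).add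
      (hu'.d2.hd2 hz).norm_sq).add (hu2.hd2 hz).norm_sq)
  have k' : HasDerivAt (fun r => E5 c v (p, r)) _ q := k
  exact ((hasDerivAt_id q).const_sub 3).mul k'

theorem NS.pt_energy {u v : ℝ × ℝ → ℂ} (h : NS u v) : ∀ z ∈ N2, z.2 ≤ 2 →
    d1 (fun z => (3 - z.2) * E5 (-1/2) u z) z + d2 (fun z => (3 - z.2) * E5 (1/2) v z) z ≤
      -E5 (1/2) v z + 90 * (M2 (1/2) v z * ((3 - z.2) * E5 (-1/2) u z) +
        ((3 - z.2) * M2 (-1/2) u z) * E5 (1/2) v z) := by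
  have hu := h.sX
  have hv := h.sY
  rintro ⟨p, q⟩ hz hq
  have N0 : NL u v (T3 v v u) (T3 u u v) := h
  have N1 : NL (d2 u) (d2 v) (C1 v (d2 v) u (d2 u)) (C1 u (d2 u) v (d2 v)) :=
    N0.q.congr (d2_T3 hv hv hu) (d2_T3 hu hu hv)
  have N2' : NL (Dm (-1/2) u) (Dm (1/2) v) (C1 v (Dm (1/2) v) u (Dm (-1/2) u))
      (C1 u (Dm (-1/2) u) v (Dm (1/2) v)) :=
    N0.D.congr (Dm_T3 (by norm_num) hv hv hu) (Dm_T3 (by norm_num) hu hu hv)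
  have hu' := hu.Dm (-1/2)
  have hv' := hv.Dm (1/2)
  have N3 := N2'.q.congr (d2_C1 hv hv' hu hu') (d2_C1 hu hu' hv hv')
  have N4 := N2'.D.congr (Dm_C1 (b := 1/2) (c := -1/2) (by norm_num) hv hv' hu hu')
    (Dm_C1 (b := -1/2) (c := 1/2) (by norm_num) hu hu' hv hv')
  set z : ℝ × ℝ := (p, q) with hzd
  obtain ⟨ν, pν, sν, v0, vD⟩ := exM (1/2) v z
  obtain ⟨μ, pμ, sμ, u0, uD⟩ := exM (-1/2) u z
  obtain ⟨ev, pev, sev, V0, V1, V2, V3, V4⟩ := exE (1/2) v z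
  obtain ⟨eu, peu, seu, U0, U1, U2, U3, U4⟩ := exE (-1/2) u z
  have f0 : ‖T3 v v u z‖ ≤ 9 * (ν * μ * ev + ν ^ 2 * eu) := by
    rw [norm_T3]
    refine mul3 (norm_nonneg _) (norm_nonneg _) (norm_nonneg _) v0 v0 U0 ?_
    nlinarith [mul_nonneg (mul_nonneg pν pμ) pev, mul_nonneg (mul_nonneg pν pν) peu]
  have g0 : ‖T3 u u v z‖ ≤ 9 * (μ * ν * eu + μ ^ 2 * ev) := by
    rw [norm_T3]
    refine mul3 (norm_nonneg _) (norm_nonneg _) (norm_nonneg _) u0 u0 V0 ?_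
    nlinarith [mul_nonneg (mul_nonneg pν pμ) peu, mul_nonneg (mul_nonneg pμ pμ) pev]
  have i0 := N0.en hz U0 V0 f0 g0
  have i1 := N1.en hz U1 V1 (C1_bd pν pμ pev peu v0 V1 u0 U1) (C1_bd pμ pν peu pev u0 U1 v0 V1)
  have i2 := N2'.en hz U2 V2 (C1_bd pν pμ pev peu v0 V2 u0 U2) (C1_bd pμ pν peu pev u0 U2 v0 V2)
  have i3 := N3.en hz U3 V3 (C2_bd pν pμ pev peu v0 V1 vD V3 u0 U1 uD U3) (C2_bd pμ pν peu pev u0 U1 uD U3 v0 V1 vD V3)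
  have i4 := N4.en hz U4 V4 (C2_bd pν pμ pev peu v0 V2 vD V4 u0 U2 uD U4) (C2_bd pμ pν peu pev u0 U2 uD U4 v0 V2 vD V4)
  have ea := d1_wE5 (c := -1/2) hu hz
  have eb := d2_wE5 (c := 1/2) hv hz
  rw [ea, eb]
  have w0 : 0 ≤ 3 - q := by have : q ≤ 2 := hq
                            linarith
  have key : 5 * (eu * (9 * (ν * μ * ev + ν ^ 2 * eu)) + ev * (9 * (μ * ν * eu + μ ^ 2 * ev))) ≤
      90 * (ν ^ 2 * eu ^ 2 + μ ^ 2 * ev ^ 2) := by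
    nlinarith [sq_nonneg (ν * eu - μ * ev)]
  have fin := mul_le_mul_of_nonneg_left (((add_le_add (add_le_add (add_le_add (add_le_add i0 i1) i2) i3) i4)).trans
    ((by linarith : _ ≤ _).trans key)) w0
  rw [sν, seu, sμ, sev] at fin
  change _ ≤ _ + 90 * (_ * ((3 - q) * _) + ((3 - q) * _) * _)
  linarith

theorem NS.ext {u v : ℝ × ℝ → ℂ} (h : NS u v) {T D0 : ℝ} (hT : 1 < T) (hT2 : T ≤ 2) (hD : 0 < D0)
    (hD1 : D0 ≤ 1 / 630)
    (hd : ∀ x : ℝ, 0 ≤ x → (3 - (T - x)) * E5 (-1/2) u (T + x, T - x) +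
      (3 - (T - x)) * E5 (1/2) v (T + x, T - x) ≤ D0 / (1 + x) ^ 2) :
    ∀ P, T ≤ P → ∫ s in T..P, ((3 - T ^ 2 / s) * E5 (1/2) v (s, T ^ 2 / s) +
      T ^ 2 / s ^ 2 * ((3 - T ^ 2 / s) * E5 (-1/2) u (s, T ^ 2 / s))) ≤ 3 * D0 := by
  have smw : Sm N2 (fun z : ℝ × ℝ => 3 - z.2) := Sm.ofCD N2_open (contDiff_const.sub contDiff_snd)
  refine ext_energy (a := fun z => (3 - z.2) * E5 (-1/2) u z) (b := fun z => (3 - z.2) * E5 (1/2) v z)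
    (ev := E5 (1/2) v) (nu := M2 (1/2) v) (mu := fun z => (3 - z.2) * M2 (-1/2) u z)
    (smw.rmul (sm_E5 h.sX)) (smw.rmul (sm_E5 h.sY)) (sm_E5 h.sY) (sm_M2 h.sY) (smw.rmul (sm_M2 h.sX))
    ?_ ?_ (fun z => E5_nn _ _ z) h.pt_energy (fun z hz _ => d2_M2_le h.sY z hz) ?_ ?_ ?_ hT hT2 hD hD1 hd
  · intro z hz; exact mul_nonneg (by linarith) (E5_nn _ _ z)
  · intro z hz; exact mul_nonneg (by linarith) (E5_nn _ _ z)
  · intro z hz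
    have := M2_le_E5 (1/2) v z
    have := E5_nn (1/2) v z
    nlinarith
  · rintro ⟨p, q⟩ hz hq
    have e : d2 (fun z => (3 - z.2) * M2 (-1/2) u z) (p, q) = (-1) * M2 (-1/2) u (p, q) + (3 - q) * d2 (M2 (-1/2) u) (p, q) :=
      (smw.rmul (sm_M2 h.sX)).d2_eq hz (((hasDerivAt_id q).const_sub 3).mul ((sm_M2 h.sX).hd2 hz))
    rw [e]
    have k1 := d2_M2_le (c := -1/2) h.sX (p, q) hz
    have k2 := M2_nn (-1/2) u (p, q)
    have hq' : q ≤ 2 := hq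
    have := mul_le_mul_of_nonneg_left k1 (show 0 ≤ 3 - q by linarith)
    change _ ≤ (3 - q) * _
    linarith
  · intro z hz
    exact mul_le_mul_of_nonneg_left (M2_le_E5 _ u z) (by linarith)

/-! ### Part K: from null to hyperbolic coordinates -/

/-- hyperbolic transform of weight c -/
def TR (c : ℝ) (F : ℝ × ℝ → ℂ) (z : ℝ × ℝ) : ℂ :=
  ((Real.sqrt z.1 * Real.exp (c * z.2) : ℝ) : ℂ) * F (z.1 * Real.exp z.2, z.1 * Real.exp (-z.2))

theorem hyp_N2 {r y : ℝ} (hr : 1 < r) : (r * Real.exp y, r * Real.exp (-y)) ∈ N2 := by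
  rw [mem_N2]
  have h1 := Real.one_le_cosh y
  rw [Real.cosh_eq] at h1
  nlinarith

theorem sm_TR {c : ℝ} {F : ℝ × ℝ → ℂ} (hF : Sm N2 F) : Sm O2 (TR c F) := by
  refine ⟨O2_open, ?_⟩
  have h1 : ContDiffOn ℝ (⊤ : ℕ∞) (fun z : ℝ × ℝ => Real.sqrt z.1 * Real.exp (c * z.2)) O2 := by
    refine ContDiffOn.mul (contDiff_fst.contDiffOn.sqrt ?_) (by fun_prop)
    intro z hz; have : 1 < z.1 := hz
    linarith
  have h2 : ContDiffOn ℝ (⊤ : ℕ∞) (fun z : ℝ × ℝ => (z.1 * Real.exp z.2, z.1 * Real.exp (-z.2))) O2 := by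
    fun_prop
  refine ContDiffOn.mul (Complex.ofRealCLM.contDiff.comp_contDiffOn h1) (hF.2.comp h2 ?_)
  intro z hz
  exact hyp_N2 hz

theorem d2_TR {c : ℝ} {F : ℝ × ℝ → ℂ} (hF : Sm N2 F) : ∀ z ∈ O2, d2 (TR c F) z = TR c (Dm c F) z := by
  rintro ⟨r, y⟩ hz
  refine (sm_TR hF).d2_eq hz ?_
  have hr : 1 < r := hz
  have e1 : HasDerivAt (fun y => r * Real.exp y) (r * Real.exp y) y := (Real.hasDerivAt_exp y).const_mul r
  have e2 : HasDerivAt (fun y => r * Real.exp (-y)) (r * (Real.exp (-y) * (-1))) y :=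
    (((hasDerivAt_id y).neg).exp).const_mul r
  have e3 : HasDerivAt (fun y => Real.sqrt r * Real.exp (c * y)) (Real.sqrt r * (Real.exp (c * y) * (c * 1))) y :=
    ((((hasDerivAt_id y).const_mul c)).exp).const_mul _
  have h := e3.ofReal_comp.mul (hF.chain e1 e2 (hyp_N2 hr))
  refine h.congr_deriv ?_
  simp only [TR, Dm, Complex.real_smul]
  push_cast; ring

theorem d1_TR {c : ℝ} {F : ℝ × ℝ → ℂ} (hF : Sm N2 F) {r y : ℝ} (hr : 1 < r) :
    (r : ℂ) * d1 (TR c F) (r, y) = (1/2) * TR c F (r, y) +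
      TR c (fun z => z.1 * d1 F z + z.2 * d2 F z) (r, y) := by
  have hr0 : 0 < r := by linarith
  have hz : (r, y) ∈ O2 := hr
  have e1 : HasDerivAt (fun r => r * Real.exp y) (1 * Real.exp y) r := (hasDerivAt_id r).mul_const _
  have e2 : HasDerivAt (fun r => r * Real.exp (-y)) (1 * Real.exp (-y)) r := (hasDerivAt_id r).mul_const _
  have e3 : HasDerivAt (fun r => Real.sqrt r * Real.exp (c * y)) (1 / (2 * Real.sqrt r) * Real.exp (c * y)) r :=
    (Real.hasDerivAt_sqrt hr0.ne').mul_const _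
  have h := e3.ofReal_comp.mul (hF.chain e1 e2 (hyp_N2 hr))
  rw [(sm_TR hF).d1_eq hz h]
  have hs : (r : ℂ) * ((1 / (2 * Real.sqrt r) : ℝ) : ℂ) = ((Real.sqrt r / 2 : ℝ) : ℂ) := by
    rw [← Complex.ofReal_mul]
    congr 1
    have : 0 < Real.sqrt r := Real.sqrt_pos.2 hr0
    field_simp
    rw [Real.sq_sqrt hr0.le]
  simp only [TR, Complex.real_smul]
  push_cast at hs ⊢
  linear_combination (Complex.exp (c * y) * F (r * Real.exp y, r * Real.exp (-y))) * hs

theorem TR_T3 {P Q R : ℝ × ℝ → ℂ} {a b c : ℝ} {r y : ℝ} (hr : 1 < r) :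
    T3 (TR a P) (TR b Q) (TR c R) (r, y) = (r : ℂ) * TR (a + b + c) (T3 P Q R) (r, y) := by
  have hr0 : 0 < r := by linarith
  have hs : ((Real.sqrt r : ℝ) : ℂ) * (Real.sqrt r : ℝ) = (r : ℂ) := by
    rw [← Complex.ofReal_mul, Real.mul_self_sqrt hr0.le]
  simp only [T3, TR, map_mul, Complex.conj_ofReal]
  have he : Real.exp ((a + b + c) * y) = Real.exp (a * y) * Real.exp (b * y) * Real.exp (c * y) := by
    rw [← Real.exp_add, ← Real.exp_add]; ring_nf
  rw [he]
  push_cast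
  rw [← hs]; ring

theorem NS.sys {u v : ℝ × ℝ → ℂ} (h : NS u v) : Sys (TR (-1/2) u) (TR (1/2) v) := by
  have hu := h.sX
  have hv := h.sY
  refine ⟨sm_TR hu, sm_TR hv, ?_, ?_⟩
  · rintro ⟨r, y⟩ hz
    have hr : 1 < r := hz
    have hr0 : (r : ℂ) ≠ 0 := by exact_mod_cast (by linarith : r ≠ 0)
    apply mul_left_cancel₀ hr0
    rw [d1_TR hu hr, d2_TR hu _ hz, TR_T3 hr]
    have hE : (((r * Real.exp y : ℝ) : ℂ)) * ((Real.exp (-1/2 * y) : ℝ) : ℂ) = (r : ℂ) * ((Real.exp (1/2 * y) : ℝ) : ℂ) := by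
      rw [← Complex.ofReal_mul, ← Complex.ofReal_mul, mul_assoc, ← Real.exp_add]; ring_nf
    have e := h.eX _ (hyp_N2 (y := y) hr)
    have hrc : (r : ℂ) * rc (r, y) = 1 := by
      simp only [rc]; push_cast; exact mul_inv_cancel₀ hr0
    have h12 : (1/2 + 1/2 + -1/2 : ℝ) = 1/2 := by norm_num
    rw [h12]
    simp only [TR, Dm]
    simp only [neg_mul] at hE ⊢
    push_cast at hE e ⊢
    set z0 := (r * Real.exp y, r * Real.exp (-y))
    linear_combination (Real.sqrt r : ℂ) * Complex.exp (-1/2 * y) * (r * Complex.exp y) * e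
       + (Real.sqrt r : ℂ) * Complex.I * (v z0 + T3 v v u z0) * hE
       + ((Real.sqrt r : ℂ) * Complex.exp (-1/2 * y) * (r * Complex.exp y * d1 u z0 - r * Complex.exp (-y) * d2 u z0 - 1/2 * u z0)
         - Complex.I * r * ((Real.sqrt r : ℂ) * Complex.exp (1/2 * y) * T3 v v u z0)) * hrc
  · rintro ⟨r, y⟩ hz
    have hr : 1 < r := hz
    have hr0 : (r : ℂ) ≠ 0 := by exact_mod_cast (by linarith : r ≠ 0)
    apply mul_left_cancel₀ hr0
    rw [d1_TR hv hr, d2_TR hv _ hz, TR_T3 hr]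
    have hE : (((r * Real.exp (-y) : ℝ) : ℂ)) * ((Real.exp (1/2 * y) : ℝ) : ℂ) = (r : ℂ) * ((Real.exp (-1/2 * y) : ℝ) : ℂ) := by
      rw [← Complex.ofReal_mul, ← Complex.ofReal_mul, mul_assoc, ← Real.exp_add]; ring_nf
    have e := h.eY _ (hyp_N2 (y := y) hr)
    have hrc : (r : ℂ) * rc (r, y) = 1 := by
      simp only [rc]; push_cast; exact mul_inv_cancel₀ hr0
    have h12 : (-1/2 + -1/2 + 1/2 : ℝ) = -1/2 := by norm_num
    rw [h12]
    simp only [TR, Dm]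
    push_cast at hE e ⊢
    set z0 := (r * Real.exp y, r * Real.exp (-y))
    linear_combination (Real.sqrt r : ℂ) * Complex.exp (1/2 * y) * (r * Complex.exp (-y)) * e
       + (Real.sqrt r : ℂ) * Complex.I * (u z0 + T3 u u v z0) * hE
       - ((Real.sqrt r : ℂ) * Complex.exp (1/2 * y) * (r * Complex.exp y * d1 v z0 - r * Complex.exp (-y) * d2 v z0 + 1/2 * v z0)
         + Complex.I * r * ((Real.sqrt r : ℂ) * Complex.exp (-1/2 * y) * T3 u u v z0)) * hrc

/-- swap of null coordinates -/
def sw (F : ℝ × ℝ → ℂ) (z : ℝ × ℝ) : ℂ := F (z.2, z.1)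

theorem Sm.sw {F : ℝ × ℝ → ℂ} (hF : Sm N2 F) : Sm N2 (sw F) := by
  refine ⟨N2_open, hF.2.comp (contDiff_snd.prodMk contDiff_fst).contDiffOn ?_⟩
  intro z hz
  have : 2 < z.1 + z.2 := hz
  change 2 < z.2 + z.1
  linarith

theorem sw_N2 {p q : ℝ} (h : (p, q) ∈ N2) : (q, p) ∈ N2 := by rw [mem_N2] at *; linarith

theorem d1_sw {F : ℝ × ℝ → ℂ} (hF : Sm N2 F) : ∀ z ∈ N2, d1 (sw F) z = sw (d2 F) z := by
  rintro ⟨p, q⟩ hz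
  exact hF.sw.d1_eq hz (hF.hd2 (sw_N2 hz))
theorem d2_sw {F : ℝ × ℝ → ℂ} (hF : Sm N2 F) : ∀ z ∈ N2, d2 (sw F) z = sw (d1 F) z := by
  rintro ⟨p, q⟩ hz
  exact hF.sw.d2_eq hz (hF.hd1 (sw_N2 hz))

theorem NS.swap {u v : ℝ × ℝ → ℂ} (h : NS u v) : NS (sw v) (sw u) := by
  have hu := h.sX
  have hv := h.sY
  refine ⟨hv.sw, hu.sw, hu.sw.T3 hu.sw hv.sw, hv.sw.T3 hv.sw hu.sw, ?_, ?_⟩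
  · rintro ⟨p, q⟩ hz
    rw [d1_sw hv _ hz]
    exact h.eY _ (sw_N2 hz)
  · rintro ⟨p, q⟩ hz
    rw [d2_sw hu _ hz]
    exact h.eX _ (sw_N2 hz)

/-- reflection in the second variable -/
def rf (F : ℝ × ℝ → ℂ) (z : ℝ × ℝ) : ℂ := F (z.1, -z.2)

theorem Sm.rf {F : ℝ × ℝ → ℂ} (hF : Sm O2 F) : Sm O2 (rf F) := by
  refine ⟨O2_open, hF.2.comp (contDiff_fst.prodMk contDiff_snd.neg).contDiffOn ?_⟩
  intro z hz; exact hz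

theorem d2_rf {F : ℝ × ℝ → ℂ} (hF : Sm O2 F) : ∀ z ∈ O2, d2 (rf F) z = -rf (d2 F) z := by
  rintro ⟨p, q⟩ hz
  refine hF.rf.d2_eq hz ?_
  have := hF.chain (hasDerivAt_const q p) ((hasDerivAt_id q).neg) (r := q) hz
  refine this.congr_deriv ?_
  simp [_root_.rf]

theorem d22_rf {F : ℝ × ℝ → ℂ} (hF : Sm O2 F) : ∀ z ∈ O2, d2 (d2 (rf F)) z = rf (d2 (d2 F)) z := by
  rintro ⟨p, q⟩ hz
  rw [d2_congr O2_open (G := fun z => (-1) * rf (d2 F) z) (fun z hz => by rw [d2_rf hF z hz]; ring) _ hz]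
  have h1 := hF.d2.rf
  rw [(h1.cmul (-1)).d2_eq hz ((h1.hd2 hz).const_mul (-1)), d2_rf hF.d2 _ hz]
  ring

theorem TR_sw (c : ℝ) (F : ℝ × ℝ → ℂ) : TR c (sw F) = rf (TR (-c) F) := by
  funext z
  simp only [TR, sw, rf, neg_neg, neg_mul_neg]

theorem nsq_TR {c : ℝ} {F : ℝ × ℝ → ℂ} {r y : ℝ} (hr : 0 < r) :
    ‖TR c F (r, y)‖ ^ 2 = r * Real.exp (2 * c * y) * ‖F (r * Real.exp y, r * Real.exp (-y))‖ ^ 2 := by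
  simp only [TR, norm_mul, Complex.norm_real, Real.norm_eq_abs, mul_pow, sq_abs, Real.sq_sqrt hr.le, Real.abs_exp]
  rw [← Real.exp_nat_mul]
  ring_nf

/-- half line energy on the hyperbola -/
theorem NS.half {u v : ℝ × ℝ → ℂ} (h : NS u v) {T D0 : ℝ} (hT : 1 < T) (hT2 : T ≤ 2) (hD : 0 < D0)
    (hD1 : D0 ≤ 1 / 630)
    (hd : ∀ x : ℝ, 0 ≤ x → (3 - (T - x)) * E5 (-1/2) u (T + x, T - x) +
      (3 - (T - x)) * E5 (1/2) v (T + x, T - x) ≤ D0 / (1 + x) ^ 2) {L : ℝ} (hL : 0 ≤ L)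
    {f : ℝ → ℝ} (hf : Continuous f)
    (hfe : ∀ y, f y ≤ T * Real.exp (-y) * E5 (-1/2) u (T * Real.exp y, T * Real.exp (-y)) +
      T * Real.exp y * E5 (1/2) v (T * Real.exp y, T * Real.exp (-y))) :
    ∫ y in (0:ℝ)..L, f y ≤ 3 * D0 := by
  have hT0 : 0 < T := by linarith
  set g : ℝ → ℝ := fun s => ((3 - T ^ 2 / s) * E5 (1/2) v (s, T ^ 2 / s) +
      T ^ 2 / s ^ 2 * ((3 - T ^ 2 / s) * E5 (-1/2) u (s, T ^ 2 / s))) with hg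
  have key := h.ext hT hT2 hD hD1 hd (T * Real.exp L) (by nlinarith [Real.one_le_exp hL])
  have hgc : ContinuousOn g (Set.Ioi 0) := by
    have c1 : ContinuousOn (fun s : ℝ => (s, T ^ 2 / s)) (Set.Ioi 0) := by
      refine continuousOn_id.prodMk (continuousOn_const.div continuousOn_id ?_)
      intro x hx; exact (ne_of_gt hx)
    have c2 : Set.MapsTo (fun s : ℝ => (s, T ^ 2 / s)) (Set.Ioi 0) N2 := by
      intro s hs
      have hs0 : 0 < s := hs
      have := hyp_le (T := T) hs0
      change 2 < s + T ^ 2 / s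
      linarith
    have c3 : ContinuousOn (fun s : ℝ => T ^ 2 / s) (Set.Ioi 0) :=
      continuousOn_const.div continuousOn_id fun x hx => ne_of_gt hx
    have c4 : ContinuousOn (fun s : ℝ => T ^ 2 / s ^ 2) (Set.Ioi 0) := by
      refine continuousOn_const.div (by fun_prop) ?_
      intro x hx; have : (0:ℝ) < x := hx; positivity
    have h1 := (sm_E5 (c := 1/2) h.sY).co.comp c1 c2
    have h2 := (sm_E5 (c := -1/2) h.sX).co.comp c1 c2
    exact ((continuousOn_const.sub c3).mul h1).add (c4.mul ((continuousOn_const.sub c3).mul h2))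
  have hsub : ∫ y in (0:ℝ)..L, g (T * Real.exp y) * (T * Real.exp y) = ∫ s in T..(T * Real.exp L), g s := by
    have := intervalIntegral.integral_comp_mul_deriv'' (f := fun y => T * Real.exp y)
      (f' := fun y => T * Real.exp y) (g := g) (a := 0) (b := L) (by fun_prop)
      (fun y _ => ((Real.hasDerivAt_exp y).const_mul T).hasDerivWithinAt) (by fun_prop)
      (hgc.mono (by rintro x ⟨y, _, rfl⟩; exact (by positivity : 0 < T * Real.exp y)))
    simpa using this
  rw [← hsub] at key
  refine le_trans ?_ key
  refine intervalIntegral.integral_mono_on hL (hf.intervalIntegrable _ _) ?_ ?_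
  · refine Continuous.intervalIntegrable ?_ _ _
    refine Continuous.mul ?_ (by fun_prop)
    exact hgc.comp_continuous (by fun_prop) (fun y => (by positivity : 0 < T * Real.exp y))
  · intro y hy
    refine (hfe y).trans ?_
    have e1 : T ^ 2 / (T * Real.exp y) = T * Real.exp (-y) := by
      rw [Real.exp_neg]; field_simp
    have e2 : T ^ 2 / (T * Real.exp y) ^ 2 * (T * Real.exp y) = T * Real.exp (-y) := by
      rw [Real.exp_neg]; field_simp
    have hle : T * Real.exp (-y) ≤ 2 := by
      have : Real.exp (-y) ≤ 1 := Real.exp_le_one_iff.2 (by linarith [hy.1])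
      nlinarith [Real.exp_pos (-y)]
    simp only [hg]
    have e3 : ∀ A B w : ℝ, (w * A + T ^ 2 / (T * Real.exp y) ^ 2 * (w * B)) * (T * Real.exp y) =
        w * (T * Real.exp y * A) + w * (T * Real.exp (-y) * B) := by
      intro A B w; rw [← e2]; ring
    rw [e3, e1]
    have p1 : 0 ≤ T * Real.exp y * E5 (1/2) v (T * Real.exp y, T * Real.exp (-y)) :=
      mul_nonneg (by positivity) (E5_nn _ _ _)
    have p2 : 0 ≤ T * Real.exp (-y) * E5 (-1/2) u (T * Real.exp y, T * Real.exp (-y)) :=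
      mul_nonneg (by positivity) (E5_nn _ _ _)
    nlinarith

theorem TR_level {u v P Q : ℝ × ℝ → ℂ} {T : ℝ} (hT : 0 < T) (hP : ∀ z, ‖P z‖ ^ 2 ≤ E5 (-1/2) u z)
    (hQ : ∀ z, ‖Q z‖ ^ 2 ≤ E5 (1/2) v z) (y : ℝ) :
    ‖TR (-1/2) P (T, y)‖ ^ 2 + ‖TR (1/2) Q (T, y)‖ ^ 2 ≤
      T * Real.exp (-y) * E5 (-1/2) u (T * Real.exp y, T * Real.exp (-y)) +
      T * Real.exp y * E5 (1/2) v (T * Real.exp y, T * Real.exp (-y)) := by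
  rw [nsq_TR hT, nsq_TR hT]
  have e1 : 2 * (-1/2) * y = -y := by ring
  have e2 : 2 * (1/2) * y = y := by ring
  rw [e1, e2]
  exact add_le_add (mul_le_mul_of_nonneg_left (hP _) (by positivity))
    (mul_le_mul_of_nonneg_left (hQ _) (by positivity))

theorem E5_ge (c : ℝ) (F : ℝ × ℝ → ℂ) (z : ℝ × ℝ) : ‖F z‖ ^ 2 ≤ E5 c F z ∧ ‖Dm c F z‖ ^ 2 ≤ E5 c F z ∧
    ‖Dm c (Dm c F) z‖ ^ 2 ≤ E5 c F z := by
  refine ⟨?_, ?_, ?_⟩ <;> unfold E5 <;>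
      nlinarith [sq_nonneg ‖F z‖, sq_nonneg ‖Dm c F z‖, sq_nonneg ‖d2 F z‖, sq_nonneg ‖d2 (Dm c F) z‖,
        sq_nonneg ‖Dm c (Dm c F) z‖]

theorem d22_TR {c : ℝ} {F : ℝ × ℝ → ℂ} (hF : Sm N2 F) : ∀ z ∈ O2,
    d2 (d2 (TR c F)) z = TR c (Dm c (Dm c F)) z := by
  intro z hz
  rw [d2_congr O2_open (d2_TR hF) z hz, d2_TR (hF.Dm c) z hz]

theorem half_levels {u v : ℝ × ℝ → ℂ} (h : NS u v) {T D0 : ℝ} (hT : 1 < T) (hT2 : T ≤ 2) (hD : 0 < D0)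
    (hD1 : D0 ≤ 1 / 630)
    (hd : ∀ x : ℝ, 0 ≤ x → (3 - (T - x)) * E5 (-1/2) u (T + x, T - x) +
      (3 - (T - x)) * E5 (1/2) v (T + x, T - x) ≤ D0 / (1 + x) ^ 2) {L : ℝ} (hL : 0 ≤ L) :
    (∫ y in (0:ℝ)..L, (‖TR (-1/2) u (T, y)‖ ^ 2 + ‖TR (1/2) v (T, y)‖ ^ 2) ≤ 3 * D0) ∧
    (∫ y in (0:ℝ)..L, (‖d2 (TR (-1/2) u) (T, y)‖ ^ 2 + ‖d2 (TR (1/2) v) (T, y)‖ ^ 2) ≤ 3 * D0) ∧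
    (∫ y in (0:ℝ)..L, (‖d2 (d2 (TR (-1/2) u)) (T, y)‖ ^ 2 + ‖d2 (d2 (TR (1/2) v)) (T, y)‖ ^ 2) ≤ 3 * D0) := by
  have hT0 : 0 < T := by linarith
  have su : Sm O2 (TR (-1/2) u) := sm_TR h.sX
  have sv : Sm O2 (TR (1/2) v) := sm_TR h.sY
  have hc : ∀ X Y : ℝ × ℝ → ℂ, Sm O2 X → Sm O2 Y → Continuous (fun y => ‖X (T, y)‖ ^ 2 + ‖Y (T, y)‖ ^ 2) :=
    fun X Y hX hY => ((hX.slice hT).norm.pow 2).add ((hY.slice hT).norm.pow 2)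
  have hm : ∀ y, (T, y) ∈ O2 := fun y => hT
  refine ⟨h.half hT hT2 hD hD1 hd hL (hc _ _ su sv) ?_, h.half hT hT2 hD hD1 hd hL (hc _ _ su.d2 sv.d2) ?_,
    h.half hT hT2 hD hD1 hd hL (hc _ _ su.d2.d2 sv.d2.d2) ?_⟩
  · exact TR_level hT0 (fun z => (E5_ge _ u z).1) (fun z => (E5_ge _ v z).1)
  · intro y
    rw [d2_TR h.sX _ (hm y), d2_TR h.sY _ (hm y)]
    exact TR_level hT0 (fun z => (E5_ge _ u z).2.1) (fun z => (E5_ge _ v z).2.1) y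
  · intro y
    rw [d22_TR h.sX _ (hm y), d22_TR h.sY _ (hm y)]
    exact TR_level hT0 (fun z => (E5_ge _ u z).2.2) (fun z => (E5_ge _ v z).2.2) y

theorem EN_halves {X Y : ℝ × ℝ → ℂ} (hX : Sm O2 X) (hY : Sm O2 Y) {T Λ b : ℝ} (hT : 1 < T)
    (h1 : ∫ y in (0:ℝ)..(Λ - Real.log T), (‖X (T, y)‖ ^ 2 + ‖Y (T, y)‖ ^ 2) ≤ b)
    (h2 : ∫ y in (0:ℝ)..(Λ - Real.log T), (‖Y (T, -y)‖ ^ 2 + ‖X (T, -y)‖ ^ 2) ≤ b) :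
    EN X Y Λ T ≤ b + b := by
  have hc : Continuous (fun y => ‖X (T, y)‖ ^ 2 + ‖Y (T, y)‖ ^ 2) :=
    ((hX.slice hT).norm.pow 2).add ((hY.slice hT).norm.pow 2)
  unfold EN
  rw [← intervalIntegral.integral_add_adjacent_intervals (hc.intervalIntegrable _ 0) (hc.intervalIntegrable 0 _)]
  refine add_le_add ?_ h1
  refine le_trans (le_of_eq ?_) h2
  have := intervalIntegral.integral_comp_neg (a := 0) (b := Λ - Real.log T) (fun y => ‖X (T, y)‖ ^ 2 + ‖Y (T, y)‖ ^ 2)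
  rw [neg_zero] at this
  rw [← this]
  refine intervalIntegral.integral_congr fun y _ => ?_
  exact add_comm _ _

theorem NS.startA {u v : ℝ × ℝ → ℂ} (h : NS u v) {T D0 a : ℝ} (hT : 1 < T) (hT2 : T ≤ 2) (hD : 0 < D0)
    (hD1 : D0 ≤ 1 / 630) (ha : a ^ 2 = 6 * D0)
    (hd : ∀ x : ℝ, 0 ≤ x → (3 - (T - x)) * E5 (-1/2) u (T + x, T - x) +
      (3 - (T - x)) * E5 (1/2) v (T + x, T - x) ≤ D0 / (1 + x) ^ 2)
    (hd' : ∀ x : ℝ, 0 ≤ x → (3 - (T - x)) * E5 (-1/2) (sw v) (T + x, T - x) +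
      (3 - (T - x)) * E5 (1/2) (sw u) (T + x, T - x) ≤ D0 / (1 + x) ^ 2) :
    Init (TR (-1/2) u) (TR (1/2) v) a T := by
  have su : Sm O2 (TR (-1/2) u) := sm_TR h.sX
  have sv : Sm O2 (TR (1/2) v) := sm_TR h.sY
  have e1 : TR (-1/2) (sw v) = rf (TR (1/2) v) := by rw [TR_sw]; norm_num
  have e2 : TR (1/2) (sw u) = rf (TR (-1/2) u) := by rw [TR_sw]; norm_num
  have e6 : a ^ 2 = 3 * D0 + 3 * D0 := by rw [ha]; ring
  have hm : ∀ y, (T, y) ∈ O2 := fun y => hT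
  refine ⟨?_, ?_, ?_⟩ <;> intro Λ hΛ <;> rw [e6] <;>
    obtain ⟨A0, A1, A2⟩ := half_levels h hT hT2 hD hD1 hd hΛ <;>
    obtain ⟨B0, B1, B2⟩ := half_levels h.swap hT hT2 hD hD1 hd' hΛ <;> rw [e1, e2] at B0 B1 B2
  · exact EN_halves su sv hT A0 B0
  · refine EN_halves su.d2 sv.d2 hT A1 ?_
    simp only [fun y => d2_rf sv _ (hm y), fun y => d2_rf su _ (hm y), norm_neg] at B1
    exact B1
  · refine EN_halves su.d2.d2 sv.d2.d2 hT A2 ?_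
    simp only [fun y => d22_rf sv _ (hm y), fun y => d22_rf su _ (hm y)] at B2
    exact B2

/-! ### Part L: data on a constant time slice -/

/-- bound for null derivatives up to second order at a point -/
structure Bd (F : ℝ × ℝ → ℂ) (z : ℝ × ℝ) (η : ℝ) : Prop where
  b0 : ‖F z‖ ≤ η
  b1 : ‖d1 F z‖ ≤ η
  b2 : ‖d2 F z‖ ≤ η
  b11 : ‖d1 (d1 F) z‖ ≤ η
  b12 : ‖d2 (d1 F) z‖ ≤ η
  b22 : ‖d2 (d2 F) z‖ ≤ η

theorem Bd.sw {F : ℝ × ℝ → ℂ} (hF : Sm N2 F) {p q η : ℝ} (hz : (p, q) ∈ N2) (h : Bd F (p, q) η) :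
    Bd (sw F) (q, p) η := by
  have hz' := sw_N2 hz
  refine ⟨h.b0, ?_, ?_, ?_, ?_, ?_⟩
  · rw [d1_sw hF _ hz']; exact h.b2
  · rw [d2_sw hF _ hz']; exact h.b1
  · rw [d1_congr N2_open (d1_sw hF) _ hz', d1_sw hF.d2 _ hz']; exact h.b22
  · rw [d2_congr N2_open (d1_sw hF) _ hz', d2_sw hF.d2 _ hz']
    change ‖d1 (d2 F) (p, q)‖ ≤ η
    rw [hF.comm hz]; exact h.b12
  · rw [d2_congr N2_open (d2_sw hF) _ hz', d2_sw hF.d1 _ hz']; exact h.b11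

theorem Dm_bd {F : ℝ × ℝ → ℂ} {c k : ℝ} (hc : |c| ≤ k) {p q h η : ℝ} (hp : |p| ≤ h) (hq : |q| ≤ h)
    (h0 : ‖F (p, q)‖ ≤ η) (h1 : ‖d1 F (p, q)‖ ≤ η) (h2 : ‖d2 F (p, q)‖ ≤ η) :
    ‖Dm c F (p, q)‖ ≤ (2 * h + k) * η := by
  unfold Dm
  have e := (norm_add_le ((p : ℂ) * d1 F (p, q) - (q : ℂ) * d2 F (p, q)) ((c : ℂ) * F (p, q))).trans
    (add_le_add_left (norm_sub_le _ _) _)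
  refine e.trans ?_
  simp only [norm_mul, Complex.norm_real, Real.norm_eq_abs]
  have hη : 0 ≤ η := (norm_nonneg _).trans h0
  have t1 := mul_le_mul hp h1 (norm_nonneg _) ((abs_nonneg _).trans hp)
  have t2 := mul_le_mul hq h2 (norm_nonneg _) ((abs_nonneg _).trans hq)
  have t3 := mul_le_mul hc h0 (norm_nonneg _) ((abs_nonneg _).trans hc)
  linarith

theorem E5_bd {F : ℝ × ℝ → ℂ} (hF : Sm N2 F) {c : ℝ} (hc : |c| ≤ 1/2) {p q h η : ℝ} (hz : (p, q) ∈ N2)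
    (hh : 1 ≤ h) (hp : |p| ≤ h) (hq : |q| ≤ h) (b : Bd F (p, q) η) :
    E5 c F (p, q) ≤ 405 * h ^ 4 * η ^ 2 := by
  have hη : 0 ≤ η := (norm_nonneg _).trans b.b0
  have hc1 : |c + 1| ≤ 3/2 := by rw [abs_le] at *; constructor <;> linarith
  have hc2 : |c - 1| ≤ 3/2 := by rw [abs_le] at *; constructor <;> linarith
  have f2 := Dm_bd hc hp hq b.b0 b.b1 b.b2
  have b12' : ‖d1 (d2 F) (p, q)‖ ≤ η := by rw [hF.comm hz]; exact b.b12
  have f3 : ‖d2 (Dm c F) (p, q)‖ ≤ (2 * h + 3/2) * η := by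
    rw [d2_Dm hF c _ hz]; exact Dm_bd hc2 hp hq b.b2 b12' b.b22
  have f3' : ‖d1 (Dm c F) (p, q)‖ ≤ (2 * h + 3/2) * η := by
    rw [d1_Dm hF c _ hz]; exact Dm_bd hc1 hp hq b.b1 b.b11 b.b12
  have f2' : ‖Dm c F (p, q)‖ ≤ (2 * h + 3/2) * η := f2.trans (by nlinarith)
  have f4 := Dm_bd hc hp hq f2' f3' f3
  have k1 : η ≤ 9 * h ^ 2 * η := by nlinarith [mul_nonneg (show 0 ≤ 9 * h ^ 2 - 1 by nlinarith) hη]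
  have k2 : (2 * h + 3/2) * η ≤ 9 * h ^ 2 * η := mul_le_mul_of_nonneg_right (by nlinarith) hη
  have k3 : (2 * h + 1/2) * ((2 * h + 3/2) * η) ≤ 9 * h ^ 2 * η := by
    rw [← mul_assoc]; exact mul_le_mul_of_nonneg_right (by nlinarith) hη
  have sqb : ∀ w : ℂ, ‖w‖ ≤ 9 * h ^ 2 * η → ‖w‖ ^ 2 ≤ 81 * h ^ 4 * η ^ 2 := by
    intro w hw
    have := pow_le_pow_left₀ (norm_nonneg w) hw 2
    refine this.trans (le_of_eq (by ring))
  have s0 := sqb _ (b.b0.trans k1)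
  have s1 := sqb _ (b.b2.trans k1)
  have s2 := sqb _ (f2'.trans k2)
  have s3 := sqb _ (f3.trans k2)
  have s4 := sqb _ (f4.trans k3)
  unfold E5
  linarith

/-- spatial derivative in null coordinates -/
def Xd (F : ℝ × ℝ → ℂ) (z : ℝ × ℝ) : ℂ := d1 F z - d2 F z

theorem Sm.Xd {F : ℝ × ℝ → ℂ} (hF : Sm N2 F) : Sm N2 (Xd F) := hF.d1.sub hF.d2

theorem XdXd {F : ℝ × ℝ → ℂ} (hF : Sm N2 F) : ∀ z ∈ N2,
    Xd (Xd F) z = d1 (d1 F) z - 2 * d2 (d1 F) z + d2 (d2 F) z := by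
  rintro ⟨p, q⟩ hz
  have e1 : d1 (Xd F) (p, q) = d1 (d1 F) (p, q) - d1 (d2 F) (p, q) :=
    hF.Xd.d1_eq hz ((hF.d1.hd1 hz).sub (hF.d2.hd1 hz))
  have e2 : d2 (Xd F) (p, q) = d2 (d1 F) (p, q) - d2 (d2 F) (p, q) :=
    hF.Xd.d2_eq hz ((hF.d1.hd2 hz).sub (hF.d2.hd2 hz))
  change d1 (Xd F) (p, q) - d2 (Xd F) (p, q) = _
  rw [e1, e2, hF.comm hz]; ring

theorem Xd_sw {F : ℝ × ℝ → ℂ} (hF : Sm N2 F) {p q : ℝ} (hz : (p, q) ∈ N2) :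
    ‖Xd (sw F) (q, p)‖ = ‖Xd F (p, q)‖ ∧ ‖Xd (Xd (sw F)) (q, p)‖ = ‖Xd (Xd F) (p, q)‖ := by
  have hz' := sw_N2 hz
  constructor
  · unfold Xd
    rw [d1_sw hF _ hz', d2_sw hF _ hz', norm_sub_rev]; rfl
  · rw [XdXd hF.sw _ hz', XdXd hF _ hz, d1_congr N2_open (d1_sw hF) _ hz', d2_congr N2_open (d1_sw hF) _ hz',
      d2_congr N2_open (d2_sw hF) _ hz', d1_sw hF.d2 _ hz', d2_sw hF.d2 _ hz', d2_sw hF.d1 _ hz']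
    change ‖d2 (d2 F) (p, q) - 2 * d1 (d2 F) (p, q) + d1 (d1 F) (p, q)‖ = _
    rw [hF.comm hz]; congr 1; ring

theorem NS.bd {u v : ℝ × ℝ → ℂ} (h : NS u v) {z : ℝ × ℝ} (hz : z ∈ N2) {η : ℝ} (hη1 : η ≤ 1)
    (u0 : ‖u z‖ ≤ η) (u1 : ‖Xd u z‖ ≤ η) (u2 : ‖Xd (Xd u) z‖ ≤ η)
    (v0 : ‖v z‖ ≤ η) (v1 : ‖Xd v z‖ ≤ η) : Bd u z (12 * η) := by
  have hu := h.sX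
  have hv := h.sY
  have hη : 0 ≤ η := (norm_nonneg _).trans u0
  have hη3 : η * η * η ≤ η := by nlinarith [mul_nonneg hη hη]
  have hI : ∀ w : ℂ, ‖(1/2) * (Complex.I * w)‖ = ‖w‖ / 2 := by
    intro w; rw [norm_mul, norm_mul, Complex.norm_I]; simp; ring
  have n := fun F : ℝ × ℝ → ℂ => norm_nonneg (F z)
  have eu : ∀ z ∈ N2, d1 u z = (1/2) * (Complex.I * (v z + T3 v v u z)) := fun z hz => by rw [← h.eX z hz]; ring
  have ev : ∀ z ∈ N2, d2 v z = (1/2) * (Complex.I * (u z + T3 u u v z)) := fun z hz => by rw [← h.eY z hz]; ring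
  have up : ‖d1 u z‖ ≤ η := by
    rw [eu z hz, hI]
    have := norm_add_le (v z) (T3 v v u z)
    rw [norm_T3] at this
    have t := mul3 (M := η) (n v) (n v) (n u) v0 v0 u0 hη3
    linarith
  have vq : ‖d2 v z‖ ≤ η := by
    rw [ev z hz, hI]
    have := norm_add_le (u z) (T3 u u v z)
    rw [norm_T3] at this
    have t := mul3 (M := η) (n u) (n u) (n v) u0 u0 v0 hη3
    linarith
  have uq : ‖d2 u z‖ ≤ 2 * η := by
    have : d2 u z = d1 u z - Xd u z := by unfold Xd; ring
    rw [this]; have := norm_sub_le (d1 u z) (Xd u z); linarith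
  have vp : ‖d1 v z‖ ≤ 2 * η := by
    have : d1 v z = d2 v z + Xd v z := by unfold Xd; ring
    rw [this]; have := norm_add_le (d2 v z) (Xd v z); linarith
  have smF := hv.T3 hv hu
  have upp : ‖d1 (d1 u) z‖ ≤ (7/2) * η := by
    have e : d1 (d1 u) z = (1/2) * (Complex.I * (d1 v z + (T3 (d1 v) v u z + T3 v (d1 v) u z + T3 v v (d1 u) z))) := by
      rw [d1_congr N2_open eu z hz, d1_cm ((hv.add smF).cmul _) _ z hz, d1_cm (hv.add smF) _ z hz,
        d1_add hv smF z hz, d1_T3 hv hv hu z hz]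
    rw [e, hI]
    have a1 := norm_add_le (d1 v z) (T3 (d1 v) v u z + T3 v (d1 v) u z + T3 v v (d1 u) z)
    have a2 := norm_add₃_le (a := T3 (d1 v) v u z) (b := T3 v (d1 v) u z) (c := T3 v v (d1 u) z)
    simp only [norm_T3] at a2
    have t1 := mul3 (M := 2 * η) (n (d1 v)) (n v) (n u) vp v0 u0 (by nlinarith)
    have t2 := mul3 (M := 2 * η) (n v) (n (d1 v)) (n u) v0 vp u0 (by nlinarith)
    have t3 := mul3 (M := η) (n v) (n v) (n (d1 u)) v0 v0 up (by nlinarith)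
    linarith
  have upq : ‖d2 (d1 u) z‖ ≤ (5/2) * η := by
    have e : d2 (d1 u) z = (1/2) * (Complex.I * (d2 v z + (T3 (d2 v) v u z + T3 v (d2 v) u z + T3 v v (d2 u) z))) := by
      rw [d2_congr N2_open eu z hz, d2_cm ((hv.add smF).cmul _) _ z hz, d2_cm (hv.add smF) _ z hz,
        d2_add hv smF z hz, d2_T3 hv hv hu z hz]
    rw [e, hI]
    have a1 := norm_add_le (d2 v z) (T3 (d2 v) v u z + T3 v (d2 v) u z + T3 v v (d2 u) z)
    have a2 := norm_add₃_le (a := T3 (d2 v) v u z) (b := T3 v (d2 v) u z) (c := T3 v v (d2 u) z)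
    simp only [norm_T3] at a2
    have t1 := mul3 (M := η) (n (d2 v)) (n v) (n u) vq v0 u0 (by nlinarith)
    have t2 := mul3 (M := η) (n v) (n (d2 v)) (n u) v0 vq u0 (by nlinarith)
    have t3 := mul3 (M := 2 * η) (n v) (n v) (n (d2 u)) v0 v0 uq (by nlinarith)
    linarith
  have uqq : ‖d2 (d2 u) z‖ ≤ (19/2) * η := by
    have e : d2 (d2 u) z = Xd (Xd u) z - d1 (d1 u) z + 2 * d2 (d1 u) z := by rw [XdXd hu z hz]; ring
    rw [e]
    have a1 := norm_add_le (Xd (Xd u) z - d1 (d1 u) z) (2 * d2 (d1 u) z)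
    have a2 := norm_sub_le (Xd (Xd u) z) (d1 (d1 u) z)
    rw [norm_mul] at a1; simp only [Complex.norm_ofNat] at a1
    linarith
  exact ⟨by linarith, by linarith, by linarith, by linarith, by linarith, by linarith⟩

/-- pointwise decay of the data -/
def eta (x : ℝ) : ℝ := (1 / 10 ^ 9) / Real.sqrt ((1 + |x|) ^ 7)

theorem eta_sq (x : ℝ) : eta x ^ 2 * (1 + |x|) ^ 7 = 1 / 10 ^ 18 := by
  unfold eta
  have h : 0 < (1 + |x|) ^ 7 := by positivity
  rw [div_pow, Real.sq_sqrt h.le]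
  field_simp

theorem eta_le_one (x : ℝ) : eta x ≤ 1 := by
  unfold eta
  have h : (1:ℝ) ≤ Real.sqrt ((1 + |x|) ^ 7) := by
    rw [Real.one_le_sqrt]; exact one_le_pow₀ (by linarith [abs_nonneg x])
  rw [div_le_one (by linarith)]
  refine le_trans ?_ h; norm_num

theorem data_E5 {u v : ℝ × ℝ → ℂ} (hu : Sm N2 u) (hv : Sm N2 v) {T : ℝ} (hT : 1 < T) (hT2 : T ≤ 2) {x : ℝ} (hx : 0 ≤ x)
    (bu : Bd u (T + x, T - x) (12 * eta x)) (bv : Bd v (T + x, T - x) (12 * eta x)) :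
    (3 - (T - x)) * E5 (-1/2) u (T + x, T - x) + (3 - (T - x)) * E5 (1/2) v (T + x, T - x)
      ≤ ((1/160000) ^ 2 / 6) / (1 + x) ^ 2 := by
  have hz : (T + x, T - x) ∈ N2 := by rw [mem_N2]; linarith
  have hp : |T + x| ≤ 2 * (1 + x) := by rw [abs_le]; constructor <;> linarith
  have hq : |T - x| ≤ 2 * (1 + x) := by rw [abs_le]; constructor <;> linarith
  have E1 := E5_bd hu (c := -1/2) (by rw [abs_le]; norm_num) hz (by linarith) hp hq bu
  have E2 := E5_bd hv (c := 1/2) (by rw [abs_le]; norm_num) hz (by linarith) hp hq bv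
  have hw : 3 - (T - x) ≤ 2 * (1 + x) := by linarith
  have hw0 : 0 ≤ 3 - (T - x) := by linarith
  have es := eta_sq x
  rw [abs_of_nonneg hx] at es
  have t : (3 - (T - x)) * (E5 (-1/2) u (T + x, T - x) + E5 (1/2) v (T + x, T - x)) ≤
      (2 * (1 + x)) * (2 * (405 * (2 * (1 + x)) ^ 4 * (12 * eta x) ^ 2)) :=
    mul_le_mul hw (by linarith) (add_nonneg (E5_nn _ _ _) (E5_nn _ _ _)) (by linarith)
  rw [le_div_iff₀ (by positivity), ← mul_add]
  have t2 := mul_le_mul_of_nonneg_right t (show 0 ≤ (1 + x) ^ 2 by positivity)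
  refine t2.trans ?_
  have : (2 * (1 + x)) * (2 * (405 * (2 * (1 + x)) ^ 4 * (12 * eta x) ^ 2)) * (1 + x) ^ 2 =
    3732480 * (eta x ^ 2 * (1 + x) ^ 7) := by ring
  rw [this, es]; norm_num

theorem NS.startB {u v : ℝ × ℝ → ℂ} (h : NS u v) {T : ℝ} (hT : 1 < T) (hT2 : T ≤ 2)
    (hu0 : ∀ x, ‖u (T + x, T - x)‖ ≤ eta x) (hu1 : ∀ x, ‖Xd u (T + x, T - x)‖ ≤ eta x)
    (hu2 : ∀ x, ‖Xd (Xd u) (T + x, T - x)‖ ≤ eta x)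
    (hv0 : ∀ x, ‖v (T + x, T - x)‖ ≤ eta x) (hv1 : ∀ x, ‖Xd v (T + x, T - x)‖ ≤ eta x)
    (hv2 : ∀ x, ‖Xd (Xd v) (T + x, T - x)‖ ≤ eta x) :
    Init (TR (-1/2) u) (TR (1/2) v) (1/160000) T := by
  have hz : ∀ x, (T + x, T - x) ∈ N2 := fun x => by rw [mem_N2]; linarith
  have bu : ∀ x, Bd u (T + x, T - x) (12 * eta x) := fun x =>
    h.bd (hz x) (eta_le_one x) (hu0 x) (hu1 x) (hu2 x) (hv0 x) (hv1 x)
  have bsv : ∀ x, Bd (sw v) (T - x, T + x) (12 * eta x) := fun x => by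
    refine h.swap.bd (sw_N2 (hz x)) (eta_le_one x) (hv0 x) ?_ ?_ (hu0 x) ?_
    · rw [(Xd_sw h.sY (hz x)).1]; exact hv1 x
    · rw [(Xd_sw h.sY (hz x)).2]; exact hv2 x
    · rw [(Xd_sw h.sX (hz x)).1]; exact hu1 x
  have bv : ∀ x, Bd v (T + x, T - x) (12 * eta x) := fun x =>
    Bd.sw h.sY.sw (sw_N2 (hz x)) (bsv x)
  have bsu : ∀ x, Bd (sw u) (T - x, T + x) (12 * eta x) := fun x => Bd.sw h.sX (hz x) (bu x)
  refine h.startA hT hT2 (D0 := (1/160000) ^ 2 / 6) (by norm_num) (by norm_num) (by norm_num) ?_ ?_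
  · intro x hx
    exact data_E5 h.sX h.sY hT hT2 hx (bu x) (bv x)
  · intro x hx
    have e1 := bsv (-x)
    have e2 := bsu (-x)
    have en : eta (-x) = eta x := by simp [eta]
    rw [en, sub_neg_eq_add, ← sub_eq_add_neg] at e1 e2
    exact data_E5 h.sY.sw h.sX.sw hT hT2 hx e1 e2

/-! ### Part M: physical coordinates, smoothness up to the initial slice -/

/-- closed half space -/
def Hc : Set (ℝ × ℝ) := {p : ℝ × ℝ | 1 ≤ p.1}

/-- uncurried function -/
def unc (u : ℝ → ℝ → ℂ) (z : ℝ × ℝ) : ℂ := u z.1 z.2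

theorem Hc_udo : UniqueDiffOn ℝ Hc := by
  have : Hc = Set.Ici (1:ℝ) ×ˢ (Set.univ : Set ℝ) := by ext z; simp [Hc]
  rw [this]; exact (uniqueDiffOn_Ici 1).prod uniqueDiffOn_univ

theorem px_cd {u : ℝ → ℝ → ℂ} (h : ContDiffOn ℝ (⊤ : ℕ∞) (unc u) Hc) :
    ContDiffOn ℝ (⊤ : ℕ∞) (unc (px u)) Hc := by
  have h1 : ContDiffOn ℝ (⊤ : ℕ∞) (fun z => fderivWithin ℝ (unc u) Hc z (0, 1)) Hc :=
    (h.fderivWithin Hc_udo (m := (⊤ : ℕ∞)) (by simp)).clm_apply contDiffOn_const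
  refine h1.congr ?_
  rintro ⟨t, x⟩ hz
  have h2 : HasFDerivWithinAt (unc u) (fderivWithin ℝ (unc u) Hc (t, x)) Hc (t, x) :=
    ((h.differentiableOn (by simp)) (t, x) hz).hasFDerivWithinAt
  have h3 : HasDerivAt (fun y : ℝ => (t, y)) ((0:ℝ), (1:ℝ)) x := (hasDerivAt_const x t).prodMk (hasDerivAt_id x)
  have h4 := h2.comp_hasDerivAt x h3 (Filter.Eventually.of_forall fun y => hz)
  exact h4.deriv

theorem pxj_cd {u : ℝ → ℝ → ℂ} (h : ContDiffOn ℝ (⊤ : ℕ∞) (unc u) Hc) (j : ℕ) :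
    ContDiffOn ℝ (⊤ : ℕ∞) (unc (px^[j] u)) Hc := by
  induction j with
  | zero => exact h
  | succ k ih => rw [Function.iterate_succ_apply']; exact px_cd ih

theorem cd_sm {u : ℝ → ℝ → ℂ} (h : ContDiffOn ℝ (⊤ : ℕ∞) (unc u) Hc) : Sm O2 (unc u) :=
  ⟨O2_open, h.mono fun z hz => le_of_lt (show (1:ℝ) < z.1 from hz)⟩

theorem px_d2 {u : ℝ → ℝ → ℂ} (h : ContDiffOn ℝ (⊤ : ℕ∞) (unc u) Hc) : ∀ z ∈ O2, unc (px u) z = d2 (unc u) z := by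
  rintro ⟨t, x⟩ hz
  exact ((cd_sm h).hd2 hz).deriv

theorem pt_d1 {u : ℝ → ℝ → ℂ} (h : ContDiffOn ℝ (⊤ : ℕ∞) (unc u) Hc) : ∀ z ∈ O2, unc (pt u) z = d1 (unc u) z := by
  rintro ⟨t, x⟩ hz
  exact ((cd_sm h).hd1 hz).deriv

/-- null coordinates -/
def nl (F : ℝ × ℝ → ℂ) (z : ℝ × ℝ) : ℂ := F ((z.1 + z.2) / 2, (z.1 - z.2) / 2)

theorem nl_mem {z : ℝ × ℝ} (hz : z ∈ N2) : ((z.1 + z.2) / 2, (z.1 - z.2) / 2) ∈ O2 := by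
  have : 2 < z.1 + z.2 := hz
  rw [mem_O2]; linarith

theorem sm_nl {F : ℝ × ℝ → ℂ} (hF : Sm O2 F) : Sm N2 (nl F) := by
  refine ⟨N2_open, hF.2.comp (t := O2) (f := fun z : ℝ × ℝ => ((z.1 + z.2) / 2, (z.1 - z.2) / 2)) ?_ fun z hz => nl_mem hz⟩
  exact ContDiff.contDiffOn (by fun_prop)

theorem d1_nl {F : ℝ × ℝ → ℂ} (hF : Sm O2 F) : ∀ z ∈ N2, d1 (nl F) z = (1/2) * (nl (d1 F) z + nl (d2 F) z) := by
  rintro ⟨p, q⟩ hz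
  refine (sm_nl hF).d1_eq hz ?_
  have e1 : HasDerivAt (fun r : ℝ => (r + q) / 2) (1 / 2) p := ((hasDerivAt_id p).add_const q).div_const 2
  have e2 : HasDerivAt (fun r : ℝ => (r - q) / 2) (1 / 2) p := ((hasDerivAt_id p).sub_const q).div_const 2
  refine (hF.chain e1 e2 (nl_mem hz)).congr_deriv ?_
  simp only [nl, Complex.real_smul]; push_cast; ring

theorem d2_nl {F : ℝ × ℝ → ℂ} (hF : Sm O2 F) : ∀ z ∈ N2, d2 (nl F) z = (1/2) * (nl (d1 F) z - nl (d2 F) z) := by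
  rintro ⟨p, q⟩ hz
  refine (sm_nl hF).d2_eq hz ?_
  have e1 : HasDerivAt (fun r : ℝ => (p + r) / 2) (1 / 2) q := ((hasDerivAt_id q).const_add p).div_const 2
  have e2 : HasDerivAt (fun r : ℝ => (p - r) / 2) (-1 / 2) q := ((hasDerivAt_id q).const_sub p).div_const 2
  refine (hF.chain e1 e2 (nl_mem hz)).congr_deriv ?_
  simp only [nl, Complex.real_smul]; push_cast; ring

theorem Xd_nl {F : ℝ × ℝ → ℂ} (hF : Sm O2 F) : ∀ z ∈ N2, Xd (nl F) z = nl (d2 F) z := by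
  intro z hz
  simp only [Xd, d1_nl hF z hz, d2_nl hF z hz]; ring

theorem XdXd_nl {F : ℝ × ℝ → ℂ} (hF : Sm O2 F) : ∀ z ∈ N2, Xd (Xd (nl F)) z = nl (d2 (d2 F)) z := by
  intro z hz
  rw [← Xd_nl hF.d2 z hz]
  simp only [Xd]
  rw [d1_congr N2_open (Xd_nl hF) z hz, d2_congr N2_open (Xd_nl hF) z hz]

theorem nsq_conj (w : ℂ) : ((‖w‖ ^ 2 : ℝ) : ℂ) = w * (starRingEnd ℂ) w := by
  rw [Complex.mul_conj, Complex.normSq_eq_norm_sq]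

theorem thirring_NS {u v : ℝ → ℝ → ℂ} (hu : ContDiffOn ℝ (⊤ : ℕ∞) (unc u) Hc)
    (hv : ContDiffOn ℝ (⊤ : ℕ∞) (unc v) Hc) (hT : Thirring u v) : NS (nl (unc u)) (nl (unc v)) := by
  have su := cd_sm hu
  have sv := cd_sm hv
  have s1 := sm_nl su
  have s2 := sm_nl sv
  refine ⟨s1, s2, s2.T3 s2 s1, s1.T3 s1 s2, ?_, ?_⟩
  · intro z hz
    have hz' := nl_mem hz
    have e := (hT ((z.1 + z.2) / 2) ((z.1 - z.2) / 2) (le_of_lt hz')).1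
    have e1 := pt_d1 hu _ hz'
    have e2 := px_d2 hu _ hz'
    rw [nsq_conj] at e
    rw [d1_nl su z hz]
    simp only [nl, T3, ← e1, ← e2]
    simp only [unc]
    linear_combination e
  · intro z hz
    have hz' := nl_mem hz
    have e := (hT ((z.1 + z.2) / 2) ((z.1 - z.2) / 2) (le_of_lt hz')).2
    have e1 := pt_d1 hv _ hz'
    have e2 := px_d2 hv _ hz'
    rw [nsq_conj] at e
    rw [d2_nl sv z hz]
    simp only [nl, T3, ← e1, ← e2]
    simp only [unc]
    linear_combination e

/-- short time propagation of pointwise decay -/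
theorem prop_short {u : ℝ → ℝ → ℂ} (hu : ContDiffOn ℝ (⊤ : ℕ∞) (unc u) Hc) (hS : SchwartzLocUnif u) (j : ℕ)
    (h1 : ∀ x, ‖px^[j] u 1 x‖ ≤ eta x / 2) :
    ∃ Ts > 1, ∀ T, 1 < T → T ≤ Ts → ∀ x, ‖px^[j] u T x‖ ≤ eta x := by
  obtain ⟨C0, hC0⟩ := hS 1 j 0 2
  obtain ⟨C4, hC4⟩ := hS 1 j 4 2
  set K := max C0 0 + max C4 0 + 1 with hK
  have hK0 : 0 < K := by positivity
  have hb : ∀ t ∈ Set.Icc (1:ℝ) 2, ∀ x, ‖pt (px^[j] u) t x‖ ≤ 8 * K / (1 + |x|) ^ 4 := by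
    intro t ht x
    have a0 := hC0 t ht x
    have a4 := hC4 t ht x
    simp only [Function.iterate_one, pow_zero, one_mul] at a0 a4
    rw [le_div_iff₀ (by positivity)]
    have hx := abs_nonneg x
    have hp : (1 + |x|) ^ 4 ≤ 8 * (1 + |x| ^ 4) := by
      nlinarith [sq_nonneg (|x| - 1), sq_nonneg (|x| ^ 2 - 1), sq_nonneg (|x| ^ 2 - |x|)]
    have hn := norm_nonneg (pt (px^[j] u) t x)
    calc ‖pt (px^[j] u) t x‖ * (1 + |x|) ^ 4 ≤ ‖pt (px^[j] u) t x‖ * (8 * (1 + |x| ^ 4)) :=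
          mul_le_mul_of_nonneg_left hp hn
      _ = 8 * (‖pt (px^[j] u) t x‖ + |x| ^ 4 * ‖pt (px^[j] u) t x‖) := by ring
      _ ≤ 8 * K := by
          have := le_max_left C0 0
          have := le_max_left C4 0
          linarith
  have hcd := pxj_cd hu j
  have hsm := cd_sm hcd
  set κ : ℝ := 1 / (2 * 10 ^ 9) / (8 * K) with hκ
  have hκ0 : 0 < κ := by positivity
  refine ⟨1 + min 1 κ, by linarith [lt_min one_pos hκ0], ?_⟩
  intro T hT hTs x
  have hT2 : T ≤ 2 := by linarith [min_le_left 1 κ]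
  have hTκ : T - 1 ≤ κ := by linarith [min_le_right 1 κ]
  set B := 8 * K / (1 + |x|) ^ 4 with hB
  have hB0 : 0 ≤ B := by positivity
  have step : ∀ s, 1 < s → s < T → ‖px^[j] u T x - px^[j] u s x‖ ≤ B * (T - 1) := by
    intro s hs hsT
    have := Convex.norm_image_sub_le_of_norm_hasDerivWithin_le (f := fun t => px^[j] u t x)
      (f' := fun t => pt (px^[j] u) t x) (s := Set.Icc s T) (C := B) (x := s) (y := T) ?_ ?_ (convex_Icc _ _)
      ⟨le_rfl, hsT.le⟩ ⟨hsT.le, le_rfl⟩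
    · refine this.trans ?_
      rw [Real.norm_eq_abs, abs_of_nonneg (by linarith)]
      exact mul_le_mul_of_nonneg_left (by linarith) hB0
    · intro t ht
      have hm : (t, x) ∈ O2 := lt_of_lt_of_le hs ht.1
      have h5 := hsm.hd1 hm
      rw [← pt_d1 hcd _ hm] at h5
      exact h5.hasDerivWithinAt
    · intro t ht
      exact hb t ⟨by linarith [ht.1], by linarith [ht.2]⟩ x
  have lim : ‖px^[j] u T x - px^[j] u 1 x‖ ≤ B * (T - 1) := by
    have hcw : ContinuousWithinAt (fun s : ℝ => px^[j] u s x) (Set.Ioi 1) 1 := by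
      have h6 : ContinuousWithinAt (unc (px^[j] u)) Hc (1, x) := hcd.continuousOn (1, x) (by simp [Hc])
      exact ContinuousWithinAt.comp (f := fun s : ℝ => (s, x)) (t := Hc) h6 (by fun_prop)
        (fun s hs => le_of_lt (show (1:ℝ) < s from hs))
    have h7 : Filter.Tendsto (fun s => ‖px^[j] u T x - px^[j] u s x‖) (nhdsWithin 1 (Set.Ioi 1))
        (nhds ‖px^[j] u T x - px^[j] u 1 x‖) := (tendsto_const_nhds.sub hcw).norm
    refine le_of_tendsto h7 ?_
    filter_upwards [Ioo_mem_nhdsGT hT] with s hs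
    exact step s hs.1 hs.2
  have hfin : B * (T - 1) ≤ eta x / 2 := by
    refine (mul_le_mul_of_nonneg_left hTκ hB0).trans ?_
    have e : B * κ = (1 / (2 * 10 ^ 9)) / (1 + |x|) ^ 4 := by
      rw [hB, hκ]; field_simp
    rw [e]; unfold eta
    have hx := abs_nonneg x
    have hs : Real.sqrt ((1 + |x|) ^ 7) ≤ (1 + |x|) ^ 4 := by
      rw [Real.sqrt_le_left (by positivity), ← pow_mul]
      exact pow_le_pow_right₀ (by linarith) (by norm_num)
    have hs0 : 0 < Real.sqrt ((1 + |x|) ^ 7) := Real.sqrt_pos.2 (by positivity)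
    rw [div_div, div_div, div_div]
    refine one_div_le_one_div_of_le (by positivity) ?_
    nlinarith
  have : px^[j] u T x = (px^[j] u T x - px^[j] u 1 x) + px^[j] u 1 x := by ring
  rw [this]
  refine (norm_add_le _ _).trans ?_
  linarith [h1 x]

/-! ### Part N: pointwise bounds for the data -/

theorem px_iter (u : ℝ → ℝ → ℂ) (t : ℝ) (j : ℕ) : px^[j] u t = deriv^[j] (u t) := by
  induction j with
  | zero => rfl
  | succ k ih =>
    rw [Function.iterate_succ_apply', Function.iterate_succ_apply', ← ih]; rfl

/-- the data as a Schwartz function -/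
theorem data_schwartz {u : ℝ → ℝ → ℂ} (hu : ContDiffOn ℝ (⊤ : ℕ∞) (unc u) Hc) (hS : SchwartzLocUnif u) :
    ∃ f : SchwartzMap ℝ ℂ, ∀ x, f x = u 1 x := by
  have hc : ContDiff ℝ (⊤ : ℕ∞) (u 1) := by
    rw [← contDiffOn_univ]
    exact hu.comp (f := fun x : ℝ => ((1:ℝ), x)) (t := Hc) (ContDiff.contDiffOn (by fun_prop)) (fun x _ => by simp [Hc])
  refine ⟨⟨u 1, hc, ?_⟩, fun x => rfl⟩
  intro k n
  obtain ⟨C, hC⟩ := hS 0 n k 1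
  refine ⟨C, fun x => ?_⟩
  have := hC 1 (by simp) x
  rw [norm_iteratedFDeriv_eq_norm_iteratedDeriv, iteratedDeriv_eq_iterate, ← px_iter]
  exact this

theorem schwartz_iter (F : SchwartzMap ℝ ℂ) (j : ℕ) : ∃ G : SchwartzMap ℝ ℂ, (G : ℝ → ℂ) = deriv^[j] F := by
  induction j with
  | zero => exact ⟨F, rfl⟩
  | succ k ih =>
    obtain ⟨G, hG⟩ := ih
    refine ⟨SchwartzMap.derivCLM ℂ ℂ G, ?_⟩
    rw [Function.iterate_succ_apply', ← hG]
    ext x; simp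

theorem sob_pt {F : SchwartzMap ℝ ℂ} {e : ℝ} (he : sobNorm 5 F ≤ e) {j : ℕ} (hj : j ≤ 2) (x : ℝ) :
    HasDerivAt (deriv^[j] F) (deriv^[j+1] F x) x ∧ ‖deriv^[j] F x‖ ≤ 2 * e := by
  obtain ⟨G, hG⟩ := schwartz_iter F j
  obtain ⟨G', hG'⟩ := schwartz_iter F (j+1)
  have hd : ∀ x, HasDerivAt (deriv^[j] F) (deriv^[j+1] F x) x := by
    intro x
    rw [Function.iterate_succ_apply', ← hG]
    exact G.differentiableAt.hasDerivAt
  refine ⟨hd x, ?_⟩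
  have e0 : 0 ≤ e := le_trans (Real.sqrt_nonneg _) he
  have hs : ∑ j ∈ Finset.range (5 + 1), ∫ x : ℝ, ‖deriv^[j] F x‖ ^ 2 ≤ e ^ 2 := by
    rw [sobNorm, Real.sqrt_le_left e0] at he; exact he
  have hn : ∀ i ∈ Finset.range (5+1), 0 ≤ ∫ x : ℝ, ‖deriv^[i] F x‖ ^ 2 := fun i _ => integral_nonneg fun x => by positivity
  have hi : ∀ i, i ≤ 5 → ∀ a b : ℝ, a ≤ b → ∫ s in a..b, ‖deriv^[i] F s‖ ^ 2 ≤ e ^ 2 := by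
    intro i hi a b hab
    obtain ⟨K, hK⟩ := schwartz_iter F i
    have h1 := Finset.single_le_sum hn (Finset.mem_range.2 (Nat.lt_succ_of_le hi))
    refine le_trans ?_ (h1.trans hs)
    rw [intervalIntegral.integral_of_le hab]
    refine setIntegral_le_integral ?_ (Filter.Eventually.of_forall fun x => by positivity)
    rw [← hK]
    exact (K.memLp 2 volume).integrable_norm_pow two_ne_zero
  have h := sob_int (f := deriv^[j] F) (f' := deriv^[j+1] F) (a := x - 1) (b := x + 1) (c := 1) (by linarith) one_pos
    (fun q _ => hd q) (by rw [← hG']; exact G'.continuous.continuousOn) (q := x) ⟨by linarith, by linarith⟩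
  have i1 := hi j (by omega) (x-1) (x+1) (by linarith)
  have i2 := hi (j+1) (by omega) (x-1) (x+1) (by linarith)
  have : ‖deriv^[j] F x‖ ^ 2 ≤ (2 * e) ^ 2 := by
    have e2 := sq_nonneg e
    rw [inv_one, one_mul] at h
    nlinarith
  exact abs_le_of_sq_le_sq' this (by positivity) |>.2

/-- weight -/
def Wt (x : ℝ) : ℝ := jb x ^ (7/2 : ℝ)

theorem Wt_eq (x : ℝ) : Wt x = (1 + ‖x‖ ^ 2) ^ (7/4 : ℝ) := by
  rw [Wt, jb, Real.sqrt_eq_rpow, ← Real.rpow_mul (by positivity)]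
  norm_num

theorem Wt_pos (x : ℝ) : 0 < Wt x := by rw [Wt_eq]; positivity

def mW (x : ℝ) : ℝ := (7/2) * x / (1 + x ^ 2)
def mW' (x : ℝ) : ℝ := (7/2) * (1 - x ^ 2) / (1 + x ^ 2) ^ 2

theorem Wt_deriv (x : ℝ) : HasDerivAt Wt (mW x * Wt x) x := by
  have h1 : HasDerivAt (fun x : ℝ => 1 + x ^ 2) (2 * x) x := by
    simpa using (hasDerivAt_pow 2 x).const_add 1
  have h2 := h1.rpow_const (p := 7/4) (Or.inl (by positivity))
  have e : Wt = fun x : ℝ => (1 + x ^ 2) ^ (7/4 : ℝ) := by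
    ext y; rw [Wt_eq]; simp
  rw [e]
  refine h2.congr_deriv ?_
  rw [Real.rpow_sub_one (by positivity)]
  simp only [mW]; field_simp; ring

theorem mW_deriv (x : ℝ) : HasDerivAt mW (mW' x) x := by
  have h1 : HasDerivAt (fun x : ℝ => 1 + x ^ 2) (2 * x) x := by
    simpa using (hasDerivAt_pow 2 x).const_add 1
  have h2 : HasDerivAt (fun x : ℝ => (7/2) * x) (7/2) x := by simpa using (hasDerivAt_id x).const_mul (7/2 : ℝ)
  refine (h2.div h1 (by positivity)).congr_deriv ?_
  simp only [mW']; field_simp; ring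

theorem mW_le (x : ℝ) : |mW x| ≤ 7/4 := by
  rw [mW, abs_div, abs_of_pos (show 0 < 1 + x ^ 2 by positivity), div_le_iff₀ (by positivity), abs_le]
  constructor <;> nlinarith [sq_nonneg (x-1), sq_nonneg (x+1)]

theorem mW'_le (x : ℝ) : |mW' x| ≤ 7/2 := by
  rw [mW', abs_div, abs_of_pos (show 0 < (1 + x ^ 2)^2 by positivity), div_le_iff₀ (by positivity), abs_le]
  constructor <;> nlinarith [sq_nonneg x, sq_nonneg (x^2)]

theorem Wt_ge (x : ℝ) : Real.sqrt ((1 + |x|) ^ 7) ≤ 4 * Wt x := by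
  have hW := Wt_pos x
  refine Real.sqrt_le_iff.2 ⟨by positivity, ?_⟩
  refine abs_le_of_sq_le_sq' (?_ : _ ≤ _) (by positivity) |>.2
  have h4 : Wt x ^ 4 = (1 + x ^ 2) ^ 7 := by
    rw [Wt_eq, ← Real.rpow_natCast, ← Real.rpow_mul (by positivity), ← Real.rpow_natCast]
    norm_num
  have h1 : (1 + |x|) ^ 2 ≤ 2 * (1 + x ^ 2) := by
    nlinarith [sq_nonneg (|x| - 1), sq_abs x]
  calc ((1 + |x|) ^ 7) ^ 2 = ((1 + |x|) ^ 2) ^ 7 := by ring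
    _ ≤ (2 * (1 + x ^ 2)) ^ 7 := by gcongr
    _ = 128 * Wt x ^ 4 := by rw [h4]; ring
    _ ≤ ((4 * Wt x) ^ 2) ^ 2 := by nlinarith [pow_pos hW 4]

theorem data_bd {u : ℝ → ℝ → ℂ} (hu : ContDiffOn ℝ (⊤ : ℕ∞) (unc u) Hc) (hS : SchwartzLocUnif u)
    (he : wSobNorm (7/2) 5 (u 1) ≤ 1 / 10 ^ 12) : ∀ j, j ≤ 2 → ∀ x, ‖px^[j] u 1 x‖ ≤ eta x / 2 := by
  obtain ⟨f, hf⟩ := data_schwartz hu hS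
  have hff : u 1 = f := by ext x; rw [hf]
  have htg : (fun x : ℝ => (1 + ‖x‖ ^ 2) ^ (7/4 : ℝ)).HasTemperateGrowth :=
    Function.hasTemperateGrowth_one_add_norm_sq_rpow ℝ (7/4)
  set F : SchwartzMap ℝ ℂ := SchwartzMap.smulLeftCLM ℂ (fun x : ℝ => (1 + ‖x‖ ^ 2) ^ (7/4 : ℝ)) f with hF
  have hFe : ∀ x, F x = ((Wt x : ℝ) : ℂ) * f x := by
    intro x
    rw [hF, SchwartzMap.smulLeftCLM_apply_apply htg, Wt_eq, Complex.real_smul]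
  have hFf : (F : ℝ → ℂ) = fun x => ((Wt x : ℝ) : ℂ) * f x := funext hFe
  have hsob : sobNorm 5 F ≤ 1 / 10 ^ 12 := by
    rw [hFf, ← hff]; exact he
  have hD : ∀ x, HasDerivAt f (deriv f x) x := fun x => f.differentiableAt.hasDerivAt
  have hD2 : ∀ x, HasDerivAt (deriv f) (deriv (deriv f) x) x := by
    intro x
    obtain ⟨G, hG⟩ := schwartz_iter f 1
    have : (G : ℝ → ℂ) = deriv f := hG
    rw [← this]; exact G.differentiableAt.hasDerivAt
  have wc : ∀ x, HasDerivAt (fun x => ((Wt x : ℝ) : ℂ)) ((mW x * Wt x : ℝ) : ℂ) x := fun x => (Wt_deriv x).ofReal_comp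
  have mc : ∀ x, HasDerivAt (fun x => ((mW x : ℝ) : ℂ)) ((mW' x : ℝ) : ℂ) x := fun x => (mW_deriv x).ofReal_comp
  have hF1 : ∀ x, deriv F x = (mW x : ℂ) * F x + (Wt x : ℂ) * deriv f x := by
    intro x
    rw [hFe x]
    rw [hFf]
    refine (((wc x).mul (hD x)).congr_deriv ?_).deriv
    push_cast; ring
  have hF2 : ∀ x, deriv (deriv F) x = (mW' x : ℂ) * F x + (mW x : ℂ) * deriv F x
      + (mW x : ℂ) * ((Wt x : ℂ) * deriv f x) + (Wt x : ℂ) * deriv (deriv f) x := by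
    intro x
    have e1 : deriv F = fun x => (mW x : ℂ) * F x + (Wt x : ℂ) * deriv f x := funext hF1
    rw [e1]
    have := ((mc x).mul (F.differentiableAt (x := x)).hasDerivAt).add ((wc x).mul (hD2 x))
    refine (this.congr_deriv ?_).deriv
    rw [hF1 x]
    push_cast; ring
  intro j hj x
  have b0 : ‖F x‖ ≤ 2 * (1 / 10 ^ 12) := (sob_pt hsob (j := 0) (by norm_num) x).2
  have b1 : ‖deriv F x‖ ≤ 2 * (1 / 10 ^ 12) := (sob_pt hsob (j := 1) (by norm_num) x).2
  have b2 : ‖deriv (deriv F) x‖ ≤ 2 * (1 / 10 ^ 12) := (sob_pt hsob (j := 2) (by norm_num) x).2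
  have hm := mW_le x
  have hm' := mW'_le x
  have mn : ∀ (r : ℝ) (z : ℂ) (p q : ℝ), |r| ≤ p → ‖z‖ ≤ q → ‖(r : ℂ) * z‖ ≤ p * q := by
    intro r z p q h1 h2
    rw [norm_mul, Complex.norm_real, Real.norm_eq_abs]
    exact mul_le_mul h1 h2 (norm_nonneg _) (le_trans (abs_nonneg _) h1)
  have c1 : ‖(Wt x : ℂ) * deriv f x‖ ≤ 6 * (1 / 10 ^ 12) := by
    have e : (Wt x : ℂ) * deriv f x = deriv F x - (mW x : ℂ) * F x := by rw [hF1 x]; ring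
    rw [e]
    refine (norm_sub_le _ _).trans ?_
    have := mn _ _ _ _ hm b0
    linarith
  have c2 : ‖(Wt x : ℂ) * deriv (deriv f) x‖ ≤ 23 * (1 / 10 ^ 12) := by
    have e : (Wt x : ℂ) * deriv (deriv f) x = deriv (deriv F) x - (mW' x : ℂ) * F x - (mW x : ℂ) * deriv F x
      - (mW x : ℂ) * ((Wt x : ℂ) * deriv f x) := by rw [hF2 x]; ring
    rw [e]
    refine (norm_sub_le _ _).trans ?_
    have h1 := (norm_sub_le (deriv (deriv F) x - (mW' x : ℂ) * F x) ((mW x : ℂ) * deriv F x))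
    have h2 := (norm_sub_le (deriv (deriv F) x) ((mW' x : ℂ) * F x))
    have := mn _ _ _ _ hm' b0
    have := mn _ _ _ _ hm b1
    have := mn _ _ _ _ hm c1
    linarith
  have key : ∀ z : ℂ, ‖(Wt x : ℂ) * z‖ ≤ 23 * (1 / 10 ^ 12) → ‖z‖ ≤ eta x / 2 := by
    intro z hz
    rw [norm_mul, Complex.norm_real, Real.norm_eq_abs, abs_of_pos (Wt_pos x)] at hz
    have hs : 0 < Real.sqrt ((1 + |x|) ^ 7) := by positivity
    rw [eta, div_div, div_div, le_div_iff₀ (by positivity)]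
    have := mul_le_mul_of_nonneg_left (Wt_ge x) (norm_nonneg z)
    nlinarith
  rw [px_iter, hff]
  interval_cases j
  · refine key _ ?_
    have := hFe x
    simp only [Function.iterate_zero, id]
    rw [← this]; linarith
  · refine key _ ?_
    simp only [Function.iterate_one]; linarith
  · exact key _ c2

/-! ### Part O: final assembly -/

/-- hyperbolic angle as a function of the velocity -/
def ang (s : ℝ) : ℝ := Real.log ((1 + s) / (1 - s)) / 2

theorem ang_cont : ContinuousOn ang (Set.Ioo (-1) 1) := by
  refine ContinuousOn.div_const (ContinuousOn.log ?_ ?_) 2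
  · refine ContinuousOn.div (by fun_prop) (by fun_prop) fun s hs => ?_
    have := hs.2; intro h; linarith
  · intro s hs
    have h1 : 0 < 1 + s := by linarith [hs.1]
    have h2 : 0 < 1 - s := by linarith [hs.2]
    positivity

theorem jb_lt (x : ℝ) : |x| < jb x := by
  rw [jb]; refine Real.lt_sqrt_of_sq_lt ?_
  rw [sq_abs]; linarith

theorem hyp_coord {t x : ℝ} (h : |x| < t) :
    x / t ∈ Set.Ioo (-1 : ℝ) 1 ∧ Real.sqrt (t ^ 2 - x ^ 2) * Real.exp (ang (x / t)) = t + x ∧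
    Real.sqrt (t ^ 2 - x ^ 2) * Real.exp (-ang (x / t)) = t - x := by
  have ht : 0 < t := lt_of_le_of_lt (abs_nonneg x) h
  obtain ⟨h1, h2⟩ := abs_lt.1 h
  have hp : 0 < t + x := by linarith
  have hm : 0 < t - x := by linarith
  have hr : 0 ≤ t ^ 2 - x ^ 2 := by nlinarith
  have e0 : (1 + x / t) / (1 - x / t) = (t + x) / (t - x) := by
    rw [div_eq_div_iff ?_ hm.ne']
    · field_simp
    · have : x / t < 1 := by rw [div_lt_one ht]; linarith
      intro h; linarith
  have e1 : Real.exp (ang (x / t)) ^ 2 = (t + x) / (t - x) := by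
    rw [← Real.exp_nat_mul, ang, e0]
    push_cast
    rw [mul_div_cancel₀ _ (two_ne_zero), Real.exp_log (by positivity)]
  have e2 : Real.sqrt (t ^ 2 - x ^ 2) * Real.exp (ang (x / t)) = t + x := by
    refine (pow_left_inj₀ (by positivity) hp.le two_ne_zero).1 ?_
    rw [mul_pow, Real.sq_sqrt hr, e1]; field_simp; ring
  refine ⟨⟨?_, ?_⟩, e2, ?_⟩
  · rw [lt_div_iff₀ ht]; linarith
  · rw [div_lt_one ht]; exact h2
  · have h3 : (Real.sqrt (t ^ 2 - x ^ 2) * Real.exp (ang (x / t))) * (Real.sqrt (t ^ 2 - x ^ 2) * Real.exp (-ang (x / t)))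
        = t ^ 2 - x ^ 2 := by
      rw [Real.exp_neg]
      have := Real.exp_ne_zero (ang (x / t))
      field_simp
      exact Real.sq_sqrt hr
    rw [e2] at h3
    have : (t + x) * (t - x) = t ^ 2 - x ^ 2 := by ring
    exact mul_left_cancel₀ hp.ne' (h3.trans this.symm)

theorem TR_u (u : ℝ → ℝ → ℂ) {t x : ℝ} (h : |x| < t) :
    TR (-1/2) (nl (unc u)) (Real.sqrt (t ^ 2 - x ^ 2), ang (x / t)) = ((Real.sqrt (t - x) : ℝ) : ℂ) * u t x := by
  obtain ⟨-, e1, e2⟩ := hyp_coord h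
  simp only [TR, nl, unc, e1, e2]
  have e3 : Real.sqrt (Real.sqrt (t ^ 2 - x ^ 2)) * Real.exp (-1 / 2 * ang (x / t)) = Real.sqrt (t - x) := by
    rw [← e2, Real.sqrt_mul (Real.sqrt_nonneg _), ← Real.exp_half]
    congr 2; ring
  rw [e3]; congr 2 <;> ring

theorem TR_v (v : ℝ → ℝ → ℂ) {t x : ℝ} (h : |x| < t) :
    TR (1/2) (nl (unc v)) (Real.sqrt (t ^ 2 - x ^ 2), ang (x / t)) = ((Real.sqrt (t + x) : ℝ) : ℂ) * v t x := by
  obtain ⟨-, e1, e2⟩ := hyp_coord h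
  simp only [TR, nl, unc, e1, e2]
  have e3 : Real.sqrt (Real.sqrt (t ^ 2 - x ^ 2)) * Real.exp (1 / 2 * ang (x / t)) = Real.sqrt (t + x) := by
    rw [← e1, Real.sqrt_mul (Real.sqrt_nonneg _), ← Real.exp_half]
    congr 2; ring
  rw [e3]; congr 2 <;> ring

theorem data_T {u : ℝ → ℝ → ℂ} (hu : ContDiffOn ℝ (⊤ : ℕ∞) (unc u) Hc) (hS : SchwartzLocUnif u)
    (he : wSobNorm (7/2) 5 (u 1) ≤ 1 / 10 ^ 12) :
    ∃ Ts > 1, ∀ T, 1 < T → T ≤ Ts → (∀ x, ‖nl (unc u) (T + x, T - x)‖ ≤ eta x) ∧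
      (∀ x, ‖Xd (nl (unc u)) (T + x, T - x)‖ ≤ eta x) ∧ ∀ x, ‖Xd (Xd (nl (unc u))) (T + x, T - x)‖ ≤ eta x := by
  have hb := data_bd hu hS he
  obtain ⟨T0, g0, h0⟩ := prop_short hu hS 0 (hb 0 (by norm_num))
  obtain ⟨T1, g1, h1⟩ := prop_short hu hS 1 (hb 1 (by norm_num))
  obtain ⟨T2, g2, h2⟩ := prop_short hu hS 2 (hb 2 (by norm_num))
  refine ⟨min T0 (min T1 T2), lt_min g0 (lt_min g1 g2), ?_⟩
  intro T hT hTs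
  have k0 : T ≤ T0 := hTs.trans (min_le_left _ _)
  have k1 : T ≤ T1 := hTs.trans ((min_le_right _ _).trans (min_le_left _ _))
  have k2 : T ≤ T2 := hTs.trans ((min_le_right _ _).trans (min_le_right _ _))
  have hz : ∀ x : ℝ, (T + x, T - x) ∈ N2 := fun x => by rw [mem_N2]; linarith
  have pe : ∀ (F : ℝ × ℝ → ℂ) (x : ℝ), nl F (T + x, T - x) = F (T, x) := by
    intro F x; simp only [nl]; congr 2 <;> ring
  have hm : ∀ x : ℝ, (T, x) ∈ O2 := fun x => hT
  refine ⟨fun x => ?_, fun x => ?_, fun x => ?_⟩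
  · rw [pe]; exact h0 T hT k0 x
  · rw [Xd_nl (cd_sm hu) _ (hz x), pe, ← px_d2 hu _ (hm x)]; exact h1 T hT k1 x
  · rw [XdXd_nl (cd_sm hu) _ (hz x), pe, ← d2_congr O2_open (px_d2 hu) _ (hm x), ← px_d2 (px_cd hu) _ (hm x)]
    exact h2 T hT k2 x

theorem rpow_half_inv {a : ℝ} (ha : 0 < a) : a ^ (-(1:ℝ)/2) * Real.sqrt a = 1 := by
  rw [Real.sqrt_eq_rpow, ← Real.rpow_add ha]; norm_num

theorem expI_norm (r : ℝ) : ‖Complex.exp (Complex.I * (r : ℂ))‖ = 1 := by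
  rw [mul_comm, Complex.norm_exp_ofReal_mul_I]

/-- turning the bound for the rescaled unknown into the bound for the unknown -/
theorem unscale {a K : ℝ} (ha : 0 < a) {w X : ℂ} (h : ‖((Real.sqrt a : ℝ) : ℂ) * w - X‖ ≤ K) :
    ‖w - ((a ^ (-(1:ℝ)/2) : ℝ) : ℂ) * X‖ ≤ K * a ^ (-(1:ℝ)/2) := by
  have e : w - ((a ^ (-(1:ℝ)/2) : ℝ) : ℂ) * X = ((a ^ (-(1:ℝ)/2) : ℝ) : ℂ) * (((Real.sqrt a : ℝ) : ℂ) * w - X) := by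
    rw [mul_sub, ← mul_assoc, ← Complex.ofReal_mul, rpow_half_inv ha]; simp
  have hp : 0 < a ^ (-(1:ℝ)/2) := by positivity
  rw [e, norm_mul, Complex.norm_real, Real.norm_eq_abs, abs_of_pos hp, mul_comm]
  exact mul_le_mul_of_nonneg_right h hp.le

theorem main_aux {u v : ℝ → ℝ → ℂ} (hu : ContDiffOn ℝ (⊤ : ℕ∞) (unc u) Hc)
    (hv : ContDiffOn ℝ (⊤ : ℕ∞) (unc v) Hc) (hSu : SchwartzLocUnif u) (hSv : SchwartzLocUnif v)
    (hT : Thirring u v) (heu : wSobNorm (7/2) 5 (u 1) ≤ 1 / 10 ^ 12) (hev : wSobNorm (7/2) 5 (v 1) ≤ 1 / 10 ^ 12) :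
    ∃ f g : ℝ → ℂ, Continuous f ∧ Continuous g ∧ (∀ y, ‖f y‖ ≤ 1/400) ∧ (∀ y, ‖g y‖ ≤ 1/400) ∧
      ∀ t x : ℝ, jb x ≤ t → ∀ P Q : ℂ,
        P = ph 1 (Real.sqrt (t ^ 2 - x ^ 2)) * (Complex.exp (Complex.I *
          ((‖f (ang (x / t))‖ ^ 2 * Real.log (Real.sqrt (t ^ 2 - x ^ 2)) : ℝ) : ℂ)) * f (ang (x / t))) →
        Q = ph (-1) (Real.sqrt (t ^ 2 - x ^ 2)) * (Complex.exp (Complex.I *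
          ((‖g (ang (x / t))‖ ^ 2 * Real.log (Real.sqrt (t ^ 2 - x ^ 2)) : ℝ) : ℂ)) * g (ang (x / t))) →
        ‖((Real.sqrt (t - x) : ℝ) : ℂ) * u t x - (P + Q)‖ ≤ 10 * Real.sqrt (t ^ 2 - x ^ 2) ^ (-(1:ℝ)/2) ∧
        ‖((Real.sqrt (t + x) : ℝ) : ℂ) * v t x - (P - Q)‖ ≤ 10 * Real.sqrt (t ^ 2 - x ^ 2) ^ (-(1:ℝ)/2) := by
  obtain ⟨Tu, gu, hTu⟩ := data_T hu hSu heu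
  obtain ⟨Tv, gv, hTv⟩ := data_T hv hSv hev
  have N := thirring_NS hu hv hT
  have S := N.sys
  set U := TR (-1/2) (nl (unc u)) with hU
  set V := TR (1/2) (nl (unc v)) with hV
  set Ts := min 2 (min Tu Tv) with hTs
  have gs : 1 < Ts := lt_min one_lt_two (lt_min gu gv)
  have k1 : Ts ≤ 2 := min_le_left _ _
  have k2 : Ts ≤ Tu := (min_le_right _ _).trans (min_le_left _ _)
  have k3 : Ts ≤ Tv := (min_le_right _ _).trans (min_le_right _ _)
  have hI : ∀ T, 1 < T → T ≤ Ts → Init U V (1/160000) T := by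
    intro T h1 h2
    obtain ⟨a0, a1, a2⟩ := hTu T h1 (h2.trans k2)
    obtain ⟨b0, b1, b2⟩ := hTv T h1 (h2.trans k3)
    exact N.startB h1 (h2.trans k1) a0 a1 a2 b0 b1 b2
  have hbd : ∀ ρ y, 1 < ρ → ‖U (ρ, y)‖ ≤ 1/400 ∧ ‖V (ρ, y)‖ ≤ 1/400 := by
    intro ρ y hρ
    have h1 : 1 < min ρ Ts := lt_min hρ gs
    exact (boot S (hI _ h1 (min_le_right _ _)) h1 (by norm_num) le_rfl).1 ρ y (min_le_left _ _)
  have hB := (boot S (hI Ts gs le_rfl) gs (by norm_num) le_rfl).2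
  have hpb : ∀ ς : ℝ, ς = 1 ∨ ς = -1 → ∀ r y, Ts ≤ r → ‖prof ς U V (r, y)‖ ≤ 1/400 := by
    intro ς hς r y hr
    have h1 := half_norm (-ς) r (U (r, y)) (V (r, y)) hς
    have h2 := hbd r y (by linarith)
    refine le_trans h1 ?_
    linarith [h2.1, h2.2]
  obtain ⟨f, fc, fb, fs⟩ := scat (sm_prof S 1) gs (hpb 1 (Or.inl rfl)) (hB 1 (Or.inl rfl))
  obtain ⟨g, gc, gb, gsc⟩ := scat (sm_prof S (-1)) gs (hpb (-1) (Or.inr rfl)) (hB (-1) (Or.inr rfl))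
  refine ⟨f, g, fc, gc, fb, gb, ?_⟩
  intro t x htx P Q hP hQ
  have hxt : |x| < t := (jb_lt x).trans_le htx
  set ρ := Real.sqrt (t ^ 2 - x ^ 2) with hρ
  set y := ang (x / t) with hy
  have jb1 : ∀ t', jb x ≤ t' → 1 + x ^ 2 ≤ t' ^ 2 := by
    intro t' h
    have h1 : jb x ^ 2 = 1 + x ^ 2 := Real.sq_sqrt (by positivity)
    have h0 : 0 ≤ jb x := Real.sqrt_nonneg _
    nlinarith
  have hρ1 : 1 ≤ ρ := by
    rw [hρ, Real.one_le_sqrt]; linarith [jb1 t htx]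
  have e35 : ρ ^ (-(3:ℝ)/5) ≤ ρ ^ (-(1:ℝ)/2) := Real.rpow_le_rpow_of_exponent_le hρ1 (by norm_num)
  have hpos : 0 < ρ ^ (-(1:ℝ)/2) := by positivity
  by_cases hc : Ts ≤ ρ
  · have a1 := fs ρ y hc
    have a2 := gsc ρ y hc
    obtain ⟨p1, p2⟩ := uv_prof U V (ρ, y)
    have q1 := TR_u u hxt
    have q2 := TR_v v hxt
    rw [← hU] at q1
    rw [← hV] at q2
    rw [← q1, ← q2, p1, p2]
    set A := prof 1 U V (ρ, y)
    set B := prof (-1) U V (ρ, y)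
    have n1 : ‖ph 1 ρ * A - P‖ ≤ 2 * ρ ^ (-(3:ℝ)/5) := by
      rw [hP, ← mul_sub, norm_mul, norm_ph, one_mul]; exact a1
    have n2 : ‖ph (-1) ρ * B - Q‖ ≤ 2 * ρ ^ (-(3:ℝ)/5) := by
      rw [hQ, ← mul_sub, norm_mul, norm_ph, one_mul]; exact a2
    constructor
    · have e : ph 1 ρ * A + ph (-1) ρ * B - (P + Q) = (ph 1 ρ * A - P) + (ph (-1) ρ * B - Q) := by ring
      show ‖ph 1 ρ * A + ph (-1) ρ * B - (P + Q)‖ ≤ _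
      rw [e]
      refine (norm_add_le _ _).trans ?_
      linarith
    · have e : ph 1 ρ * A - ph (-1) ρ * B - (P - Q) = (ph 1 ρ * A - P) - (ph (-1) ρ * B - Q) := by ring
      show ‖ph 1 ρ * A - ph (-1) ρ * B - (P - Q)‖ ≤ _
      rw [e]
      refine (norm_sub_le _ _).trans ?_
      linarith
  · have hρ2 : ρ ≤ 2 := by linarith
    have hlow : 1/2 ≤ ρ ^ (-(1:ℝ)/2) := by
      have h1 : ρ ^ (-(1:ℝ)) ≤ ρ ^ (-(1:ℝ)/2) := Real.rpow_le_rpow_of_exponent_le hρ1 (by norm_num)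
      rw [Real.rpow_neg_one] at h1
      have h2 : (2:ℝ)⁻¹ ≤ ρ⁻¹ := inv_anti₀ (by linarith) hρ2
      linarith
    have nP : ‖P‖ ≤ 1/400 := by
      rw [hP, norm_mul, norm_mul, norm_ph, expI_norm, one_mul, one_mul]; exact fb _
    have nQ : ‖Q‖ ≤ 1/400 := by
      rw [hQ, norm_mul, norm_mul, norm_ph, expI_norm, one_mul, one_mul]; exact gb _
    have strict : ∀ t', t < t' → ‖((Real.sqrt (t' - x) : ℝ) : ℂ) * u t' x‖ ≤ 1/400 ∧
        ‖((Real.sqrt (t' + x) : ℝ) : ℂ) * v t' x‖ ≤ 1/400 := by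
      intro t' ht'
      have h1 : |x| < t' := hxt.trans ht'
      rw [← TR_u u h1, ← TR_v v h1]
      refine hbd _ _ ?_
      have h2 := jb1 t htx
      have h3 : 0 ≤ t := le_trans (abs_nonneg x) hxt.le
      refine Real.lt_sqrt_of_sq_lt ?_
      nlinarith
    have ht1 : 1 ≤ t := by
      have h3 : 0 ≤ t := le_trans (abs_nonneg x) hxt.le
      nlinarith [jb1 t htx]
    have cw : ∀ w : ℝ → ℝ → ℂ, ContDiffOn ℝ (⊤ : ℕ∞) (unc w) Hc →
        ContinuousWithinAt (fun s : ℝ => w s x) (Set.Ioi t) t := by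
      intro w hw
      have h6 : ContinuousWithinAt (unc w) Hc (t, x) := hw.continuousOn (t, x) ht1
      exact ContinuousWithinAt.comp (f := fun s : ℝ => (s, x)) (t := Hc) h6 (by fun_prop)
        (fun s hs => ht1.trans (le_of_lt (show t < s from hs)))
    have cu : ContinuousWithinAt (fun s : ℝ => ((Real.sqrt (s - x) : ℝ) : ℂ) * u s x) (Set.Ioi t) t :=
      ContinuousWithinAt.mul (Continuous.continuousWithinAt (by fun_prop)) (cw u hu)
    have cv : ContinuousWithinAt (fun s : ℝ => ((Real.sqrt (s + x) : ℝ) : ℂ) * v s x) (Set.Ioi t) t :=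
      ContinuousWithinAt.mul (Continuous.continuousWithinAt (by fun_prop)) (cw v hv)
    have bu : ‖((Real.sqrt (t - x) : ℝ) : ℂ) * u t x‖ ≤ 1/400 := by
      refine le_of_tendsto cu.norm ?_
      filter_upwards [self_mem_nhdsWithin] with s hs using (strict s hs).1
    have bv : ‖((Real.sqrt (t + x) : ℝ) : ℂ) * v t x‖ ≤ 1/400 := by
      refine le_of_tendsto cv.norm ?_
      filter_upwards [self_mem_nhdsWithin] with s hs using (strict s hs).2
    constructor
    · refine (norm_sub_le _ _).trans ?_
      have := norm_add_le P Q
      linarith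
    · refine (norm_sub_le _ _).trans ?_
      have := norm_sub_le P Q
      linarith

/-- modified (long range) scattering of small solutions of the Thirring model
in the interior region t ≥ ⟨x⟩, with logarithmic phase correction. -/
theorem cubic_dirac_modified_scattering :
    ∃ ε > (0 : ℝ), ∃ C > (0 : ℝ), ∀ u v : ℝ → ℝ → ℂ,
      ContDiffOn ℝ (⊤ : ℕ∞) (fun p : ℝ × ℝ => u p.1 p.2) {p : ℝ × ℝ | 1 ≤ p.1} →
      ContDiffOn ℝ (⊤ : ℕ∞) (fun p : ℝ × ℝ => v p.1 p.2) {p : ℝ × ℝ | 1 ≤ p.1} →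
      SchwartzLocUnif u → SchwartzLocUnif v →
      Thirring u v →
      wSobNorm (7 / 2) 5 (u 1) + wSobNorm (7 / 2) 5 (v 1) ≤ ε →
      ∃ fp fm : ℝ → ℂ,
        ContinuousOn fp (Set.Ioo (-1) 1) ∧ ContinuousOn fm (Set.Ioo (-1) 1) ∧
        (∃ B : ℝ, ∀ s ∈ Set.Ioo (-1 : ℝ) 1, ‖fp s‖ ≤ B ∧ ‖fm s‖ ≤ B) ∧
        ∀ t x : ℝ, jb x ≤ t →
          ‖u t x - (((t - x) ^ (-(1 : ℝ) / 2) : ℝ) : ℂ) *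
              (Complex.exp (Complex.I * (Real.sqrt (t ^ 2 - x ^ 2) : ℝ)) *
                 Complex.exp (Complex.I *
                   ((‖fp (x / t)‖ ^ 2 * Real.log (Real.sqrt (t ^ 2 - x ^ 2)) : ℝ) : ℂ)) *
                 fp (x / t) +
               Complex.exp (-Complex.I * (Real.sqrt (t ^ 2 - x ^ 2) : ℝ)) *
                 Complex.exp (Complex.I *
                   ((‖fm (x / t)‖ ^ 2 * Real.log (Real.sqrt (t ^ 2 - x ^ 2)) : ℝ) : ℂ)) *
                 fm (x / t))‖
            ≤ C * Real.sqrt (t ^ 2 - x ^ 2) ^ (-(1 : ℝ) / 2) * (t - x) ^ (-(1 : ℝ) / 2) ∧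
          ‖v t x - (((t + x) ^ (-(1 : ℝ) / 2) : ℝ) : ℂ) *
              (Complex.exp (Complex.I * (Real.sqrt (t ^ 2 - x ^ 2) : ℝ)) *
                 Complex.exp (Complex.I *
                   ((‖fp (x / t)‖ ^ 2 * Real.log (Real.sqrt (t ^ 2 - x ^ 2)) : ℝ) : ℂ)) *
                 fp (x / t) -
               Complex.exp (-Complex.I * (Real.sqrt (t ^ 2 - x ^ 2) : ℝ)) *
                 Complex.exp (Complex.I *
                   ((‖fm (x / t)‖ ^ 2 * Real.log (Real.sqrt (t ^ 2 - x ^ 2)) : ℝ) : ℂ)) *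
                 fm (x / t))‖
            ≤ C * Real.sqrt (t ^ 2 - x ^ 2) ^ (-(1 : ℝ) / 2) * (t + x) ^ (-(1 : ℝ) / 2) := by
  refine ⟨1 / 10 ^ 12, by positivity, 10, by norm_num, ?_⟩
  intro u v hu hv hSu hSv hT he
  have n1 : 0 ≤ wSobNorm (7 / 2) 5 (u 1) := Real.sqrt_nonneg _
  have n2 : 0 ≤ wSobNorm (7 / 2) 5 (v 1) := Real.sqrt_nonneg _
  obtain ⟨f, g, fc, gc, fb, gb, h⟩ := main_aux (u := u) (v := v) hu hv hSu hSv hT (by linarith) (by linarith)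
  refine ⟨fun s => f (ang s), fun s => g (ang s), fc.comp_continuousOn ang_cont, gc.comp_continuousOn ang_cont,
    ⟨1/400, fun s _ => ⟨fb _, gb _⟩⟩, ?_⟩
  intro t x htx
  obtain ⟨h1, h2⟩ := abs_lt.1 ((jb_lt x).trans_le htx)
  have e1 : ∀ r : ℝ, Complex.exp (Complex.I * (r : ℂ)) = ph 1 r := by
    intro r; simp [ph]
  have e2 : ∀ r : ℝ, Complex.exp (-Complex.I * (r : ℂ)) = ph (-1) r := by
    intro r; simp [ph]
  obtain ⟨a, b⟩ := h t x htx _ _ rfl rfl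
  constructor
  · refine le_trans (le_of_eq ?_) (unscale (by linarith) a)
    rw [e1 (Real.sqrt (t ^ 2 - x ^ 2)), e2 (Real.sqrt (t ^ 2 - x ^ 2)), mul_assoc (ph 1 _), mul_assoc (ph (-1) _)]
  · refine le_trans (le_of_eq ?_) (unscale (by linarith) b)
    rw [e1 (Real.sqrt (t ^ 2 - x ^ 2)), e2 (Real.sqrt (t ^ 2 - x ^ 2)), mul_assoc (ph 1 _), mul_assoc (ph (-1) _)]
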